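/- Let 1 < p, q < ∞, 1 ≤ r, s ≤ 2 with max(r,s) = 2, let t = rs/(r+s), and let N > 0. There exists a constant C such that for every pair of continuous Littlewood–Paley families (f_i)_{i∈ℤ} and (g_j)_{j∈ℤ}, each with band width N, every jump collection (N_k)_{k≥0}, and every λ > 0, one has ‖ λ · (#{k ≥ 1 : |Σ_{N_{k−1}(x) < i < j ≤ N_k(x)} f_i(x) g_j(x)| > λ})^{1/t} ‖_{pq/(p+q)} ≤ C ‖(f_i)‖_{p,r} ‖(g_j)‖_{q,s}. -/

import Mathlib

open MeasureTheory ENNReal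
open scoped FourierTransform NNReal

noncomputable section

/-- A jump collection: a sequence of measurable integer-valued functions on `ℝ`,
nondecreasing in the index. -/
def IsJumpCollection (Nk : ℕ → ℝ → ℤ) : Prop :=
  (∀ k, Measurable (Nk k)) ∧ ∀ (k : ℕ) (x : ℝ), Nk k x ≤ Nk (k + 1) x

/-- A continuous Littlewood–Paley family with band width `Nb`. -/
def IsContLPFamily (Nb : ℝ) (f : ℤ → SchwartzMap ℝ ℂ) : Prop :=
  ∀ i : ℤ, ∀ ξ : ℝ, 𝓕 (⇑(f i)) ξ ≠ 0 →
    (2 : ℝ) ^ ((i : ℝ) - Nb) < |ξ| ∧ |ξ| < (2 : ℝ) ^ ((i : ℝ) + Nb)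

/-- The mixed norm `‖(f_i)‖_{p,r} = ‖(∑_i |f_i|^r)^(1/r)‖_{L^p}` for a family of
Schwartz functions. -/
def mixedNorm (p r : ℝ) (f : ℤ → SchwartzMap ℝ ℂ) : ℝ≥0∞ :=
  (∫⁻ x : ℝ, ((∑' i : ℤ, (ENNReal.ofReal (‖f i x‖)) ^ r) ^ (1 / r)) ^ p) ^ (1 / p)

/-! ## Maximal function -/

def cBall (h : ℝ → ℝ≥0∞) (x : ℝ) : ℝ≥0∞ :=
  ⨆ j : ℤ, ENNReal.ofReal ((2:ℝ)^(-j)) * ∫⁻ y in Metric.closedBall x ((2:ℝ)^j), h y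

def wk (m : ℤ) (x y : ℝ) : ℝ≥0∞ := ENNReal.ofReal ((2:ℝ)^m/(1+(2:ℝ)^m*|x-y|)^2)

def Av (m : ℤ) (h : ℝ → ℝ≥0∞) (x : ℝ) : ℝ≥0∞ := ∫⁻ y, wk m x y * h y

def Mx (h : ℝ → ℝ≥0∞) (x : ℝ) : ℝ≥0∞ := ⨆ m : ℤ, Av m h x

lemma wk_symm (m : ℤ) (x y : ℝ) : wk m x y = wk m y x := by
  unfold wk; rw [abs_sub_comm]

lemma measurable_wk2 (m : ℤ) : Measurable (fun z : ℝ × ℝ => wk m z.1 z.2) := by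
  unfold wk
  fun_prop

lemma measurable_wk (m : ℤ) (x : ℝ) : Measurable (wk m x) := by
  unfold wk
  fun_prop

lemma measurable_Av (m : ℤ) {h : ℝ → ℝ≥0∞} (hh : Measurable h) : Measurable (Av m h) := by
  unfold Av
  apply Measurable.lintegral_prod_right' (f := fun z : ℝ × ℝ => wk m z.1 z.2 * h z.2)
  exact (measurable_wk2 m).mul (hh.comp measurable_snd)

lemma measurable_Mx {h : ℝ → ℝ≥0∞} (hh : Measurable h) : Measurable (Mx h) := by
  unfold Mx
  exact Measurable.iSup fun m => measurable_Av m hh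

lemma Av_le_Mx (m : ℤ) (h : ℝ → ℝ≥0∞) (x : ℝ) : Av m h x ≤ Mx h x :=
  le_iSup (fun m => Av m h x) m

lemma Av_mono (m : ℤ) {h g : ℝ → ℝ≥0∞} (hg : ∀ y, h y ≤ g y) (x : ℝ) : Av m h x ≤ Av m g x := by
  unfold Av
  gcongr with y
  exact hg y

lemma Mx_mono {h g : ℝ → ℝ≥0∞} (hg : ∀ y, h y ≤ g y) (x : ℝ) : Mx h x ≤ Mx g x := by
  unfold Mx
  gcongr with y
  exact Av_mono _ hg x

lemma wk_le_tsum (m : ℤ) (x y : ℝ) : wk m x y ≤ ∑' l : ℕ, ENNReal.ofReal (4 * (2:ℝ)^(-(l:ℤ)))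
    * (ENNReal.ofReal ((2:ℝ)^(-((l:ℤ)-m))) * (Metric.closedBall x ((2:ℝ)^((l:ℤ)-m))).indicator 1 y) := by
  set z := (2:ℝ)^m * |x-y| with hz
  have hm : (0:ℝ) < (2:ℝ)^m := by positivity
  have hz0 : 0 ≤ z := by positivity
  obtain ⟨l, hl1, hl2⟩ : ∃ l : ℕ, z ≤ (2:ℝ)^l ∧ (2:ℝ)^l ≤ 2 * (1+z) := by
    have hex : ∃ l : ℕ, z ≤ (2:ℝ)^l := by
      obtain ⟨l, hl⟩ := pow_unbounded_of_one_lt z (by norm_num : (1:ℝ) < 2)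
      exact ⟨l, hl.le⟩
    classical
    refine ⟨Nat.find hex, Nat.find_spec hex, ?_⟩
    rcases Nat.eq_zero_or_pos (Nat.find hex) with h0 | h0
    · rw [h0]; norm_num; linarith
    · have := Nat.find_min hex (m := Nat.find hex - 1) (by omega)
      push Not at this
      have e : (2:ℝ)^(Nat.find hex) = 2 * 2^(Nat.find hex - 1) := by
        rw [← pow_succ']; congr 1; omega
      rw [e]; linarith
  refine le_trans ?_ (ENNReal.le_tsum l)
  have hmem : y ∈ Metric.closedBall x ((2:ℝ)^((l:ℤ)-m)) := by
    rw [Metric.mem_closedBall, Real.dist_eq, abs_sub_comm, zpow_sub₀ (by norm_num), le_div_iff₀ hm]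
    rw [mul_comm]; simpa using hl1
  rw [Set.indicator_of_mem hmem, Pi.one_apply, mul_one, ← ENNReal.ofReal_mul (by positivity)]
  unfold wk
  apply ENNReal.ofReal_le_ofReal
  rw [← hz, div_le_iff₀ (by positivity)]
  have e2 : 4 * (2:ℝ)^(-(l:ℤ)) * (2:ℝ)^(-((l:ℤ)-m)) = 4 * (2:ℝ)^m / ((2:ℝ)^l)^2 := by
    rw [neg_sub, zpow_sub₀ (by norm_num), zpow_neg, zpow_natCast]
    field_simp
  rw [e2, div_mul_eq_mul_div, le_div_iff₀ (by positivity)]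
  have : ((2:ℝ)^l)^2 ≤ (2*(1+z))^2 := by gcongr
  nlinarith

lemma Av_le_cBall (m : ℤ) {h : ℝ → ℝ≥0∞} (hh : Measurable h) (x : ℝ) : Av m h x ≤ 8 * cBall h x := by
  unfold Av
  calc ∫⁻ y, wk m x y * h y ≤ ∫⁻ y, ∑' l : ℕ, ENNReal.ofReal (4 * (2:ℝ)^(-(l:ℤ)))
    * (ENNReal.ofReal ((2:ℝ)^(-((l:ℤ)-m))) * (Metric.closedBall x ((2:ℝ)^((l:ℤ)-m))).indicator h y) := by
        gcongr with y
        refine (mul_le_mul_left (wk_le_tsum m x y) (h y)).trans ?_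
        rw [← ENNReal.tsum_mul_right]
        refine ENNReal.tsum_le_tsum fun l => ?_
        rw [mul_assoc, mul_assoc]
        refine mul_le_mul_right (mul_le_mul_right ?_ _) _
        by_cases hy : y ∈ (Metric.closedBall x ((2:ℝ)^((l:ℤ)-m)))
        · simp [hy]
        · simp [hy]
    _ = ∑' l : ℕ, ENNReal.ofReal (4 * (2:ℝ)^(-(l:ℤ))) * (ENNReal.ofReal ((2:ℝ)^(-((l:ℤ)-m))) *
          ∫⁻ y in Metric.closedBall x ((2:ℝ)^((l:ℤ)-m)), h y) := by
        rw [lintegral_tsum]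
        · congr 1; ext l
          rw [lintegral_const_mul, lintegral_const_mul, lintegral_indicator]
          · exact Metric.isClosed_closedBall.measurableSet
          · exact hh.indicator Metric.isClosed_closedBall.measurableSet
          · exact (hh.indicator Metric.isClosed_closedBall.measurableSet).const_mul _
        · intro l
          exact (((hh.indicator Metric.isClosed_closedBall.measurableSet).const_mul _).const_mul _).aemeasurable
    _ ≤ ∑' l : ℕ, ENNReal.ofReal (4 * (2:ℝ)^(-(l:ℤ))) * cBall h x := by
        gcongr with l
        exact le_iSup (fun j : ℤ => ENNReal.ofReal ((2:ℝ)^(-j)) * ∫⁻ y in Metric.closedBall x ((2:ℝ)^j), h y) ((l:ℤ)-m)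
    _ ≤ 8 * cBall h x := by
        rw [ENNReal.tsum_mul_right]
        gcongr
        have : ∀ l : ℕ, 4 * (2:ℝ)^(-(l:ℤ)) = 4 * (1/2)^l := by
          intro l; rw [zpow_neg, zpow_natCast]; simp
        simp_rw [this]
        rw [← ENNReal.ofReal_tsum_of_nonneg (fun l => by positivity)
          ((summable_geometric_two).mul_left 4), tsum_mul_left, tsum_geometric_two]
        norm_num

lemma Mx_le_cBall {h : ℝ → ℝ≥0∞} (hh : Measurable h) (x : ℝ) : Mx h x ≤ 8 * cBall h x :=
  iSup_le fun m => Av_le_cBall m hh x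

lemma Mx_const_le (c : ℝ≥0∞) (x : ℝ) : Mx (fun _ => c) x ≤ 16 * c := by
  refine (Mx_le_cBall measurable_const x).trans ?_
  have : cBall (fun _ => c) x ≤ 2 * c := by
    unfold cBall
    apply iSup_le
    intro j
    rw [lintegral_const, Measure.restrict_apply MeasurableSet.univ, Set.univ_inter,
      Real.volume_closedBall, mul_comm c, ← mul_assoc, ← ENNReal.ofReal_mul (by positivity)]
    gcongr
    have : (2:ℝ)^(-j) * (2 * 2^j) = 2 := by
      rw [zpow_neg]; field_simp
    rw [this]; norm_num
  calc 8 * cBall (fun _ => c) x ≤ 8 * (2 * c) := by gcongr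
    _ = 16 * c := by rw [← mul_assoc]; norm_num

lemma cBall_weak {h : ℝ → ℝ≥0∞} (s : ℝ) (hs : 0 < s) :
    ENNReal.ofReal s * volume {x | ENNReal.ofReal s < cBall h x} ≤ 10 * ∫⁻ y, h y := by
  by_cases hI : ∫⁻ y, h y = ⊤
  · rw [hI]; simp
  set I := (∫⁻ y, h y).toReal with hIdef
  set E := {x | ENNReal.ofReal s < cBall h x}
  have hE : ∀ x, x ∈ E → ∃ j : ℤ, ENNReal.ofReal (s * (2:ℝ)^j) < ∫⁻ y in Metric.closedBall x ((2:ℝ)^j), h y := by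
    intro x hx
    obtain ⟨j, hj⟩ := lt_iSup_iff.mp (show ENNReal.ofReal s < ⨆ j : ℤ, _ from hx)
    refine ⟨j, ?_⟩
    rw [ENNReal.ofReal_mul hs.le]
    rw [zpow_neg, ENNReal.ofReal_inv_of_pos (by positivity), mul_comm] at hj
    by_contra hcon
    push Not at hcon
    have h1 : (∫⁻ y in Metric.closedBall x ((2:ℝ)^j), h y) * (ENNReal.ofReal ((2:ℝ)^j))⁻¹ ≤
      ENNReal.ofReal s * ENNReal.ofReal ((2:ℝ)^j) * (ENNReal.ofReal ((2:ℝ)^j))⁻¹ := by gcongr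
    rw [mul_assoc, ENNReal.mul_inv_cancel (by simp; positivity) (by simp), mul_one] at h1
    exact absurd hj (not_lt.mpr h1)
  choose! j hj using hE
  obtain ⟨u, huE, hud, hu⟩ := Vitali.exists_disjoint_subfamily_covering_enlargement_closedBall E
    (fun x => x) (fun x => (2:ℝ)^(j x)) (I / s) (by
      intro a ha
      rw [le_div_iff₀ hs, mul_comm]
      have := (hj a ha).le.trans (setLIntegral_le_lintegral _ _)
      rw [← ENNReal.ofReal_toReal hI] at this
      exact (ENNReal.ofReal_le_ofReal_iff ENNReal.toReal_nonneg).mp this) 5 (by norm_num)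
  have huc : u.Countable := by
    have hd2 : u.PairwiseDisjoint (fun a => Metric.ball a ((2:ℝ)^(j a))) := by
      intro a ha b hb hab
      exact (hud ha hb hab).mono Metric.ball_subset_closedBall Metric.ball_subset_closedBall
    exact hd2.countable_of_isOpen (fun a _ => Metric.isOpen_ball)
      (fun a _ => ⟨a, Metric.mem_ball_self (by positivity)⟩)
  have hcov : E ⊆ ⋃ b ∈ u, Metric.closedBall b (5 * (2:ℝ)^(j b)) := by
    intro a ha
    obtain ⟨b, hb, hab⟩ := hu a ha
    simp only [Set.mem_iUnion]
    exact ⟨b, hb, hab (Metric.mem_closedBall_self (by positivity))⟩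
  have : Countable u := huc.to_subtype
  calc ENNReal.ofReal s * volume E ≤ ENNReal.ofReal s * ∑' b : u, volume (Metric.closedBall (b:ℝ) (5 * (2:ℝ)^(j b))) := by
        gcongr
        exact (measure_mono hcov).trans (measure_biUnion_le _ huc _)
    _ = ∑' b : u, 10 * ENNReal.ofReal (s * (2:ℝ)^(j b)) := by
        rw [← ENNReal.tsum_mul_left]
        congr 1; ext b
        rw [Real.volume_closedBall, ← ENNReal.ofReal_mul hs.le, show (10:ℝ≥0∞) = ENNReal.ofReal 10 by norm_num,
          ← ENNReal.ofReal_mul (by norm_num)]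
        congr 1; ring
    _ ≤ ∑' b : u, 10 * ∫⁻ y in Metric.closedBall (b:ℝ) ((2:ℝ)^(j b)), h y := by
        gcongr with b
        exact (hj b (huE b.2)).le
    _ = 10 * ∫⁻ y in ⋃ b : u, Metric.closedBall (b:ℝ) ((2:ℝ)^(j b)), h y := by
        rw [ENNReal.tsum_mul_left, lintegral_iUnion]
        · intro b; exact Metric.isClosed_closedBall.measurableSet
        · intro a b hab
          exact hud a.2 b.2 (fun h => hab (Subtype.ext h))
    _ ≤ 10 * ∫⁻ y, h y := mul_le_mul_right (setLIntegral_le_lintegral _ _) _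

lemma Mx_weak {h : ℝ → ℝ≥0∞} (hh : Measurable h) (s : ℝ) (hs : 0 < s) :
    ENNReal.ofReal s * volume {x | ENNReal.ofReal s < Mx h x} ≤ 80 * ∫⁻ y, h y := by
  have h1 := cBall_weak (h := h) (s/8) (by positivity)
  have h2 : {x | ENNReal.ofReal s < Mx h x} ⊆ {x | ENNReal.ofReal (s/8) < cBall h x} := by
    intro x hx
    simp only [Set.mem_ofPred_eq] at hx ⊢
    have := hx.trans_le (Mx_le_cBall hh x)
    rw [show s = 8 * (s/8) by ring, ENNReal.ofReal_mul (by norm_num)] at this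
    by_contra hc
    push Not at hc
    have : 8 * cBall h x ≤ ENNReal.ofReal 8 * ENNReal.ofReal (s/8) := by
      rw [show (8:ℝ≥0∞) = ENNReal.ofReal 8 by norm_num]; gcongr
    exact absurd ‹_ < _› (not_lt.mpr this)
  calc ENNReal.ofReal s * volume {x | ENNReal.ofReal s < Mx h x} ≤
      ENNReal.ofReal (8 * (s/8)) * volume {x | ENNReal.ofReal (s/8) < cBall h x} := by
        rw [show 8 * (s/8) = s by ring]
        gcongr
    _ ≤ 8 * (10 * ∫⁻ y, h y) := by
        rw [ENNReal.ofReal_mul (by norm_num), mul_assoc]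
        norm_num
        gcongr
    _ = _ := by rw [← mul_assoc]; norm_num

/-! ### layer cake -/
lemma layer_fin (P : ℝ) (hP : 0 < P) (a : ℝ) (ha : 0 ≤ a) :
    ∫⁻ s in Set.Ioc 0 a, ENNReal.ofReal (P * s^(P-1)) = ENNReal.ofReal a ^ P := by
  have hIntg : IntegrableOn (fun s : ℝ => P * s^(P-1)) (Set.Ioc 0 a) := by
    have := (intervalIntegral.intervalIntegrable_rpow' (a := 0) (b := a) (r := P-1) (by linarith)).const_mul P
    rwa [intervalIntegrable_iff_integrableOn_Ioc_of_le ha] at this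
  rw [← ofReal_integral_eq_lintegral_ofReal hIntg]
  · rw [← intervalIntegral.integral_of_le ha, intervalIntegral.integral_const_mul,
      integral_rpow (Or.inl (by linarith)), ENNReal.ofReal_rpow_of_nonneg ha hP.le]
    congr 1
    rw [sub_add_cancel, Real.zero_rpow hP.ne']
    field_simp; simp
  · filter_upwards [ae_restrict_mem measurableSet_Ioc] with s hs
    have := hs.1
    simp only [Pi.zero_apply]
    positivity

lemma layer (P : ℝ) (hP : 0 < P) (a : ℝ≥0∞) :
    ∫⁻ s in Set.Ioi (0:ℝ), (ENNReal.ofReal (P * s^(P-1))) * ({s : ℝ | ENNReal.ofReal s < a}.indicator 1 s) = a ^ P := by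
  have key : ∀ b : ℝ, 0 ≤ b → ∫⁻ s in Set.Ioi (0:ℝ), (ENNReal.ofReal (P * s^(P-1))) * ((Set.Iio b).indicator 1 s) = ENNReal.ofReal b ^ P := by
    intro b hb
    rw [← layer_fin P hP b hb, ← restrict_Ioo_eq_restrict_Ioc, ← lintegral_indicator measurableSet_Ioi,
      ← lintegral_indicator measurableSet_Ioo]
    congr 1; ext s
    by_cases h1 : 0 < s <;> by_cases h2 : s < b <;> simp [Set.indicator, h1, h2]
  by_cases ha : a = ⊤
  · subst ha
    rw [ENNReal.top_rpow_of_pos hP]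
    apply ENNReal.eq_top_of_forall_nnreal_le
    intro r
    have h1 := key ((r:ℝ)^(1/P)) (by positivity)
    rw [ENNReal.ofReal_rpow_of_nonneg (by positivity) hP.le, ← Real.rpow_mul (by positivity), one_div_mul_cancel hP.ne', Real.rpow_one, ENNReal.ofReal_coe_nnreal] at h1
    rw [← h1]
    gcongr with s
    intro x _; simp
  · rw [← ENNReal.ofReal_toReal ha, ← key _ ENNReal.toReal_nonneg]
    apply setLIntegral_congr_fun measurableSet_Ioi
    intro s hs
    simp only
    congr 1
    by_cases h : s < a.toReal
    · simp [h, ENNReal.ofReal_lt_ofReal_iff (lt_trans hs h), Set.indicator]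
    · simp only [Set.indicator, Set.mem_ofPred_eq, Set.mem_Iio, h, if_false]
      rw [if_neg]
      intro hc
      exact h ((ENNReal.ofReal_lt_ofReal_iff_of_nonneg (le_of_lt hs)).mp hc)

lemma Mx_weak' {h : ℝ → ℝ≥0∞} (hh : Measurable h) (s : ℝ) (hs : 0 < s) :
    ENNReal.ofReal s * volume {x | ENNReal.ofReal s < Mx h x} ≤
      160 * ∫⁻ y, {y | ENNReal.ofReal (s/32) < h y}.indicator h y := by
  set S := {y | ENNReal.ofReal (s/32) < h y} with hS
  have hSm : MeasurableSet S := measurableSet_lt measurable_const hh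
  have h1 := Mx_weak (hh.indicator hSm) (s/2) (by positivity)
  have hle : ∀ x, Mx h x ≤ Mx (S.indicator h) x + ENNReal.ofReal (s/2) := by
    intro x
    apply iSup_le
    intro m
    have : ∀ y, h y ≤ S.indicator h y + ENNReal.ofReal (s/32) := by
      intro y
      by_cases hy : y ∈ S
      · simp [hy]
      · simp only [hy, not_false_eq_true, Set.indicator_of_notMem, zero_add]
        simpa [hS] using hy
    refine (Av_mono m this x).trans ?_
    have e : Av m (fun y => S.indicator h y + ENNReal.ofReal (s/32)) x = Av m (S.indicator h) x
        + Av m (fun _ => ENNReal.ofReal (s/32)) x := by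
      unfold Av
      rw [← lintegral_add_left (f := fun y => wk m x y * S.indicator h y) ((measurable_wk m x).mul (hh.indicator hSm))]
      simp_rw [mul_add]
    rw [e]
    gcongr
    · exact Av_le_Mx _ _ _
    · refine (Av_le_Mx _ _ _).trans ((Mx_const_le _ _).trans ?_)
      rw [show (16:ℝ≥0∞) = ENNReal.ofReal 16 by norm_num, ← ENNReal.ofReal_mul (by norm_num)]
      apply ENNReal.ofReal_le_ofReal; linarith
  have h2 : {x | ENNReal.ofReal s < Mx h x} ⊆ {x | ENNReal.ofReal (s/2) < Mx (S.indicator h) x} := by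
    intro x hx
    simp only [Set.mem_ofPred_eq] at hx ⊢
    have := hx.trans_le (hle x)
    by_contra hc
    push Not at hc
    have h3 : Mx (S.indicator h) x + ENNReal.ofReal (s/2) ≤ ENNReal.ofReal s := by
      calc _ ≤ ENNReal.ofReal (s/2) + ENNReal.ofReal (s/2) := by gcongr
        _ = ENNReal.ofReal s := by rw [← ENNReal.ofReal_add (by positivity) (by positivity)]; congr 1; ring
    exact absurd this (not_lt.mpr h3)
  calc ENNReal.ofReal s * volume {x | ENNReal.ofReal s < Mx h x} ≤
      ENNReal.ofReal (2 * (s/2)) * volume {x | ENNReal.ofReal (s/2) < Mx (S.indicator h) x} := by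
        rw [show 2 * (s/2) = s by ring]
        gcongr
    _ ≤ 2 * (80 * ∫⁻ y, S.indicator h y) := by
        rw [ENNReal.ofReal_mul (by norm_num), mul_assoc]
        norm_num
        gcongr
    _ = _ := by rw [← mul_assoc]; norm_num

lemma Mx_strong (P : ℝ) (hP : 1 < P) : ∃ C : ℝ≥0, ∀ h : ℝ → ℝ≥0∞, Measurable h →
    ∫⁻ x, (Mx h x) ^ P ≤ C * ∫⁻ x, (h x) ^ P := by
  have hP1 : 0 < P - 1 := by linarith
  refine ⟨(160 * (P / (P-1)) * 32^(P-1)).toNNReal, ?_⟩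
  intro h hh
  have hMm := measurable_Mx hh
  have meas1 : ∀ {φ : ℝ → ℝ≥0∞} (_ : Measurable φ) , MeasurableSet {z : ℝ × ℝ | ENNReal.ofReal z.2 < φ z.1} := by
    intro φ hφ
    exact measurableSet_lt (by fun_prop) (by fun_prop)
  have step1 : ∫⁻ x, (Mx h x) ^ P = ∫⁻ s in Set.Ioi (0:ℝ), ENNReal.ofReal (P * s^(P-1)) * volume {x | ENNReal.ofReal s < Mx h x} := by
    simp_rw [← layer P (by linarith) (Mx h _)]
    rw [lintegral_lintegral_swap]
    · congr 1; ext s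
      rw [lintegral_const_mul]
      · congr 1
        rw [← lintegral_indicator_one (measurableSet_lt measurable_const hMm)]
        rfl
      · exact measurable_one.indicator (measurableSet_lt measurable_const hMm)
    · apply Measurable.aemeasurable
      apply Measurable.mul
      · fun_prop
      · exact measurable_one.indicator (meas1 hMm)
  have step2 : ∫⁻ x, (Mx h x) ^ P ≤ ∫⁻ s in Set.Ioi (0:ℝ), ∫⁻ y, 160 * ENNReal.ofReal (P * s^(P-1-1)) * {y | ENNReal.ofReal (s/32) < h y}.indicator h y := by
    rw [step1]
    apply setLIntegral_mono'  measurableSet_Ioi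
    intro s hs
    have hs' : 0 < s := hs
    rw [lintegral_const_mul _ (hh.indicator (measurableSet_lt measurable_const hh))]
    have e : P * s^(P-1) = P * s^(P-1-1) * s := by
      rw [mul_assoc, ← Real.rpow_add_one hs'.ne']; congr 2; ring
    rw [e, ENNReal.ofReal_mul (by positivity), mul_assoc, mul_comm (160:ℝ≥0∞), mul_assoc]
    exact mul_le_mul_right (Mx_weak' hh s hs') _
  refine step2.trans ?_
  rw [lintegral_lintegral_swap]
  · have e3 : ∀ y, ∫⁻ s in Set.Ioi (0:ℝ), 160 * ENNReal.ofReal (P * s^(P-1-1)) * {y | ENNReal.ofReal (s/32) < h y}.indicator h y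
        = ENNReal.ofReal (160 * (P / (P-1)) * 32^(P-1)) * h y ^ P := by
      intro y
      have e4 : ∀ s : ℝ, 160 * ENNReal.ofReal (P * s^(P-1-1)) * {y | ENNReal.ofReal (s/32) < h y}.indicator h y
        = (ENNReal.ofReal (160 * (P / (P-1))) * h y) * (ENNReal.ofReal ((P-1) * s^(P-1-1)) * {s : ℝ | ENNReal.ofReal s < 32 * h y}.indicator 1 s) := by
        intro s
        have hiff : ENNReal.ofReal (s/32) < h y ↔ ENNReal.ofReal s < 32 * h y := by
          rw [ENNReal.ofReal_div_of_pos (by norm_num), ENNReal.div_lt_iff (by simp) (by simp), mul_comm]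
          norm_num
        have e5 : 160 * ENNReal.ofReal (P * s^(P-1-1)) = ENNReal.ofReal (160 * (P/(P-1))) * ENNReal.ofReal ((P-1) * s^(P-1-1)) := by
          rw [← ENNReal.ofReal_mul (by positivity), show (160:ℝ≥0∞) = ENNReal.ofReal 160 by norm_num,
            ← ENNReal.ofReal_mul (by norm_num)]
          congr 1; field_simp
        rw [e5]
        by_cases hc : ENNReal.ofReal s < 32 * h y
        · simp only [Set.indicator, Set.mem_ofPred_eq, hiff, hc, if_true, Pi.one_apply]; ring
        · simp only [Set.indicator, Set.mem_ofPred_eq, hiff, hc, if_false]; ring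
      simp_rw [e4]
      rw [lintegral_const_mul, layer _ hP1, ENNReal.mul_rpow_of_nonneg _ _ hP1.le]
      · rw [ENNReal.ofReal_mul (p := 160 * (P/(P-1))) (by positivity), ← ENNReal.ofReal_rpow_of_pos (by norm_num : (0:ℝ) < 32)]
        have : h y * h y ^ (P-1) = h y ^ P := by
          nth_rw 1 [← ENNReal.rpow_one (h y)]
          rw [← ENNReal.rpow_add_of_nonneg _ _ zero_le_one hP1.le]; congr 1; ring
        rw [← this]
        norm_num
        ring
      · apply Measurable.mul
        · fun_prop
        · exact measurable_one.indicator (measurableSet_lt (by fun_prop) measurable_const)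
    simp_rw [e3]
    rw [lintegral_const_mul _ (by fun_prop)]
    rfl
  · apply Measurable.aemeasurable
    apply Measurable.mul
    · fun_prop
    · have : MeasurableSet {z : ℝ × ℝ | ENNReal.ofReal (z.1/32) < h z.2} :=
        measurableSet_lt (by fun_prop) (by fun_prop)
      have h2 := (hh.comp measurable_snd).indicator this
      exact h2


/-! ## Duality and Fefferman-Stein type inequality -/

lemma rpow_mul_self {a : ℝ≥0∞} {P : ℝ} (hP : 1 ≤ P) : a * a ^ (P-1) = a ^ P := by
  nth_rw 1 [← ENNReal.rpow_one a]
  rw [← ENNReal.rpow_add_of_nonneg _ _ zero_le_one (by linarith)]; congr 1; ring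

lemma le_of_self_le_mul {I D : ℝ≥0∞} {P P' : ℝ} (hpq : P.HolderConjugate P') (hI : I ≠ ⊤)
    (h : I ≤ D * I ^ (1/P')) : I ^ (1/P) ≤ D := by
  by_cases h0 : I = 0
  · rw [h0, ENNReal.zero_rpow_of_pos (by have := hpq.pos; positivity)]; simp
  have hpow0 : I ^ (1/P') ≠ 0 := by
    simp [ENNReal.rpow_eq_zero_iff, h0, hI]
  have hpowt : I ^ (1/P') ≠ ⊤ := ENNReal.rpow_ne_top_of_nonneg (by have := hpq.symm.pos; positivity) hI
  have e : I = I ^ (1/P) * I ^ (1/P') := by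
    rw [← ENNReal.rpow_add _ _ h0 hI]
    have : 1/P + 1/P' = 1 := by simpa using hpq.inv_add_inv_eq_one
    rw [this, ENNReal.rpow_one]
  rw [e] at h
  nth_rw 2 [← e] at h
  exact (ENNReal.mul_le_mul_iff_left hpow0 hpowt).mp h

lemma duality {Φ : ℝ → ℝ≥0∞} (hΦ : Measurable Φ) {P P' : ℝ} (hpq : P.HolderConjugate P') (D : ℝ≥0∞)
    (h : ∀ G : ℝ → ℝ≥0∞, Measurable G → ∫⁻ x, Φ x * G x ≤ D * (∫⁻ x, G x ^ P') ^ (1/P')) :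
    (∫⁻ x, Φ x ^ P) ^ (1/P) ≤ D := by
  have hP : 1 < P := hpq.lt
  set Ψ : ℕ → ℝ → ℝ≥0∞ := fun k => (Set.Icc (-(k:ℝ)) k).indicator (fun x => min (Φ x) k) with hΨ
  have hΨm : ∀ k, Measurable (Ψ k) := fun k =>
    (hΦ.min measurable_const).indicator measurableSet_Icc
  have hmono : Monotone Ψ := by
    intro k l hkl x
    have hkl' : (k:ℝ) ≤ l := by exact_mod_cast hkl
    simp only [hΨ, Set.indicator]
    by_cases hx : x ∈ Set.Icc (-(k:ℝ)) k
    · have hx2 : x ∈ Set.Icc (-(l:ℝ)) l := ⟨by linarith [hx.1], by linarith [hx.2]⟩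
      rw [if_pos hx, if_pos hx2]
      gcongr
    · rw [if_neg hx]; exact zero_le
  have hle : ∀ k x, Ψ k x ≤ Φ x := by
    intro k x
    simp only [hΨ, Set.indicator]
    split_ifs
    · exact min_le_left _ _
    · exact zero_le
  have hbound : ∀ k, (∫⁻ x, Ψ k x ^ P) ^ (1/P) ≤ D := by
    intro k
    apply le_of_self_le_mul hpq
    · apply ne_of_lt
      calc ∫⁻ x, Ψ k x ^ P ≤ ∫⁻ x, (Set.Icc (-(k:ℝ)) k).indicator (fun _ => (k:ℝ≥0∞)^P) x := by
            gcongr with x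
            simp only [hΨ, Set.indicator]
            split_ifs
            · gcongr; exact min_le_right _ _
            · rw [ENNReal.zero_rpow_of_pos (by linarith)]
        _ < ⊤ := by
            rw [lintegral_indicator measurableSet_Icc, lintegral_const]
            apply ENNReal.mul_lt_top
            · exact (ENNReal.rpow_ne_top_of_nonneg (by linarith) (by simp)).lt_top
            · simp
    · calc ∫⁻ x, Ψ k x ^ P ≤ ∫⁻ x, Φ x * (Ψ k x ^ (P-1)) := by
            gcongr with x
            rw [← rpow_mul_self hP.le]
            gcongr
            exact hle k x
        _ ≤ D * (∫⁻ x, (Ψ k x ^ (P-1)) ^ P') ^ (1/P') := h _ ((hΨm k).pow_const _)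
        _ = _ := by
            congr 3
            ext x
            rw [← ENNReal.rpow_mul]
            congr 1
            exact hpq.sub_one_mul_conj
  have hsup : ∫⁻ x, Φ x ^ P = ⨆ k, ∫⁻ x, Ψ k x ^ P := by
    rw [← lintegral_iSup (fun k => (hΨm k).pow_const _)]
    · congr 1; ext x
      apply le_antisymm
      · obtain ⟨k0, hk0⟩ := exists_nat_ge |x|
        by_cases htop : Φ x = ⊤
        · rw [htop, ENNReal.top_rpow_of_pos (by linarith)]
          rw [top_le_iff]
          apply ENNReal.eq_top_of_forall_nnreal_le
          intro r
          obtain ⟨k1, hk1⟩ := exists_nat_ge r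
          refine le_trans ?_ (le_iSup _ (k0 + k1 + 1))
          have hx : x ∈ Set.Icc (-((k0 + k1 + 1 : ℕ):ℝ)) ((k0 + k1 + 1 : ℕ):ℝ) := by
            rw [Set.mem_Icc, ← abs_le]; push_cast
            have : (0:ℝ) ≤ k1 := by positivity
            linarith
          simp only [hΨ, Set.indicator, if_pos hx, htop, min_eq_right, le_top]
          calc (r:ℝ≥0∞) ≤ ((k0+k1+1 : ℕ):ℝ≥0∞) := by
                have : r ≤ ((k0+k1+1 : ℕ):ℝ≥0) := hk1.trans (by exact_mod_cast (by omega))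
                exact_mod_cast this
            _ ≤ _ := by
                nth_rw 1 [← ENNReal.rpow_one ((k0+k1+1 : ℕ):ℝ≥0∞)]
                apply ENNReal.rpow_le_rpow_of_exponent_le _ hP.le
                exact_mod_cast (by omega)
        · obtain ⟨k1, hk1⟩ := exists_nat_ge (Φ x).toNNReal
          refine le_trans ?_ (le_iSup _ (k0 + k1))
          have hx : x ∈ Set.Icc (-((k0 + k1 : ℕ):ℝ)) ((k0 + k1 : ℕ):ℝ) := by
            rw [Set.mem_Icc, ← abs_le]; push_cast
            have : (0:ℝ) ≤ k1 := by positivity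
            linarith
          have : Φ x ≤ ((k0+k1 : ℕ):ℝ≥0∞) := by
            rw [← ENNReal.coe_toNNReal htop]
            have : (Φ x).toNNReal ≤ ((k0+k1 : ℕ):ℝ≥0) := hk1.trans (by exact_mod_cast (by omega))
            exact_mod_cast this
          simp only [hΨ, Set.indicator, if_pos hx, min_eq_left this]
          exact le_rfl
      · apply iSup_le
        intro k
        gcongr
        exact hle k x
    · intro k l hkl x
      simp only
      gcongr
      exact hmono hkl x
  rw [hsup]
  have : (⨆ k, ∫⁻ x, Ψ k x ^ P) ≤ D ^ P := by
    apply iSup_le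
    intro k
    have := hbound k
    rw [one_div, ENNReal.rpow_inv_le_iff (by linarith)] at this
    exact this
  rw [one_div, ENNReal.rpow_inv_le_iff (by linarith)]
  exact this

lemma Av_holder (m : ℤ) {u v : ℝ → ℝ≥0∞} (hu : Measurable u) (hv : Measurable v) {a b : ℝ}
    (hab : a.HolderConjugate b) (x : ℝ) :
    Av m (fun y => u y * v y) x ≤ (Av m (fun y => u y ^ a) x)^(1/a) * (Av m (fun y => v y ^ b) x)^(1/b) := by
  have h := ENNReal.lintegral_mul_le_Lp_mul_Lq (volume.withDensity (wk m x)) hab hu.aemeasurable hv.aemeasurable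
  rw [lintegral_withDensity_eq_lintegral_mul _ (measurable_wk m x) (hu.mul hv),
    lintegral_withDensity_eq_lintegral_mul _ (measurable_wk m x) (hu.pow_const a),
    lintegral_withDensity_eq_lintegral_mul _ (measurable_wk m x) (hv.pow_const b)] at h
  exact h

lemma Av_one_le (m : ℤ) (x : ℝ) : Av m (fun _ => 1) x ≤ 16 :=
  (Av_le_Mx _ _ _).trans ((Mx_const_le 1 x).trans (by simp))

lemma Av_jensen (m : ℤ) {u : ℝ → ℝ≥0∞} (hu : Measurable u) {ρ : ℝ} (hρ : 1 ≤ ρ) (x : ℝ) :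
    (Av m u x) ^ ρ ≤ 16 ^ (ρ - 1) * Av m (fun y => u y ^ ρ) x := by
  rcases hρ.eq_or_lt with h1 | h1
  · rw [← h1]; simp
  · have hab := Real.HolderConjugate.conjExponent h1
    have h := Av_holder m hu (measurable_const (a := (1:ℝ≥0∞))) hab x
    simp only [mul_one, ENNReal.one_rpow] at h
    calc (Av m u x) ^ ρ ≤ ((Av m (fun y => u y ^ ρ) x)^(1/ρ) * 16 ^ (1/ρ.conjExponent)) ^ ρ := by
          gcongr
          refine h.trans ?_
          have := hab.symm.pos
          gcongr
          exact Av_one_le m x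
      _ = _ := by
          rw [ENNReal.mul_rpow_of_nonneg _ _ (by linarith), ← ENNReal.rpow_mul, ← ENNReal.rpow_mul,
            one_div_mul_cancel (by linarith), ENNReal.rpow_one, mul_comm]
          congr 2
          rw [Real.conjExponent]; field_simp

lemma Av_swap (m : ℤ) {u v : ℝ → ℝ≥0∞} (hu : Measurable u) (hv : Measurable v) :
    ∫⁻ x, Av m u x * v x = ∫⁻ x, u x * Av m v x := by
  unfold Av
  have e1 : ∀ x, (∫⁻ y, wk m x y * u y) * v x = ∫⁻ y, wk m x y * u y * v x := fun x => by
    rw [lintegral_mul_const]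
    exact (measurable_wk m x).mul hu
  have e2 : ∀ x, u x * (∫⁻ y, wk m x y * v y) = ∫⁻ y, u x * (wk m x y * v y) := fun x => by
    rw [lintegral_const_mul]
    exact (measurable_wk m x).mul hv
  simp_rw [e1, e2]
  rw [lintegral_lintegral_swap]
  · congr 1; ext x; congr 1; ext y
    rw [wk_symm]; ring
  · exact (((measurable_wk2 m).mul (hu.comp measurable_snd)).mul (hv.comp measurable_fst)).aemeasurable

lemma lintegral_Av_le (m : ℤ) {u : ℝ → ℝ≥0∞} (hu : Measurable u) :
    ∫⁻ x, Av m u x ≤ 16 * ∫⁻ x, u x := by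
  have := Av_swap m hu (measurable_const (a := (1:ℝ≥0∞)))
  simp only [mul_one] at this
  rw [this, ← lintegral_const_mul _ hu]
  refine lintegral_mono fun x => ?_
  simp only
  rw [mul_comm]
  gcongr
  exact Av_one_le m x

lemma sum_Av_le {ι : Type} (S : Finset ι) (m : ι → ℤ) (h : ι → ℝ → ℝ≥0∞) (hm : ∀ i, Measurable (h i)) :
    ∫⁻ x, ∑ i ∈ S, Av (m i) (h i) x ≤ 16 * ∫⁻ x, ∑ i ∈ S, h i x := by
  rw [lintegral_finsetSum _ (fun i _ => measurable_Av _ (hm i)), lintegral_finsetSum _ (fun i _ => hm i),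
    Finset.mul_sum]
  gcongr with i
  exact lintegral_Av_le _ (hm i)

lemma sum_Av_strong (Q : ℝ) (hQ : 1 ≤ Q) : ∃ C : ℝ≥0, ∀ (ι : Type) (S : Finset ι) (m : ι → ℤ)
    (h : ι → ℝ → ℝ≥0∞), (∀ i, Measurable (h i)) →
    ∫⁻ x, (∑ i ∈ S, Av (m i) (h i) x) ^ Q ≤ C * ∫⁻ x, (∑ i ∈ S, h i x) ^ Q := by
  rcases hQ.eq_or_lt with h1 | h1
  · refine ⟨16, fun ι S m h hm => ?_⟩
    subst h1
    simp only [ENNReal.rpow_one]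
    exact sum_Av_le S m h hm
  · have hab := Real.HolderConjugate.conjExponent h1
    set Q' := Q.conjExponent
    obtain ⟨C, hC⟩ := Mx_strong Q' hab.symm.lt
    refine ⟨(C ^ (1/Q')) ^ Q, fun ι S m h hm => ?_⟩
    have hd := duality (Φ := fun x => ∑ i ∈ S, Av (m i) (h i) x)
      (Finset.measurable_sum _ fun i _ => measurable_Av _ (hm i)) hab
      ((C ^ (1/Q') : ℝ≥0) * (∫⁻ x, (∑ i ∈ S, h i x) ^ Q) ^ (1/Q)) ?_
    · rw [one_div, ENNReal.rpow_inv_le_iff (by linarith), ENNReal.mul_rpow_of_nonneg _ _ (by linarith),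
        ← ENNReal.rpow_mul, inv_mul_cancel₀ (by linarith), ENNReal.rpow_one] at hd
      rw [ENNReal.coe_rpow_of_nonneg _ (by linarith)]
      simpa [one_div] using hd
    · intro G hG
      have hhm : Measurable (fun x => ∑ i ∈ S, h i x) := Finset.measurable_sum _ fun i _ => (hm i)
      calc ∫⁻ x, (∑ i ∈ S, Av (m i) (h i) x) * G x = ∑ i ∈ S, ∫⁻ x, Av (m i) (h i) x * G x := by
            simp_rw [Finset.sum_mul]
            rw [lintegral_finsetSum]
            exact fun i _ => (measurable_Av _ (hm i)).mul hG
        _ = ∑ i ∈ S, ∫⁻ x, h i x * Av (m i) G x := by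
            congr 1; ext i; exact Av_swap _ (hm i) hG
        _ ≤ ∑ i ∈ S, ∫⁻ x, h i x * Mx G x := by
            gcongr with i _ x
            exact Av_le_Mx _ _ _
        _ = ∫⁻ x, (∑ i ∈ S, h i x) * Mx G x := by
            simp_rw [Finset.sum_mul]
            rw [lintegral_finsetSum]
            exact fun i _ => (hm i).mul (measurable_Mx hG)
        _ ≤ (∫⁻ x, (∑ i ∈ S, h i x) ^ Q) ^ (1/Q) * (∫⁻ x, Mx G x ^ Q') ^ (1/Q') :=
            ENNReal.lintegral_mul_le_Lp_mul_Lq volume hab hhm.aemeasurable (measurable_Mx hG).aemeasurable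
        _ ≤ (∫⁻ x, (∑ i ∈ S, h i x) ^ Q) ^ (1/Q) * (C * ∫⁻ x, G x ^ Q') ^ (1/Q') := by
            have := hab.symm.pos
            gcongr
            exact hC G hG
        _ = _ := by
            have := hab.symm.pos
            rw [ENNReal.mul_rpow_of_nonneg _ _ (by positivity), ENNReal.coe_rpow_of_nonneg _ (by positivity)]
            ring

lemma FS_ge (P R : ℝ) (hR : 1 ≤ R) (hPR : R ≤ P) : ∃ C : ℝ≥0, ∀ (ι : Type) (S : Finset ι) (m : ι → ℤ)
    (h : ι → ℝ → ℝ≥0∞), (∀ i, Measurable (h i)) →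
    ∫⁻ x, (∑ i ∈ S, Av (m i) (h i) x ^ R) ^ (P/R) ≤ C * ∫⁻ x, (∑ i ∈ S, h i x ^ R) ^ (P/R) := by
  have hQ : 1 ≤ P / R := by rw [le_div_iff₀ (by linarith)]; linarith
  obtain ⟨C, hC⟩ := sum_Av_strong (P/R) hQ
  refine ⟨((16:ℝ≥0) ^ (R-1)) ^ (P/R) * C, fun ι S m h hm => ?_⟩
  have h2 := hC ι S m (fun i x => h i x ^ R) (fun i => (hm i).pow_const R)
  calc ∫⁻ x, (∑ i ∈ S, Av (m i) (h i) x ^ R) ^ (P/R)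
      ≤ ∫⁻ x, (((16:ℝ≥0) ^ (R-1)) ^ (P/R) : ℝ≥0) * (∑ i ∈ S, Av (m i) (fun y => h i y ^ R) x) ^ (P/R) := by
        gcongr with x
        rw [ENNReal.coe_rpow_of_nonneg _ (by linarith), ← ENNReal.mul_rpow_of_nonneg _ _ (by linarith),
          ENNReal.coe_rpow_of_nonneg _ (by linarith), Finset.mul_sum]
        gcongr with i
        exact Av_jensen _ (hm i) hR x
    _ = (((16:ℝ≥0) ^ (R-1)) ^ (P/R) : ℝ≥0) * ∫⁻ x, (∑ i ∈ S, Av (m i) (fun y => h i y ^ R) x) ^ (P/R) := by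
        rw [lintegral_const_mul]
        exact (Finset.measurable_sum _ fun i _ => measurable_Av _ ((hm i).pow_const _)).pow_const _
    _ ≤ _ := by
        rw [ENNReal.coe_mul, mul_assoc]
        gcongr

lemma FS_lt (P R : ℝ) (hP : 1 < P) (hPR : P < R) : ∃ C : ℝ≥0, ∀ (ι : Type) (S : Finset ι) (m : ι → ℤ)
    (h : ι → ℝ → ℝ≥0∞), (∀ i, Measurable (h i)) → (∀ i x, h i x ≠ ⊤) →
    ∫⁻ x, (∑ i ∈ S, Av (m i) (h i) x ^ R) ^ (P/R) ≤ C * ∫⁻ x, (∑ i ∈ S, h i x ^ R) ^ (P/R) := by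
  have hR : 1 < R := by linarith
  set e := (R-P)/(R-1) with he
  have he0 : 0 < e := div_pos (by linarith) (by linarith)
  have he1 : e < 1 := by rw [he, div_lt_one (by linarith)]; linarith
  have hPe : 1 < P/e := by rw [lt_div_iff₀ he0]; linarith
  obtain ⟨C, hC⟩ := Mx_strong (P/e) hPe
  refine ⟨C ^ (1-P/R) * 16 ^ (P/R), fun ι S m h hm hfin => ?_⟩
  have hPR1 : P/R < 1 := by rw [div_lt_one (by linarith)]; exact hPR
  have hPR0 : 0 < P/R := by positivity
  set H : ℝ → ℝ≥0∞ := fun x => (∑ i ∈ S, h i x ^ R) ^ (1/R) with hH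
  have hHm : Measurable H := (Finset.measurable_sum _ fun i _ => (hm i).pow_const _).pow_const _
  have hHR : ∀ x, H x ^ R = ∑ i ∈ S, h i x ^ R := fun x => by
    simp only [hH]; rw [← ENNReal.rpow_mul, one_div_mul_cancel (by linarith), ENNReal.rpow_one]
  have hHP : ∀ x, H x ^ P = (∑ i ∈ S, h i x ^ R) ^ (P/R) := fun x => by
    simp only [hH]; rw [← ENNReal.rpow_mul]; congr 1; ring
  have hHt : ∀ x, H x ≠ ⊤ := fun x => by
    apply ENNReal.rpow_ne_top_of_nonneg (by positivity)
    exact (ENNReal.sum_lt_top.mpr fun i _ => (ENNReal.rpow_ne_top_of_nonneg (by linarith) (hfin i x)).lt_top).ne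
  set k : ι → ℝ → ℝ≥0∞ := fun i x => h i x * H x ^ (P/R-1) with hk
  have hkm : ∀ i, Measurable (k i) := fun i => (hm i).mul (hHm.pow_const _)
  have hhk : ∀ i ∈ S, ∀ x, h i x ≤ H x ^ (1-P/R) * k i x := by
    intro i hi x
    by_cases h0 : H x = 0
    · have : H x ^ R = 0 := by rw [h0, ENNReal.zero_rpow_of_pos (by linarith)]
      rw [hHR, Finset.sum_eq_zero_iff] at this
      have := this i hi
      rw [ENNReal.rpow_eq_zero_iff_of_pos (by linarith)] at this
      rw [this]; exact zero_le
    · have e1 : H x ^ (1-P/R) * k i x = h i x * (H x ^ (1-P/R) * H x ^ (P/R-1)) := by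
        simp only [hk]; ring
      rw [e1, ← ENNReal.rpow_add _ _ h0 (hHt x)]
      simp
  have hkR : ∀ x, ∑ i ∈ S, k i x ^ R ≤ H x ^ P := by
    intro x
    have : ∑ i ∈ S, k i x ^ R = H x ^ R * H x ^ (P - R) := by
      rw [hHR, Finset.sum_mul]
      refine Finset.sum_congr rfl fun i _ => ?_
      simp only [hk]
      rw [ENNReal.mul_rpow_of_nonneg _ _ (by linarith), ← ENNReal.rpow_mul]
      congr 2; field_simp
    rw [this]
    by_cases h0 : H x = 0
    · rw [h0, ENNReal.zero_rpow_of_pos (by linarith)]; simp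
    · rw [← ENNReal.rpow_add _ _ h0 (hHt x)]; simp
  have hab : R.HolderConjugate (R/(R-1)) := Real.HolderConjugate.conjExponent hR
  set U : ℝ → ℝ≥0∞ := Mx (fun y => H y ^ e) with hU
  have hUm : Measurable U := measurable_Mx (hHm.pow_const _)
  set V : ℝ → ℝ≥0∞ := fun x => ∑ i ∈ S, Av (m i) (fun y => k i y ^ R) x with hV
  have hVm : Measurable V := Finset.measurable_sum _ fun i _ => measurable_Av _ ((hkm i).pow_const _)
  have hpt : ∀ x, ∑ i ∈ S, Av (m i) (h i) x ^ R ≤ U x ^ (R-1) * V x := by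
    intro x
    rw [hV, Finset.mul_sum]
    gcongr with i hi
    have h1 := (Av_mono (m i) (hhk i hi) x).trans (Av_holder (m i) (hHm.pow_const (1-P/R)) (hkm i) hab.symm x)
    have e2 : (fun y => (H y ^ (1 - P/R)) ^ (R/(R-1))) = fun y => H y ^ e := by
      ext y; rw [← ENNReal.rpow_mul]; congr 1; rw [he]; field_simp
    rw [e2] at h1
    calc Av (m i) (h i) x ^ R ≤ (U x ^ (1/(R/(R-1))) * Av (m i) (fun y => k i y ^ R) x ^ (1/R)) ^ R := by
          have := hab.symm.pos
          gcongr
          refine h1.trans ?_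
          gcongr
          exact Av_le_Mx _ _ _
      _ = _ := by
          rw [ENNReal.mul_rpow_of_nonneg _ _ (by linarith), ← ENNReal.rpow_mul, ← ENNReal.rpow_mul,
            one_div_mul_cancel (by linarith), ENNReal.rpow_one]
          congr 2; field_simp
  have hab2 : (1/(1-P/R)).HolderConjugate (1/(P/R)) := by
    rw [Real.holderConjugate_iff]
    constructor
    · rw [lt_div_iff₀ (by linarith)]; linarith
    · field_simp; ring
  simp_rw [← hHP]
  calc ∫⁻ x, (∑ i ∈ S, Av (m i) (h i) x ^ R) ^ (P/R) ≤ ∫⁻ x, U x ^ ((R-1)*(P/R)) * V x ^ (P/R) := by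
        gcongr with x
        rw [ENNReal.rpow_mul, ← ENNReal.mul_rpow_of_nonneg _ _ (by positivity)]
        gcongr
        exact hpt x
    _ ≤ (∫⁻ x, (U x ^ ((R-1)*(P/R))) ^ (1/(1-P/R))) ^ (1/(1/(1-P/R))) * (∫⁻ x, (V x ^ (P/R)) ^ (1/(P/R))) ^ (1/(1/(P/R))) :=
        ENNReal.lintegral_mul_le_Lp_mul_Lq volume hab2 (hUm.pow_const _).aemeasurable (hVm.pow_const _).aemeasurable
    _ = (∫⁻ x, U x ^ (P/e)) ^ (1-P/R) * (∫⁻ x, V x) ^ (P/R) := by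
        simp_rw [← ENNReal.rpow_mul, one_div_one_div]
        have e5 : (R - 1) * (P / R) * (1 / (1 - P / R)) = P/e := by
          rw [he]
          have : R - P ≠ 0 := by linarith
          have : R - 1 ≠ 0 := by linarith
          have h3 : 1 - P/R = (R-P)/R := by field_simp
          rw [h3]
          field_simp
        have e6 : P/R * (1/(P/R)) = 1 := by field_simp
        rw [e5, e6]
        simp
    _ ≤ (C * ∫⁻ x, H x ^ P) ^ (1-P/R) * (16 * ∫⁻ x, H x ^ P) ^ (P/R) := by
        gcongr
        · refine (hC _ (hHm.pow_const e)).trans (le_of_eq ?_)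
          congr 2; ext x; rw [← ENNReal.rpow_mul]; congr 1; field_simp
        · refine (sum_Av_le S m (fun i y => k i y ^ R) (fun i => (hkm i).pow_const _)).trans ?_
          gcongr with x
          exact hkR x
    _ = _ := by
        rw [ENNReal.mul_rpow_of_nonneg _ _ (by linarith), ENNReal.mul_rpow_of_nonneg _ _ (by linarith),
          ENNReal.coe_mul, ENNReal.coe_rpow_of_nonneg _ (by linarith), ENNReal.coe_rpow_of_nonneg _ (by linarith)]
        have : (∫⁻ x, H x ^ P) = (∫⁻ x, H x ^ P) ^ (1-P/R) * (∫⁻ x, H x ^ P) ^ (P/R) := by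
          rw [← ENNReal.rpow_add_of_nonneg _ _ (by linarith) (by linarith)]; simp
        conv_rhs => rw [this]
        push_cast
        ring

lemma FS (P R : ℝ) (hP : 1 < P) (hR : 1 ≤ R) : ∃ C : ℝ≥0, ∀ (ι : Type) (S : Finset ι) (m : ι → ℤ)
    (h : ι → ℝ → ℝ≥0∞), (∀ i, Measurable (h i)) → (∀ i x, h i x ≠ ⊤) →
    ∫⁻ x, (∑ i ∈ S, Av (m i) (h i) x ^ R) ^ (P/R) ≤ C * ∫⁻ x, (∑ i ∈ S, h i x ^ R) ^ (P/R) := by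
  rcases le_or_gt R P with h | h
  · obtain ⟨C, hC⟩ := FS_ge P R hR h
    exact ⟨C, fun ι S m h hm _ => hC ι S m h hm⟩
  · exact FS_lt P R hP h


/-! ## Dyadic tree: averages and the potential -/

def E1 (h : ℤ → ℝ) (z : ℤ) : ℝ := (h (2*z) + h (2*z+1)) / 2

lemma div_pow_succ' (z : ℤ) (k : ℕ) : z / 2^(k+1) = (z / 2) / 2^k := by
  rw [pow_succ', Int.ediv_ediv_of_nonneg (by norm_num)]

lemma div_pow_succ (z : ℤ) (k : ℕ) : z / 2^(k+1) = (z / 2^k) / 2 := by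
  rw [pow_succ, Int.ediv_ediv_of_nonneg (by positivity)]

lemma div_pow_add (z : ℤ) (k l : ℕ) : z / 2^(k+l) = (z / 2^k) / 2^l := by
  rw [pow_add, Int.ediv_ediv_of_nonneg (by positivity)]

lemma E_mono_desc (k : ℕ) (h g : ℤ → ℝ) (z : ℤ) (H : ∀ w, w / 2^k = z → h w ≤ g w) :
    E1^[k] h z ≤ E1^[k] g z := by
  induction k generalizing z with
  | zero => simpa using H z (by simp)
  | succ k ih =>
    rw [Function.iterate_succ_apply', Function.iterate_succ_apply']
    have h1 := ih (2*z) (fun w hw => H w (by rw [div_pow_succ, hw]; omega))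
    have h2 := ih (2*z+1) (fun w hw => H w (by rw [div_pow_succ, hw]; omega))
    simp only [E1]
    linarith

lemma E_add (k : ℕ) (h g : ℤ → ℝ) (z : ℤ) :
    E1^[k] (fun w => h w + g w) z = E1^[k] h z + E1^[k] g z := by
  induction k generalizing z with
  | zero => rfl
  | succ k ih =>
    simp only [Function.iterate_succ_apply', E1, ih]
    ring

lemma E_smul (k : ℕ) (c : ℝ) (h : ℤ → ℝ) (z : ℤ) :
    E1^[k] (fun w => c * h w) z = c * E1^[k] h z := by
  induction k generalizing z with
  | zero => rfl
  | succ k ih =>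
    simp only [Function.iterate_succ_apply', E1, ih]
    ring

lemma E_const (k : ℕ) (c : ℝ) (z : ℤ) :
    E1^[k] (fun _ => c) z = c := by
  induction k generalizing z with
  | zero => rfl
  | succ k ih =>
    simp only [Function.iterate_succ_apply', E1, ih]
    ring

structure State where
  dA : ℂ
  dB : ℂ
  M : ℂ
  s : ℝ
  uX : ℝ
  uY : ℝ
  c : ℕ

def State.start : State := ⟨0,0,0,0,0,0,0⟩

def viol (S : State) (a b : ℂ) (x y : ℝ) : Prop :=
  1 < x ∨ 1 < y ∨ 1 < ‖S.dA + a‖ ∨ 1 < ‖S.dB + b‖ ∨ 1 < ‖S.M + S.dA * b‖ ∨ 1 < S.s + x * y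

open Classical in
def stp (r s : ℝ) (S : State) (a b : ℂ) (x y : ℝ) : State :=
  if viol S a b x y then ⟨0, 0, 0, 0, S.uX + x^r, S.uY + y^s, S.c + 1⟩
  else ⟨S.dA + a, S.dB + b, S.M + S.dA * b, S.s + x*y, S.uX + x^r, S.uY + y^s, S.c⟩

structure TD where
  A : ℕ → ℤ → ℂ
  B : ℕ → ℤ → ℂ
  X : ℕ → ℤ → ℝ
  Y : ℕ → ℤ → ℝ
  r : ℝ
  s : ℝ
  hr1 : 1 ≤ r
  hr2 : r ≤ 2
  hs1 : 1 ≤ s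
  hs2 : s ≤ 2
  hX : ∀ n z, 0 < X n z
  hY : ∀ n z, 0 < Y n z
  hA : ∀ n z, ‖A (n+1) z - A n (z/2)‖ ≤ X n (z/2)
  hB : ∀ n z, ‖B (n+1) z - B n (z/2)‖ ≤ Y n (z/2)
  mA : (∀ n z, A (n+1) (2*z) + A (n+1) (2*z+1) = 2 * A n z) ∨ r = 1
  mB : (∀ n z, B (n+1) (2*z) + B (n+1) (2*z+1) = 2 * B n z) ∨ s = 1

namespace TD
variable (D : TD)

def St (k1 k2 : ℝ) (m : ℕ) : ℕ → ℤ → State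
  | 0, _ => State.start
  | d+1, z => stp D.r D.s (St k1 k2 m d (z/2)) ((D.A (m+d+1) z - D.A (m+d) (z/2)) / k1)
      ((D.B (m+d+1) z - D.B (m+d) (z/2)) / k2) (D.X (m+d) (z/2) / k1) (D.Y (m+d) (z/2) / k2)

end TD

structure State.Inv (S : State) : Prop where
  hA : ‖S.dA‖ ≤ 1
  hB : ‖S.dB‖ ≤ 1
  hM : ‖S.M‖ ≤ 1
  hs : S.s ≤ 1
  hs0 : 0 ≤ S.s

lemma stp_inv {r s : ℝ} {S : State} (h : S.Inv) {a b : ℂ} {x y : ℝ} (hx : 0 ≤ x) (hy : 0 ≤ y) :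
    (stp r s S a b x y).Inv := by
  unfold stp
  split_ifs with hv
  · constructor <;> simp
  · simp only [viol, not_or, not_lt] at hv
    obtain ⟨h1, h2, h3, h4, h5, h6⟩ := hv
    exact ⟨h3, h4, h5, h6, by have := h.hs0; positivity⟩

open Classical in
def pot (Bx By : ℝ) (S : State) : ℝ :=
  if S.uX ≤ Bx ∧ S.uY ≤ By then S.c + ‖S.dA‖^2 + ‖S.dB‖^2 + ‖S.M‖^2 + S.s + 7*(Bx - S.uX) + 7*(By - S.uY)
  else 0

lemma sq_incr {r : ℝ} (hr2 : r ≤ 2) (D w a1 a2 : ℂ) (x : ℝ) (hx : 0 < x) (hx1 : x ≤ 1)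
    (hD : ‖D‖ ≤ 1) (hw : ‖w‖ ≤ 1) (h1 : ‖a1‖ ≤ x) (h2 : ‖a2‖ ≤ x) (hm : a1 + a2 = 0 ∨ r = 1) :
    ‖D + w * a1‖^2 + ‖D + w * a2‖^2 ≤ 2 * ‖D‖^2 + 6 * x^r := by
  have hxr : x^2 ≤ x^r := by
    rw [← Real.rpow_natCast x 2]
    exact Real.rpow_le_rpow_of_exponent_ge hx hx1 (by simpa using hr2)
  have hxr0 : 0 < x^r := Real.rpow_pos_of_pos hx r
  rcases hm with hm | hm
  · have e : a2 = -a1 := by linear_combination hm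
    subst e
    have hp := parallelogram_law_with_norm ℝ D (w * a1)
    have hwa : ‖w * a1‖ ≤ x := by
      rw [norm_mul]; nlinarith [norm_nonneg w, norm_nonneg a1]
    have e2 : D + w * -a1 = D - w * a1 := by ring
    rw [e2]
    nlinarith [norm_nonneg (w * a1)]
  · have key : ∀ a : ℂ, ‖a‖ ≤ x → ‖D + w * a‖^2 ≤ ‖D‖^2 + 3 * x := by
      intro a ha
      have hwa : ‖w * a‖ ≤ x := by
        rw [norm_mul]; nlinarith [norm_nonneg w, norm_nonneg a]
      have := norm_add_le D (w * a)
      nlinarith [norm_nonneg (D + w*a), norm_nonneg D, norm_nonneg (w * a)]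
    rw [hm, Real.rpow_one]
    linarith [key a1 h1, key a2 h2]

lemma one_lt_sq {a : ℝ} (h : 1 < a) : 1 < a^2 := by nlinarith

lemma pot_child_le {r s : ℝ} (S : State) (hS : S.Inv) (a b : ℂ) (x y : ℝ) (hx : 0 < x) (hy : 0 < y)
    (hx1 : x ≤ 1) (hy1 : y ≤ 1) (Bx By : ℝ) (hBx : S.uX + x^r ≤ Bx) (hBy : S.uY + y^s ≤ By) :
    pot Bx By (stp r s S a b x y) ≤ S.c + ‖S.dA + a‖^2 + ‖S.dB + b‖^2 + ‖S.M + S.dA * b‖^2 + (S.s + x * y)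
      + 7*(Bx - (S.uX + x^r)) + 7*(By - (S.uY + y^s)) := by
  unfold stp
  have hs0 := hS.hs0
  have hxy : 0 < x * y := by positivity
  split_ifs with hv
  · simp only [pot, hBx, hBy, and_self, if_true, norm_zero]
    push_cast
    have p1 := sq_nonneg ‖S.dA + a‖
    have p2 := sq_nonneg ‖S.dB + b‖
    have p3 := sq_nonneg ‖S.M + S.dA * b‖
    rcases hv with h | h | h | h | h | h
    · linarith
    · linarith
    · have := one_lt_sq h; linarith
    · have := one_lt_sq h; linarith
    · have := one_lt_sq h; linarith
    · linarith
  · simp only [pot, hBx, hBy, and_self, if_true, le_refl]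

lemma pot_nonneg (Bx By : ℝ) (S : State) (hS : S.Inv) : 0 ≤ pot Bx By S := by
  unfold pot
  split_ifs with h
  · have := hS.hs0
    have : 0 ≤ Bx - S.uX := by linarith [h.1]
    have : 0 ≤ By - S.uY := by linarith [h.2]
    positivity
  · exact le_rfl

lemma stp_uX (r s : ℝ) (S : State) (a b : ℂ) (x y : ℝ) : (stp r s S a b x y).uX = S.uX + x^r := by
  unfold stp; split_ifs <;> rfl

lemma stp_uY (r s : ℝ) (S : State) (a b : ℂ) (x y : ℝ) : (stp r s S a b x y).uY = S.uY + y^s := by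
  unfold stp; split_ifs <;> rfl

lemma pot_step {r s : ℝ} (hr1 : 1 ≤ r) (hr2 : r ≤ 2) (hs1 : 1 ≤ s) (hs2 : s ≤ 2) (S : State) (hS : S.Inv)
    (a1 b1 a2 b2 : ℂ) (x y : ℝ) (hx : 0 < x) (hy : 0 < y)
    (ha1 : ‖a1‖ ≤ x) (ha2 : ‖a2‖ ≤ x) (hb1 : ‖b1‖ ≤ y) (hb2 : ‖b2‖ ≤ y)
    (mA : a1 + a2 = 0 ∨ r = 1) (mB : b1 + b2 = 0 ∨ s = 1) (Bx By : ℝ) :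
    pot Bx By (stp r s S a1 b1 x y) + pot Bx By (stp r s S a2 b2 x y) ≤ 2 * pot Bx By S := by
  have hxr0 : 0 < x^r := Real.rpow_pos_of_pos hx r
  have hys0 : 0 < y^s := Real.rpow_pos_of_pos hy s
  by_cases hal : S.uX + x^r ≤ Bx ∧ S.uY + y^s ≤ By
  · have hal0 : S.uX ≤ Bx ∧ S.uY ≤ By := ⟨by linarith [hal.1], by linarith [hal.2]⟩
    have hP : pot Bx By S = S.c + ‖S.dA‖^2 + ‖S.dB‖^2 + ‖S.M‖^2 + S.s + 7*(Bx - S.uX) + 7*(By - S.uY) := by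
      simp only [pot, hal0, and_self, if_true]
    by_cases hxy : x ≤ 1 ∧ y ≤ 1
    · obtain ⟨hx1, hy1⟩ := hxy
      have c1 := pot_child_le (r := r) (s := s) S hS a1 b1 x y hx hy hx1 hy1 Bx By hal.1 hal.2
      have c2 := pot_child_le (r := r) (s := s) S hS a2 b2 x y hx hy hx1 hy1 Bx By hal.1 hal.2
      have i1 := sq_incr hr2 S.dA 1 a1 a2 x hx hx1 hS.hA (by simp) ha1 ha2 mA
      have i2 := sq_incr hs2 S.dB 1 b1 b2 y hy hy1 hS.hB (by simp) hb1 hb2 mB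
      have i3 := sq_incr hs2 S.M S.dA b1 b2 y hy hy1 hS.hM hS.hA hb1 hb2 mB
      simp only [one_mul] at i1 i2
      have hxr : x^2 ≤ x^r := by
        rw [← Real.rpow_natCast x 2]
        exact Real.rpow_le_rpow_of_exponent_ge hx hx1 (by simpa using hr2)
      have hyr : y^2 ≤ y^s := by
        rw [← Real.rpow_natCast y 2]
        exact Real.rpow_le_rpow_of_exponent_ge hy hy1 (by simpa using hs2)
      rw [hP]
      nlinarith [sq_nonneg (x - y)]
    · have hx1 : 1 < x ∨ 1 < y := by
        by_contra hc; push Not at hc; exact hxy hc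
      have hbig : 1 ≤ x^r + y^s := by
        rcases hx1 with h | h
        · have := Real.one_le_rpow h.le (by linarith : 0 ≤ r); linarith
        · have := Real.one_le_rpow h.le (by linarith : 0 ≤ s); linarith
      have key : ∀ a b : ℂ, pot Bx By (stp r s S a b x y) = S.c + 1 + 7*(Bx - (S.uX + x^r)) + 7*(By - (S.uY + y^s)) := by
        intro a b
        have hv : viol S a b x y := by
          rcases hx1 with h | h
          · exact Or.inl h
          · exact Or.inr (Or.inl h)
        simp only [stp, hv, if_true, pot, hal, and_self, norm_zero]
        push_cast; ring
      rw [key, key, hP]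
      have := hS.hs0
      nlinarith [sq_nonneg ‖S.dA‖, sq_nonneg ‖S.dB‖, sq_nonneg ‖S.M‖]
  · have key : ∀ a b : ℂ, pot Bx By (stp r s S a b x y) = 0 := by
      intro a b
      simp only [pot, stp_uX, stp_uY, hal, if_false]
    rw [key, key]
    have := pot_nonneg Bx By S hS
    linarith

namespace TD
variable (D : TD)

lemma St_inv {k1 k2 : ℝ} (h1 : 0 < k1) (h2 : 0 < k2) (m d : ℕ) (z : ℤ) : (D.St k1 k2 m d z).Inv := by
  induction d generalizing z with
  | zero => constructor <;> simp [St, State.start]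
  | succ d ih =>
    exact stp_inv (ih _) (div_nonneg (D.hX _ _).le h1.le) (div_nonneg (D.hY _ _).le h2.le)

lemma E_pot_le {k1 k2 : ℝ} (h1 : 0 < k1) (h2 : 0 < k2) (Bx By : ℝ) (m d : ℕ) (z : ℤ) :
    E1^[d] (fun w => pot Bx By (D.St k1 k2 m d w)) z ≤ pot Bx By State.start := by
  induction d generalizing z with
  | zero => exact le_rfl
  | succ d ih =>
    refine le_trans ?_ (ih z)
    rw [Function.iterate_succ_apply]
    apply E_mono_desc
    intro w _
    simp only [E1]
    have e1 : (2*w)/2 = w := by omega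
    have e2 : (2*w+1)/2 = w := by omega
    have hk1 : ((k1:ℂ)) ≠ 0 := by exact_mod_cast h1.ne'
    have hk2 : ((k2:ℂ)) ≠ 0 := by exact_mod_cast h2.ne'
    have nA : ∀ z, ‖(D.A (m+d+1) z - D.A (m+d) (z/2)) / k1‖ ≤ D.X (m+d) (z/2) / k1 := by
      intro z
      rw [norm_div, Complex.norm_real, Real.norm_of_nonneg h1.le]
      gcongr
      exact D.hA _ _
    have nB : ∀ z, ‖(D.B (m+d+1) z - D.B (m+d) (z/2)) / k2‖ ≤ D.Y (m+d) (z/2) / k2 := by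
      intro z
      rw [norm_div, Complex.norm_real, Real.norm_of_nonneg h2.le]
      gcongr
      exact D.hB _ _
    have nA1 := nA (2*w)
    have nA2 := nA (2*w+1)
    have nB1 := nB (2*w)
    have nB2 := nB (2*w+1)
    rw [e1] at nA1 nB1
    rw [e2] at nA2 nB2
    have := pot_step D.hr1 D.hr2 D.hs1 D.hs2 (D.St k1 k2 m d w) (D.St_inv h1 h2 m d w)
      _ _ _ _ (D.X (m+d) w / k1) (D.Y (m+d) w / k2)
      (div_pos (D.hX _ _) h1) (div_pos (D.hY _ _) h2) nA1 nA2 nB1 nB2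
      (D.mA.imp (fun h => by
        have := h (m+d) w
        rw [← add_div, _root_.div_eq_zero_iff]; left
        linear_combination this) id)
      (D.mB.imp (fun h => by
        have := h (m+d) w
        rw [← add_div, _root_.div_eq_zero_iff]; left
        linear_combination this) id) Bx By
    simp only [St, e1, e2]
    linarith

open Classical in
/-- the fraction of alive descendants with count at least ν -/
lemma E_count_le {k1 k2 : ℝ} (h1 : 0 < k1) (h2 : 0 < k2) (Bx By ν : ℝ) (hBx : 0 ≤ Bx) (hBy : 0 ≤ By)
    (hν : 0 < ν) (m d : ℕ) (z : ℤ) :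
    E1^[d] (fun w => if (D.St k1 k2 m d w).uX ≤ Bx ∧ (D.St k1 k2 m d w).uY ≤ By ∧
      ν ≤ (D.St k1 k2 m d w).c then (1:ℝ) else 0) z ≤ 7 * (Bx + By) / ν := by
  have h := D.E_pot_le h1 h2 Bx By m d z
  have e : pot Bx By State.start = 7 * (Bx + By) := by
    simp [pot, State.start, hBx, hBy]; ring
  rw [e] at h
  rw [le_div_iff₀ hν, mul_comm, ← E_smul]
  refine le_trans (E_mono_desc _ _ _ _ fun w _ => ?_) h
  split_ifs with hc
  · obtain ⟨c1, c2, c3⟩ := hc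
    have hI := D.St_inv h1 h2 m d w
    simp only [pot, c1, c2, and_self, if_true]
    have := hI.hs0
    nlinarith [sq_nonneg ‖(D.St k1 k2 m d w).dA‖, sq_nonneg ‖(D.St k1 k2 m d w).dB‖, sq_nonneg ‖(D.St k1 k2 m d w).M‖]
  · rw [mul_zero]
    exact pot_nonneg _ _ _ (D.St_inv h1 h2 m d w)

end TD


/-! ## Pathwise deterministic analysis -/

def Mq (A B : ℕ → ℂ) (m n : ℕ) : ℂ := ∑ j ∈ Finset.Ico m n, (A j - A m) * (B (j+1) - B j)

def Tq (A B : ℕ → ℂ) (X Y : ℕ → ℝ) (m n : ℕ) : ℝ :=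
  ‖Mq A B m n‖ + X m * ‖B n - B m‖ + ‖A n - A m‖ * Y (n-1) + 2 * ∑ j ∈ Finset.Ico m n, X j * Y j
    + X m * Y (n-1) + X (n-1) * Y (n-1)

structure GoodP (A B : ℕ → ℂ) (X Y : ℕ → ℝ) (m n : ℕ) (k1 k2 : ℝ) : Prop where
  hX : ∀ j, m ≤ j → j < n → X j ≤ k1
  hY : ∀ j, m ≤ j → j < n → Y j ≤ k2
  hA : ∀ j, m ≤ j → j ≤ n → ‖A j - A m‖ ≤ k1
  hB : ∀ j, m ≤ j → j ≤ n → ‖B j - B m‖ ≤ k2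
  hM : ∀ j, m ≤ j → j ≤ n → ‖Mq A B m j‖ ≤ k1 * k2
  hS : ∀ j, m ≤ j → j ≤ n → ∑ i ∈ Finset.Ico m j, X i * Y i ≤ k1 * k2

section path
variable {A B : ℕ → ℂ} {X Y : ℕ → ℝ}

lemma Mq_concat {m n l : ℕ} (h1 : m ≤ n) (h2 : n ≤ l) :
    Mq A B m l = Mq A B m n + Mq A B n l + (A n - A m) * (B l - B n) := by
  unfold Mq
  rw [← Finset.sum_Ico_consecutive _ h1 h2]
  have e : B l - B n = ∑ j ∈ Finset.Ico n l, (B (j+1) - B j) := (Finset.sum_Ico_sub B h2).symm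
  rw [e, Finset.mul_sum, add_assoc, ← Finset.sum_add_distrib]
  congr 1
  refine Finset.sum_congr rfl fun j _ => ?_
  ring

lemma GoodP.T_le {m n : ℕ} {k1 k2 : ℝ} (hX0 : ∀ j, 0 < X j) (hY0 : ∀ j, 0 < Y j) (h : GoodP A B X Y m n k1 k2)
    {m' n' : ℕ} (h1 : m ≤ m') (h2 : m' < n') (h3 : n' ≤ n) : Tq A B X Y m' n' ≤ 12 * (k1 * k2) := by
  have a1 : ‖A n' - A m'‖ ≤ 2 * k1 := by
    have e : A n' - A m' = (A n' - A m) - (A m' - A m) := by ring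
    rw [e]
    have := norm_sub_le (A n' - A m) (A m' - A m)
    have := h.hA n' (by omega) h3
    have := h.hA m' (by omega) (by omega)
    linarith
  have b1 : ‖B n' - B m'‖ ≤ 2 * k2 := by
    have e : B n' - B m' = (B n' - B m) - (B m' - B m) := by ring
    rw [e]
    have := norm_sub_le (B n' - B m) (B m' - B m)
    have := h.hB n' (by omega) h3
    have := h.hB m' (by omega) (by omega)
    linarith
  have x1 := h.hX m' h1 (by omega)
  have x2 := h.hX (n'-1) (by omega) (by omega)
  have y2 := h.hY (n'-1) (by omega) (by omega)
  have px1 := hX0 m'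
  have px2 := hX0 (n'-1)
  have py2 := hY0 (n'-1)
  have pk1 : 0 < k1 := by linarith
  have pk2 : 0 < k2 := by linarith
  have m1 : ‖Mq A B m' n'‖ ≤ 4 * (k1 * k2) := by
    have e : Mq A B m' n' = Mq A B m n' - Mq A B m m' - (A m' - A m) * (B n' - B m') := by
      rw [Mq_concat h1 h2.le]; ring
    rw [e]
    have i1 := norm_sub_le (Mq A B m n' - Mq A B m m') ((A m' - A m) * (B n' - B m'))
    have i2 := norm_sub_le (Mq A B m n') (Mq A B m m')
    have i3 := h.hM n' (by omega) h3
    have i4 := h.hM m' (by omega) (by omega)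
    have i5 : ‖(A m' - A m) * (B n' - B m')‖ ≤ k1 * (2 * k2) := by
      rw [norm_mul]
      gcongr
      exact h.hA m' (by omega) (by omega)
    linarith
  have s1 : ∑ j ∈ Finset.Ico m' n', X j * Y j ≤ k1 * k2 := by
    refine le_trans ?_ (h.hS n' (by omega) h3)
    apply Finset.sum_le_sum_of_subset_of_nonneg
    · exact Finset.Ico_subset_Ico_left h1
    · intro i _ _; exact (mul_pos (hX0 i) (hY0 i)).le
  have t1 : X m' * ‖B n' - B m'‖ ≤ k1 * (2 * k2) := by gcongr
  have t2 : ‖A n' - A m'‖ * Y (n'-1) ≤ 2 * k1 * k2 := by gcongr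
  have t3 : X m' * Y (n'-1) ≤ k1 * k2 := by gcongr
  have t4 : X (n'-1) * Y (n'-1) ≤ k1 * k2 := by gcongr
  unfold Tq
  linarith

lemma GoodP.concat {m n l : ℕ} {k1 k2 k1' k2' : ℝ}
    (hk1 : 0 ≤ k1) (hk2 : 0 ≤ k2) (hk1' : 0 ≤ k1') (hk2' : 0 ≤ k2')
    (hmn : m ≤ n) (hnl : n ≤ l) (h : GoodP A B X Y m n k1 k2) (h' : GoodP A B X Y n l k1' k2') :
    GoodP A B X Y m l (k1+k1') (k2+k2') := by
  have p1 := mul_nonneg hk1 hk2'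
  have p2 := mul_nonneg hk1' hk2
  have p3 := mul_nonneg hk1' hk2'
  have p4 := mul_nonneg hk1 hk2
  constructor
  · intro j h1 h2
    rcases lt_or_ge j n with h3 | h3
    · linarith [h.hX j h1 h3]
    · linarith [h'.hX j h3 h2]
  · intro j h1 h2
    rcases lt_or_ge j n with h3 | h3
    · linarith [h.hY j h1 h3]
    · linarith [h'.hY j h3 h2]
  · intro j h1 h2
    rcases le_or_gt j n with h3 | h3
    · linarith [h.hA j h1 h3]
    · have := norm_add_le (A n - A m) (A j - A n)
      rw [show A n - A m + (A j - A n) = A j - A m by ring] at this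
      linarith [h.hA n hmn le_rfl, h'.hA j h3.le h2]
  · intro j h1 h2
    rcases le_or_gt j n with h3 | h3
    · linarith [h.hB j h1 h3]
    · have := norm_add_le (B n - B m) (B j - B n)
      rw [show B n - B m + (B j - B n) = B j - B m by ring] at this
      linarith [h.hB n hmn le_rfl, h'.hB j h3.le h2]
  · intro j h1 h2
    rcases le_or_gt j n with h3 | h3
    · nlinarith [h.hM j h1 h3]
    · rw [Mq_concat hmn h3.le]
      have i1 := norm_add_le (Mq A B m n + Mq A B n j) ((A n - A m) * (B j - B n))
      have i2 := norm_add_le (Mq A B m n) (Mq A B n j)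
      have i3 := h.hM n hmn le_rfl
      have i4 := h'.hM j h3.le h2
      have i5 : ‖(A n - A m) * (B j - B n)‖ ≤ k1 * k2' := by
        rw [norm_mul]
        gcongr
        · exact h.hA n hmn le_rfl
        · exact h'.hB j h3.le h2
      nlinarith
  · intro j h1 h2
    rcases le_or_gt j n with h3 | h3
    · nlinarith [h.hS j h1 h3]
    · rw [← Finset.sum_Ico_consecutive _ hmn h3.le]
      nlinarith [h.hS n hmn le_rfl, h'.hS j h3.le h2]

lemma GoodP.single {n : ℕ} {k1 k2 : ℝ} (hX0 : 0 < X n) (hY0 : 0 < Y n) (h1 : X n ≤ k1) (h2 : Y n ≤ k2)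
    (hA : ‖A (n+1) - A n‖ ≤ X n) (hB : ‖B (n+1) - B n‖ ≤ Y n) : GoodP A B X Y n (n+1) k1 k2 := by
  have pk1 : 0 < k1 := by linarith
  have pk2 : 0 < k2 := by linarith
  constructor
  · intro j i1 i2
    obtain rfl : j = n := by omega
    exact h1
  · intro j i1 i2
    obtain rfl : j = n := by omega
    exact h2
  · intro j i1 i2
    obtain rfl | rfl : j = n ∨ j = n+1 := by omega
    · simp [pk1.le]
    · linarith
  · intro j i1 i2
    obtain rfl | rfl : j = n ∨ j = n+1 := by omega
    · simp [pk2.le]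
    · linarith
  · intro j i1 i2
    obtain rfl | rfl : j = n ∨ j = n+1 := by omega
    · simp [Mq]; positivity
    · simp [Mq]; positivity
  · intro j i1 i2
    obtain rfl | rfl : j = n ∨ j = n+1 := by omega
    · simp; positivity
    · simp; gcongr

lemma GoodP.refl {n : ℕ} {k1 k2 : ℝ} (pk1 : 0 < k1) (pk2 : 0 < k2) : GoodP A B X Y n n k1 k2 := by
  constructor
  · intro j i1 i2; omega
  · intro j i1 i2; omega
  all_goals
    intro j i1 i2
    obtain rfl : j = n := by omega
    simp [Mq]; positivity

/-- cells of the state sequence -/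
lemma cell {r s k1 k2 : ℝ} (pk1 : 0 < k1) (pk2 : 0 < k2)
    (m D : ℕ) (S : ℕ → State) (h0 : S 0 = State.start)
    (hS : ∀ d, d < D → S (d+1) = stp r s (S d) ((A (m+d+1) - A (m+d)) / k1) ((B (m+d+1) - B (m+d)) / k2)
      (X (m+d) / k1) (Y (m+d) / k2)) (d : ℕ) (hd : d ≤ D) :
    ∃ e, m ≤ e ∧ e ≤ m + d ∧ GoodP A B X Y e (m+d) k1 k2 ∧ (S d).dA = (A (m+d) - A e) / k1 ∧
      (S d).dB = (B (m+d) - B e) / k2 ∧ (S d).M = Mq A B e (m+d) / (k1 * k2) ∧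
      (S d).s = (∑ i ∈ Finset.Ico e (m+d), X i * Y i) / (k1 * k2) ∧
      (∀ d', d' ≤ d → (S d').c ≤ (S d).c) ∧
      (∀ d', d' ≤ d → (S d').c = (S d).c → e ≤ m + d') := by
  have qk1 : (k1:ℂ) ≠ 0 := by exact_mod_cast pk1.ne'
  have qk2 : (k2:ℂ) ≠ 0 := by exact_mod_cast pk2.ne'
  induction d with
  | zero =>
    refine ⟨m, le_rfl, le_rfl, GoodP.refl pk1 pk2, ?_, ?_, ?_, ?_, ?_, ?_⟩
    · simp [h0, State.start]
    · simp [h0, State.start]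
    · simp [h0, State.start, Mq]
    · simp [h0, State.start]
    · intro d' hd'; rw [Nat.le_zero.mp hd']
    · intro d' hd' _; omega
  | succ d ih =>
    obtain ⟨e, he1, he2, hG, hdA, hdB, hM, hs, hc1, hc2⟩ := ih (by omega)
    have hst := hS d (by omega)
    by_cases hv : viol (S d) ((A (m+d+1) - A (m+d)) / k1) ((B (m+d+1) - B (m+d)) / k2)
      (X (m+d) / k1) (Y (m+d) / k2)
    · have hst' : S (d+1) = ⟨0, 0, 0, 0, (S d).uX + (X (m+d) / k1)^r, (S d).uY + (Y (m+d) / k2)^s, (S d).c + 1⟩ := by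
        rw [hst, stp, if_pos hv]
      refine ⟨m+(d+1), by omega, le_rfl, GoodP.refl pk1 pk2, ?_, ?_, ?_, ?_, ?_, ?_⟩
      · simp [hst']
      · simp [hst']
      · simp [hst', Mq]
      · simp [hst']
      · intro d' hd'
        rcases hd'.eq_or_lt with h | h
        · rw [h]
        · have := hc1 d' (by omega)
          rw [hst']; simp only; omega
      · intro d' hd' hc
        rcases hd'.eq_or_lt with h | h
        · rw [h]
        · have := hc1 d' (by omega)
          rw [hst'] at hc; simp only at hc; omega
    · have hst' : S (d+1) = ⟨(S d).dA + (A (m+d+1) - A (m+d)) / k1, (S d).dB + (B (m+d+1) - B (m+d)) / k2,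
          (S d).M + (S d).dA * ((B (m+d+1) - B (m+d)) / k2), (S d).s + (X (m+d) / k1) * (Y (m+d) / k2),
          (S d).uX + (X (m+d) / k1)^r, (S d).uY + (Y (m+d) / k2)^s, (S d).c⟩ := by
        rw [hst, stp, if_neg hv]
      have nA : (S (d+1)).dA = (A (m+(d+1)) - A e) / k1 := by
        rw [hst']; simp only [hdA]; rw [← add_div]; congr 1; rw [← add_assoc]; ring
      have nB : (S (d+1)).dB = (B (m+(d+1)) - B e) / k2 := by
        rw [hst']; simp only [hdB]; rw [← add_div]; congr 1; rw [← add_assoc]; ring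
      have nM : (S (d+1)).M = Mq A B e (m+(d+1)) / (k1 * k2) := by
        rw [hst']; simp only [hM, hdA]
        unfold Mq
        rw [← add_assoc, Finset.sum_Ico_succ_top he2]
        field_simp
      have ns : (S (d+1)).s = (∑ i ∈ Finset.Ico e (m+(d+1)), X i * Y i) / (k1 * k2) := by
        rw [hst']; simp only [hs]
        rw [← add_assoc, Finset.sum_Ico_succ_top he2]
        field_simp
      have e1 : (S (d+1)).dA = (S d).dA + (A (m+d+1) - A (m+d)) / k1 := by rw [hst']
      have e2 : (S (d+1)).dB = (S d).dB + (B (m+d+1) - B (m+d)) / k2 := by rw [hst']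
      have e3 : (S (d+1)).M = (S d).M + (S d).dA * ((B (m+d+1) - B (m+d)) / k2) := by rw [hst']
      have e4 : (S (d+1)).s = (S d).s + (X (m+d) / k1) * (Y (m+d) / k2) := by rw [hst']
      simp only [viol, not_or, not_lt] at hv
      rw [← e1, ← e2, ← e3, ← e4, nA, nB, nM, ns] at hv
      obtain ⟨v1, v2, v3, v4, v5, v6⟩ := hv
      rw [div_le_one pk1] at v1
      rw [div_le_one pk2] at v2
      rw [norm_div, Complex.norm_real, Real.norm_of_nonneg pk1.le, div_le_one pk1] at v3
      rw [norm_div, Complex.norm_real, Real.norm_of_nonneg pk2.le, div_le_one pk2] at v4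
      rw [norm_div, norm_mul, Complex.norm_real, Complex.norm_real, Real.norm_of_nonneg pk2.le,
        Real.norm_of_nonneg pk1.le, div_le_one (by positivity)] at v5
      rw [div_le_one (by positivity)] at v6
      refine ⟨e, he1, by omega, ?_, nA, nB, nM, ns, ?_, ?_⟩
      · constructor
        · intro j i1 i2
          rcases (show j < m + d ∨ j = m+d by omega) with h | h
          · exact hG.hX j i1 h
          · rw [h]; exact v1
        · intro j i1 i2
          rcases (show j < m + d ∨ j = m+d by omega) with h | h
          · exact hG.hY j i1 h
          · rw [h]; exact v2
        · intro j i1 i2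
          rcases (show j ≤ m + d ∨ j = m+(d+1) by omega) with h | h
          · exact hG.hA j i1 h
          · rw [h]; exact v3
        · intro j i1 i2
          rcases (show j ≤ m + d ∨ j = m+(d+1) by omega) with h | h
          · exact hG.hB j i1 h
          · rw [h]; exact v4
        · intro j i1 i2
          rcases (show j ≤ m + d ∨ j = m+(d+1) by omega) with h | h
          · exact hG.hM j i1 h
          · rw [h]; exact v5
        · intro j i1 i2
          rcases (show j ≤ m + d ∨ j = m+(d+1) by omega) with h | h
          · exact hG.hS j i1 h
          · rw [h]; exact v6
      · intro d' hd'
        rcases hd'.eq_or_lt with h | h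
        · rw [h]
        · have := hc1 d' (by omega)
          rw [hst']; exact this
      · intro d' hd' hc
        rcases hd'.eq_or_lt with h | h
        · rw [h]; omega
        · rw [hst'] at hc; exact hc2 d' (by omega) hc

end path

lemma pq_sum_le {ι : Type} (S : Finset ι) (p q : ι → ℝ) (hp : ∀ i ∈ S, 0 ≤ p i) (hq : ∀ i ∈ S, 0 ≤ q i) (P Q t : ℝ)
    (hP : ∑ i ∈ S, p i ≤ P) (hQ : ∑ i ∈ S, q i ≤ Q) (ht : 1/2 ≤ t) : ∑ i ∈ S, (p i * q i)^t ≤ (P * Q)^t := by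
  have hP0 : 0 ≤ P := (Finset.sum_nonneg hp).trans hP
  have hQ0 : 0 ≤ Q := (Finset.sum_nonneg hq).trans hQ
  have hpP : ∀ i ∈ S, p i ≤ P := fun i hi => (Finset.single_le_sum hp hi).trans hP
  have hqQ : ∀ i ∈ S, q i ≤ Q := fun i hi => (Finset.single_le_sum hq hi).trans hQ
  by_cases h0 : P = 0 ∨ Q = 0
  · rw [Finset.sum_eq_zero]
    · positivity
    · intro i hi
      have : p i * q i = 0 := by
        rcases h0 with h | h
        · rw [le_antisymm (h ▸ hpP i hi) (hp i hi), zero_mul]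
        · rw [le_antisymm (h ▸ hqQ i hi) (hq i hi), mul_zero]
      rw [this, Real.zero_rpow (by linarith)]
  · push Not at h0
    have pP : 0 < P := lt_of_le_of_ne hP0 (Ne.symm h0.1)
    have pQ : 0 < Q := lt_of_le_of_ne hQ0 (Ne.symm h0.2)
    have key : ∀ i ∈ S, (p i * q i)^t ≤ (P*Q)^t * ((p i / P + q i / Q)/2) := by
      intro i hi
      have a0 : 0 ≤ p i / P := div_nonneg (hp i hi) hP0
      have b0 : 0 ≤ q i / Q := div_nonneg (hq i hi) hQ0
      have a1 : p i / P ≤ 1 := (div_le_one pP).mpr (hpP i hi)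
      have b1 : q i / Q ≤ 1 := (div_le_one pQ).mpr (hqQ i hi)
      have e : p i * q i = (P * Q) * ((p i / P) * (q i / Q)) := by field_simp
      rw [e, Real.mul_rpow (by positivity) (by positivity)]
      gcongr
      set u := p i / P
      set v := q i / Q
      rcases (mul_nonneg a0 b0).eq_or_lt with h | h
      · rw [← h, Real.zero_rpow (by linarith)]; linarith
      · calc (u * v)^t ≤ (u*v)^(1/2 : ℝ) := by
              apply Real.rpow_le_rpow_of_exponent_ge h _ ht
              nlinarith
          _ ≤ (u + v)/2 := by
              rw [← Real.sqrt_eq_rpow]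
              apply Real.sqrt_le_iff.mpr
              constructor
              · linarith
              · nlinarith [sq_nonneg (u - v)]
    calc ∑ i ∈ S, (p i * q i)^t ≤ ∑ i ∈ S, (P*Q)^t * ((p i / P + q i / Q)/2) := Finset.sum_le_sum key
      _ = (P*Q)^t * (((∑ i ∈ S, p i) / P + (∑ i ∈ S, q i) / Q)/2) := by
          rw [← Finset.mul_sum, ← Finset.sum_div, Finset.sum_add_distrib, Finset.sum_div, Finset.sum_div]
      _ ≤ (P*Q)^t * ((1 + 1)/2) := by
          gcongr
          · exact (div_le_one pP).mpr hP
          · exact (div_le_one pQ).mpr hQ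
      _ = _ := by ring


/-! ## Stopping rule on the tree -/
namespace TD
variable (D : TD)

def t : ℝ := D.r * D.s / (D.r + D.s)

lemma t_pos : 0 < D.t := by
  have := D.hr1; have := D.hs1
  unfold t; positivity

lemma t_ge : 1/2 ≤ D.t := by
  have := D.hr1; have := D.hs1
  unfold t
  rw [le_div_iff₀ (by linarith)]
  nlinarith

lemma t_le : D.t ≤ 1 := by
  have := D.hr1; have := D.hs1; have := D.hr2; have := D.hs2
  unfold t
  rw [div_le_one (by linarith)]
  nlinarith

/-- sums of r-th powers along the path to node `z` at generation `n`, from generation `m` -/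
def sX (m n : ℕ) (z : ℤ) : ℝ := ∑ i ∈ Finset.Icc m n, D.X i (z / 2^(n-i)) ^ D.r
def sY (m n : ℕ) (z : ℤ) : ℝ := ∑ i ∈ Finset.Icc m n, D.Y i (z / 2^(n-i)) ^ D.s

def alf (K : ℕ) (z : ℤ) : ℝ := (D.sX 0 K z) ^ (1 / D.r)
def bet (K : ℕ) (z : ℤ) : ℝ := (D.sY 0 K z) ^ (1 / D.s)

def aa (K n : ℕ) (z : ℤ) : ℝ := E1^[K-n] (D.alf K) z
def bb (K n : ℕ) (z : ℤ) : ℝ := E1^[K-n] (D.bet K) z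

/-- exchange the roles of `A` and `B` -/
def flip : TD where
  A := D.B
  B := D.A
  X := D.Y
  Y := D.X
  r := D.s
  s := D.r
  hr1 := D.hs1
  hr2 := D.hs2
  hs1 := D.hr1
  hs2 := D.hr2
  hX := D.hY
  hY := D.hX
  hA := D.hB
  hB := D.hA
  mA := D.mB
  mB := D.mA

lemma X_le_sX {m n i : ℕ} (h1 : m ≤ i) (h2 : i ≤ n) (z : ℤ) : D.X i (z / 2^(n-i)) ^ D.r ≤ D.sX m n z := by
  unfold sX
  exact Finset.single_le_sum (f := fun i => D.X i (z / 2^(n-i)) ^ D.r)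
    (fun j _ => (Real.rpow_pos_of_pos (D.hX _ _) _).le) (Finset.mem_Icc.mpr ⟨h1, h2⟩)

lemma rpow_inv_r {x : ℝ} (hx : 0 ≤ x) : (x ^ D.r) ^ (1/D.r) = x := by
  have := D.hr1
  rw [← Real.rpow_mul hx, mul_one_div_cancel (by linarith), Real.rpow_one]

lemma X_le_alf {K i : ℕ} (h2 : i ≤ K) (z : ℤ) : D.X i (z / 2^(K-i)) ≤ D.alf K z := by
  have := D.hr1
  rw [← D.rpow_inv_r (D.hX i _).le]
  unfold alf
  apply Real.rpow_le_rpow (Real.rpow_pos_of_pos (D.hX _ _) _).le (D.X_le_sX (Nat.zero_le _) h2 z)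
  positivity

lemma alf_pos (K : ℕ) (z : ℤ) : 0 < D.alf K z :=
  (D.hX K _).trans_le (D.X_le_alf le_rfl z)

lemma X_le_aa {K n : ℕ} (hn : n ≤ K) (z : ℤ) : D.X n z ≤ D.aa K n z := by
  unfold aa
  rw [← E_const (K-n) (D.X n z) z]
  apply E_mono_desc
  intro w hw
  rw [← hw]
  exact D.X_le_alf hn w

lemma Y_le_bb {K n : ℕ} (hn : n ≤ K) (z : ℤ) : D.Y n z ≤ D.bb K n z := D.flip.X_le_aa hn z

lemma aa_pos {K n : ℕ} (hn : n ≤ K) (z : ℤ) : 0 < D.aa K n z := (D.hX _ _).trans_le (D.X_le_aa hn z)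
lemma bb_pos {K n : ℕ} (hn : n ≤ K) (z : ℤ) : 0 < D.bb K n z := (D.hY _ _).trans_le (D.Y_le_bb hn z)

def C0 : ℝ := 12 * (112 * 8)^2

def nu (K : ℕ) (lam : ℝ) (m : ℕ) (ζ : ℤ) : ℝ := max 1 ((C0 * D.aa K m ζ * D.bb K m ζ / lam) ^ D.t)

lemma one_le_nu (K : ℕ) (lam : ℝ) (m : ℕ) (ζ : ℤ) : 1 ≤ D.nu K lam m ζ := le_max_left _ _

def cA (K m : ℕ) (ζ : ℤ) : ℝ := 112 * 8 * D.aa K m ζ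
def cB (K m : ℕ) (ζ : ℤ) : ℝ := 112 * 8 * D.bb K m ζ
def fA (K : ℕ) (lam : ℝ) (m : ℕ) (ζ : ℤ) : ℝ := D.cA K m ζ * (D.nu K lam m ζ) ^ (-(1 / D.r))
def fB (K : ℕ) (lam : ℝ) (m : ℕ) (ζ : ℤ) : ℝ := D.cB K m ζ * (D.nu K lam m ζ) ^ (-(1 / D.s))

lemma cA_pos {K m : ℕ} (hm : m ≤ K) (ζ : ℤ) : 0 < D.cA K m ζ := by
  have := D.aa_pos hm ζ; unfold cA; positivity
lemma cB_pos {K m : ℕ} (hm : m ≤ K) (ζ : ℤ) : 0 < D.cB K m ζ := by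
  have := D.bb_pos hm ζ; unfold cB; positivity
lemma fA_pos {K m : ℕ} (lam : ℝ) (hm : m ≤ K) (ζ : ℤ) : 0 < D.fA K lam m ζ := by
  have := D.cA_pos hm ζ; have := D.one_le_nu K lam m ζ; unfold fA; positivity
lemma fB_pos {K m : ℕ} (lam : ℝ) (hm : m ≤ K) (ζ : ℤ) : 0 < D.fB K lam m ζ := by
  have := D.cB_pos hm ζ; have := D.one_le_nu K lam m ζ; unfold fB; positivity

lemma f_prod {K m : ℕ} {lam : ℝ} (hl : 0 < lam) (hm : m ≤ K) (ζ : ℤ) :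
    12 * (D.fA K lam m ζ * D.fB K lam m ζ) ≤ lam := by
  have h1 := D.one_le_nu K lam m ζ
  have ha := D.aa_pos hm ζ
  have hb := D.bb_pos hm ζ
  have hr := D.hr1
  have hs := D.hs1
  have ht := D.t_pos
  have e : 12 * (D.fA K lam m ζ * D.fB K lam m ζ) = (C0 * D.aa K m ζ * D.bb K m ζ) * (D.nu K lam m ζ) ^ (-(1/D.t)) := by
    have e2 : (D.nu K lam m ζ) ^ (-(1/D.t)) = (D.nu K lam m ζ) ^ (-(1 / D.r)) * (D.nu K lam m ζ) ^ (-(1 / D.s)) := by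
      rw [← Real.rpow_add (by linarith)]
      congr 1
      unfold t
      field_simp
      ring
    rw [e2]
    unfold fA fB cA cB C0
    ring
  rw [e, Real.rpow_neg (by linarith), ← div_eq_mul_inv, div_le_iff₀ (by positivity)]
  have h2 : (C0 * D.aa K m ζ * D.bb K m ζ / lam) ≤ (D.nu K lam m ζ) ^ (1/D.t) := by
    have hc : 0 ≤ C0 * D.aa K m ζ * D.bb K m ζ / lam := by unfold C0; positivity
    calc C0 * D.aa K m ζ * D.bb K m ζ / lam = ((C0 * D.aa K m ζ * D.bb K m ζ / lam)^D.t) ^ (1/D.t) := by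
          rw [← Real.rpow_mul hc, mul_one_div_cancel ht.ne', Real.rpow_one]
      _ ≤ _ := by
          apply Real.rpow_le_rpow (by positivity) (le_max_right _ _) (by positivity)
  rw [div_le_iff₀ hl] at h2
  linarith

def bad (K : ℕ) (lam : ℝ) (m n : ℕ) (z : ℤ) : Prop :=
  (8 * D.aa K m (z / 2^(n-m))) ^ D.r < D.sX m n z ∨ (8 * D.bb K m (z / 2^(n-m))) ^ D.s < D.sY m n z ∨
  1 ≤ (D.St (D.cA K m (z / 2^(n-m))) (D.cB K m (z / 2^(n-m))) m (n-m) z).c ∨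
  D.nu K lam m (z / 2^(n-m)) ≤ (D.St (D.fA K lam m (z / 2^(n-m))) (D.fB K lam m (z / 2^(n-m))) m (n-m) z).c

lemma sX_succ (m n : ℕ) (h : m ≤ n + 1) (z : ℤ) : D.sX m (n+1) z = D.sX m n (z/2) + D.X (n+1) z ^ D.r := by
  unfold sX
  rw [Finset.sum_Icc_succ_top h]
  congr 1
  · apply Finset.sum_congr rfl
    intro i hi
    rw [Finset.mem_Icc] at hi
    rw [← div_pow_succ', show n + 1 - i = n - i + 1 by omega]
  · simp

lemma St_uX (k1 k2 : ℝ) (h1 : 0 < k1) (m d : ℕ) (z : ℤ) :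
    (D.St k1 k2 m d z).uX ≤ D.sX m (m+d) z / k1 ^ D.r := by
  have key : ∀ d z, (D.St k1 k2 m d z).uX + (D.X (m+d) z / k1) ^ D.r = D.sX m (m+d) z / k1 ^ D.r := by
    intro d
    induction d with
    | zero =>
      intro z
      simp [St, State.start, sX, Real.div_rpow (D.hX _ _).le h1.le]
    | succ d ih =>
      intro z
      rw [St, stp_uX, ih (z/2), Real.div_rpow (D.hX _ _).le h1.le, ← add_div, ← add_assoc,
        D.sX_succ m (m+d) (by omega)]
  have := key d z
  have p := Real.rpow_pos_of_pos (div_pos (D.hX (m+d) z) h1) D.r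
  linarith

lemma St_uY (k1 k2 : ℝ) (h1 : 0 < k2) (m d : ℕ) (z : ℤ) :
    (D.St k1 k2 m d z).uY ≤ D.sY m (m+d) z / k2 ^ D.s := by
  have key : ∀ d z, (D.St k1 k2 m d z).uY + (D.Y (m+d) z / k2) ^ D.s = D.sY m (m+d) z / k2 ^ D.s := by
    intro d
    induction d with
    | zero =>
      intro z
      simp [St, State.start, sY, Real.div_rpow (D.hY _ _).le h1.le]
    | succ d ih =>
      intro z
      rw [St, stp_uY, ih (z/2), Real.div_rpow (D.hY _ _).le h1.le, ← add_div, ← add_assoc]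
      exact congrArg (· / k2 ^ D.s) (D.flip.sX_succ m (m+d) (by omega) z).symm
  have := key d z
  have p := Real.rpow_pos_of_pos (div_pos (D.hY (m+d) z) h1) D.s
  linarith

lemma St_c_mono (k1 k2 : ℝ) (m d k : ℕ) (z : ℤ) : (D.St k1 k2 m d (z / 2^k)).c ≤ (D.St k1 k2 m (d+k) z).c := by
  induction k generalizing z with
  | zero => simp
  | succ k ih =>
    rw [div_pow_succ']
    refine (ih (z/2)).trans ?_
    rw [← add_assoc, St, stp]
    split_ifs <;> simp

end TD


namespace TD
variable (D : TD)

lemma sX_mono {K m n : ℕ} (hn : n ≤ K) (w : ℤ) : D.sX m n (w / 2^(K-n)) ≤ D.sX 0 K w := by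
  unfold sX
  calc ∑ i ∈ Finset.Icc m n, D.X i (w / 2^(K-n) / 2^(n-i)) ^ D.r
      = ∑ i ∈ Finset.Icc m n, D.X i (w / 2^(K-i)) ^ D.r := by
        apply Finset.sum_congr rfl
        intro i hi
        rw [Finset.mem_Icc] at hi
        rw [← div_pow_add, show K - n + (n - i) = K - i by omega]
    _ ≤ _ := by
        apply Finset.sum_le_sum_of_subset_of_nonneg
        · intro i hi
          rw [Finset.mem_Icc] at hi ⊢
          omega
        · intro i _ _
          exact (Real.rpow_pos_of_pos (D.hX _ _) _).le

lemma sX_eq (K : ℕ) (w : ℤ) : D.sX 0 K w = D.alf K w ^ D.r := by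
  unfold alf
  have := D.hr1
  rw [← Real.rpow_mul, one_div_mul_cancel (by linarith), Real.rpow_one]
  exact Finset.sum_nonneg fun i _ => (Real.rpow_pos_of_pos (D.hX _ _) _).le

lemma sX_le_of {K m n : ℕ} (hn : n ≤ K) (w : ℤ) {c : ℝ} (h : D.alf K w ≤ c) :
    D.sX m n (w / 2^(K-n)) ≤ c ^ D.r := by
  refine (D.sX_mono hn w).trans ?_
  rw [sX_eq]
  have := D.hr1
  exact Real.rpow_le_rpow (D.alf_pos K w).le h (by linarith)

lemma sY_le_of {K m n : ℕ} (hn : n ≤ K) (w : ℤ) {c : ℝ} (h : D.bet K w ≤ c) :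
    D.sY m n (w / 2^(K-n)) ≤ c ^ D.s := D.flip.sX_le_of hn w h

lemma rp_aux {r : ℝ} (hr : 1 ≤ r) {a : ℝ} (ha : 0 < a) : (8 * a)^r / (112 * 8 * a) ^ r ≤ 1/112 := by
  rw [← Real.div_rpow (by positivity) (by positivity)]
  have : 8 * a / (112 * 8 * a) = 1/112 := by field_simp
  rw [this]
  calc ((1:ℝ)/112)^r ≤ (1/112)^(1:ℝ) := Real.rpow_le_rpow_of_exponent_ge (by norm_num) (by norm_num) hr
    _ = _ := Real.rpow_one _

lemma rp_aux2 {r : ℝ} (hr : 1 ≤ r) {a v : ℝ} (ha : 0 < a) (hv : 1 ≤ v) :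
    (8 * a)^r / (112 * 8 * a * v^(-(1/r))) ^ r ≤ v/112 := by
  have h := rp_aux hr ha
  rw [Real.mul_rpow (x := 112 * 8 * a) (by positivity) (by positivity), ← Real.rpow_mul (x := v) (by positivity)]
  have e : -(1/r) * r = -1 := by field_simp
  rw [e, Real.rpow_neg_one]
  have : (8 * a)^r / ((112 * 8 * a) ^ r * v⁻¹) = ((8 * a)^r / (112 * 8 * a) ^ r) * v := by field_simp
  rw [this]
  nlinarith

lemma markov {K m : ℕ} (hm : m ≤ K) (ζ : ℤ) :
    E1^[K-m] (fun w => if 8 * D.aa K m ζ < D.alf K w then (1:ℝ) else 0) ζ ≤ 1/8 := by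
  have ha := D.aa_pos hm ζ
  calc _ ≤ E1^[K-m] (fun w => (8 * D.aa K m ζ)⁻¹ * D.alf K w) ζ := by
        apply E_mono_desc
        intro w _
        have := D.alf_pos K w
        split_ifs with h
        · rw [inv_mul_eq_div, le_div_iff₀ (by positivity)]; linarith
        · positivity
    _ = (8 * D.aa K m ζ)⁻¹ * D.aa K m ζ := by rw [E_smul]; rfl
    _ = 1/8 := by field_simp
    _ ≤ _ := le_rfl

open Classical in
lemma frac {K m : ℕ} {lam : ℝ} (hm : m ≤ K) (ζ : ℤ) :
    E1^[K-m] (fun w => if ∃ n, m < n ∧ n ≤ K ∧ D.bad K lam m n (w / 2^(K-n)) then (1:ℝ) else 0) ζ ≤ 1/2 := by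
  have ha := D.aa_pos hm ζ
  have hb := D.bb_pos hm ζ
  have hv := D.one_le_nu K lam m ζ
  have h1 := D.markov hm ζ
  have h2 := D.flip.markov hm ζ
  have h3 := D.E_count_le (D.cA_pos hm ζ) (D.cB_pos hm ζ) (1/112) (1/112) 1 (by norm_num) (by norm_num) (by norm_num) m (K-m) ζ
  have h4 := D.E_count_le (D.fA_pos lam hm ζ) (D.fB_pos lam hm ζ) (D.nu K lam m ζ/112) (D.nu K lam m ζ/112)
    (D.nu K lam m ζ) (by positivity) (by positivity) (by positivity) m (K-m) ζ
  have e4 : 7 * (D.nu K lam m ζ / 112 + D.nu K lam m ζ / 112) / D.nu K lam m ζ = 1/8 := by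
    field_simp; norm_num
  rw [e4] at h4
  have e3 : (7:ℝ) * (1 / 112 + 1 / 112) / 1 = 1/8 := by norm_num
  rw [e3] at h3
  have key : E1^[K-m] (fun w => if ∃ n, m < n ∧ n ≤ K ∧ D.bad K lam m n (w / 2^(K-n)) then (1:ℝ) else 0) ζ ≤ _ :=
    E_mono_desc (K-m) _ (fun w => ((if 8 * D.aa K m ζ < D.alf K w then (1:ℝ) else 0) +
      (if 8 * D.flip.aa K m ζ < D.flip.alf K w then (1:ℝ) else 0)) +
      ((if (D.St (D.cA K m ζ) (D.cB K m ζ) m (K-m) w).uX ≤ 1/112 ∧ (D.St (D.cA K m ζ) (D.cB K m ζ) m (K-m) w).uY ≤ 1/112 ∧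
      1 ≤ ((D.St (D.cA K m ζ) (D.cB K m ζ) m (K-m) w).c : ℝ) then (1:ℝ) else 0) +
      (if (D.St (D.fA K lam m ζ) (D.fB K lam m ζ) m (K-m) w).uX ≤ (D.nu K lam m ζ/112) ∧
        (D.St (D.fA K lam m ζ) (D.fB K lam m ζ) m (K-m) w).uY ≤ (D.nu K lam m ζ/112) ∧
      (D.nu K lam m ζ) ≤ ((D.St (D.fA K lam m ζ) (D.fB K lam m ζ) m (K-m) w).c : ℝ) then (1:ℝ) else 0))) ζ ?_
  · rw [E_add, E_add, E_add] at key
    linarith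
  · intro w hw
    have nn : ∀ (P : Prop) [Decidable P], (0:ℝ) ≤ if P then 1 else 0 := by
      intro P _; split_ifs <;> norm_num
    by_cases c0 : ∃ n, m < n ∧ n ≤ K ∧ D.bad K lam m n (w / 2^(K-n))
    swap
    · rw [if_neg c0]
      have := nn; refine add_nonneg (add_nonneg (nn _) (nn _)) (add_nonneg (nn _) (nn _))
    rw [if_pos c0]
    by_cases c1 : 8 * D.aa K m ζ < D.alf K w
    · rw [if_pos c1]
      have := add_nonneg (nn (8 * D.flip.aa K m ζ < D.flip.alf K w)) (add_nonneg (nn ((D.St (D.cA K m ζ) (D.cB K m ζ) m (K-m) w).uX ≤ 1/112 ∧ (D.St (D.cA K m ζ) (D.cB K m ζ) m (K-m) w).uY ≤ 1/112 ∧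
        1 ≤ ((D.St (D.cA K m ζ) (D.cB K m ζ) m (K-m) w).c : ℝ))) (nn ((D.St (D.fA K lam m ζ) (D.fB K lam m ζ) m (K-m) w).uX ≤ (D.nu K lam m ζ/112) ∧
        (D.St (D.fA K lam m ζ) (D.fB K lam m ζ) m (K-m) w).uY ≤ (D.nu K lam m ζ/112) ∧
        (D.nu K lam m ζ) ≤ ((D.St (D.fA K lam m ζ) (D.fB K lam m ζ) m (K-m) w).c : ℝ))))
      linarith
    rw [if_neg c1]
    by_cases c2 : 8 * D.flip.aa K m ζ < D.flip.alf K w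
    · rw [if_pos c2]
      have := (add_nonneg (nn ((D.St (D.cA K m ζ) (D.cB K m ζ) m (K-m) w).uX ≤ 1/112 ∧ (D.St (D.cA K m ζ) (D.cB K m ζ) m (K-m) w).uY ≤ 1/112 ∧
        1 ≤ ((D.St (D.cA K m ζ) (D.cB K m ζ) m (K-m) w).c : ℝ))) (nn ((D.St (D.fA K lam m ζ) (D.fB K lam m ζ) m (K-m) w).uX ≤ (D.nu K lam m ζ/112) ∧
        (D.St (D.fA K lam m ζ) (D.fB K lam m ζ) m (K-m) w).uY ≤ (D.nu K lam m ζ/112) ∧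
        (D.nu K lam m ζ) ≤ ((D.St (D.fA K lam m ζ) (D.fB K lam m ζ) m (K-m) w).c : ℝ))))
      linarith
    rw [if_neg c2]
    push Not at c1 c2
    have x1 : ∀ n, n ≤ K → D.sX m n (w / 2^(K-n)) ≤ (8 * D.aa K m ζ) ^ D.r := fun n hn => D.sX_le_of hn w c1
    have y1 : ∀ n, n ≤ K → D.sY m n (w / 2^(K-n)) ≤ (8 * D.bb K m ζ) ^ D.s := fun n hn => D.sY_le_of hn w c2
    have xK : D.sX m (m + (K-m)) w ≤ (8 * D.aa K m ζ) ^ D.r := by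
      have := x1 K le_rfl; rw [show m + (K-m) = K by omega]; simpa using this
    have yK : D.sY m (m + (K-m)) w ≤ (8 * D.bb K m ζ) ^ D.s := by
      have := y1 K le_rfl; rw [show m + (K-m) = K by omega]; simpa using this
    have ux1 : (D.St (D.cA K m ζ) (D.cB K m ζ) m (K-m) w).uX ≤ 1/112 :=
      (D.St_uX _ _ (D.cA_pos hm ζ) m (K-m) w).trans (le_trans (div_le_div_of_nonneg_right xK (Real.rpow_pos_of_pos (D.cA_pos hm ζ) _).le) (rp_aux D.hr1 ha))
    have uy1 : (D.St (D.cA K m ζ) (D.cB K m ζ) m (K-m) w).uY ≤ 1/112 :=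
      (D.St_uY _ _ (D.cB_pos hm ζ) m (K-m) w).trans (le_trans (div_le_div_of_nonneg_right yK (Real.rpow_pos_of_pos (D.cB_pos hm ζ) _).le) (rp_aux D.hs1 hb))
    have ux2 : (D.St (D.fA K lam m ζ) (D.fB K lam m ζ) m (K-m) w).uX ≤ D.nu K lam m ζ/112 :=
      (D.St_uX _ _ (D.fA_pos lam hm ζ) m (K-m) w).trans (le_trans (div_le_div_of_nonneg_right xK (Real.rpow_pos_of_pos (D.fA_pos lam hm ζ) _).le) (rp_aux2 D.hr1 ha hv))
    have uy2 : (D.St (D.fA K lam m ζ) (D.fB K lam m ζ) m (K-m) w).uY ≤ D.nu K lam m ζ/112 :=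
      (D.St_uY _ _ (D.fB_pos lam hm ζ) m (K-m) w).trans (le_trans (div_le_div_of_nonneg_right yK (Real.rpow_pos_of_pos (D.fB_pos lam hm ζ) _).le) (rp_aux2 D.hs1 hb hv))
    obtain ⟨n, hn1, hn2, hbad⟩ := c0
    have ez : w / 2^(K-n) / 2^(n-m) = ζ := by
      rw [← div_pow_add, show K - n + (n-m) = K - m by omega, hw]
    unfold bad at hbad
    rw [ez] at hbad
    have cm := fun k1 k2 => D.St_c_mono k1 k2 m (n-m) (K-n) w
    rw [show n - m + (K - n) = K - m by omega] at cm
    rcases hbad with h | h | h | h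
    · exact absurd (x1 n hn2) (not_le.mpr h)
    · exact absurd (y1 n hn2) (not_le.mpr h)
    · rw [if_pos ⟨ux1, uy1, by exact_mod_cast h.trans (cm _ _)⟩]
      have := nn ((D.St (D.fA K lam m ζ) (D.fB K lam m ζ) m (K-m) w).uX ≤ (D.nu K lam m ζ/112) ∧
        (D.St (D.fA K lam m ζ) (D.fB K lam m ζ) m (K-m) w).uY ≤ (D.nu K lam m ζ/112) ∧
        (D.nu K lam m ζ) ≤ ((D.St (D.fA K lam m ζ) (D.fB K lam m ζ) m (K-m) w).c : ℝ))
      linarith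
    · have h' : (D.nu K lam m ζ) ≤ ((D.St (D.fA K lam m ζ) (D.fB K lam m ζ) m (K-m) w).c : ℝ) :=
        h.trans (by exact_mod_cast cm _ _)
      rw [if_pos (c := _ ∧ _ ∧ (D.nu K lam m ζ) ≤ _) ⟨ux2, uy2, h'⟩]
      have := nn ((D.St (D.cA K m ζ) (D.cB K m ζ) m (K-m) w).uX ≤ 1/112 ∧ (D.St (D.cA K m ζ) (D.cB K m ζ) m (K-m) w).uY ≤ 1/112 ∧
        1 ≤ ((D.St (D.cA K m ζ) (D.cB K m ζ) m (K-m) w).c : ℝ))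
      linarith

end TD


lemma GoodP.mono {A B : ℕ → ℂ} {X Y : ℕ → ℝ} {m n : ℕ} {k1 k2 k1' k2' : ℝ} (h : GoodP A B X Y m n k1 k2)
    (p1 : 0 ≤ k1) (p2 : 0 ≤ k2) (h1 : k1 ≤ k1') (h2 : k2 ≤ k2') : GoodP A B X Y m n k1' k2' := by
  have : k1 * k2 ≤ k1' * k2' := by gcongr; linarith
  exact ⟨fun j a b => (h.hX j a b).trans h1, fun j a b => (h.hY j a b).trans h2,
    fun j a b => (h.hA j a b).trans h1, fun j a b => (h.hB j a b).trans h2,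
    fun j a b => (h.hM j a b).trans this, fun j a b => (h.hS j a b).trans this⟩

/-- stopping structure along a path -/
structure PathSig (K : ℕ) (σ : ℕ → ℕ) : Prop where
  zero : σ 0 = 0
  step : ∀ n, n < K → σ (n+1) = n+1 ∨ σ (n+1) = σ n

namespace PathSig
variable {K : ℕ} {σ : ℕ → ℕ}

lemma le (h : PathSig K σ) {n : ℕ} (hn : n ≤ K) : σ n ≤ n := by
  induction n with
  | zero => simp [h.zero]
  | succ n ih =>
    have := ih (by omega)
    rcases h.step n (by omega) with h | h <;> omega

lemma idem (h : PathSig K σ) {n : ℕ} (hn : n ≤ K) : σ (σ n) = σ n := by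
  induction n with
  | zero => simp [h.zero]
  | succ n ih =>
    have := ih (by omega)
    rcases h.step n (by omega) with h | h
    · rw [h, h]
    · rw [h, this]

lemma mono (h : PathSig K σ) {m n : ℕ} (hmn : m ≤ n) (hn : n ≤ K) : σ m ≤ σ n := by
  induction n, hmn using Nat.le_induction with
  | base => rfl
  | succ n hmn ih =>
    have := ih (by omega)
    have := h.le (n := n) (by omega)
    rcases h.step n (by omega) with h | h <;> omega

end PathSig

section count
variable {A B : ℕ → ℂ} {X Y : ℕ → ℝ} {K : ℕ} {σ : ℕ → ℕ} {a b : ℕ → ℝ} {c : ℝ}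

lemma chain (hσ : PathSig K σ) (hc : 0 < c) (hX0 : ∀ j, 0 < X j) (hY0 : ∀ j, 0 < Y j)
    (hA : ∀ n, n < K → ‖A (n+1) - A n‖ ≤ X n) (hB : ∀ n, n < K → ‖B (n+1) - B n‖ ≤ Y n)
    (ha : ∀ n, n ≤ K → 0 < a n) (hb : ∀ n, n ≤ K → 0 < b n)
    (hG : ∀ n, n ≤ K → GoodP A B X Y (σ n) n (c * a (σ n)) (c * b (σ n)))
    (hX : ∀ n, n ≤ K → X n ≤ c * a (σ n)) (hY : ∀ n, n ≤ K → Y n ≤ c * b (σ n))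
    (τ : ℕ) (hτ : σ τ = τ) (n : ℕ) (hτn : τ ≤ n) (hn : n < K) :
    GoodP A B X Y τ (n+1) (2 * c * ∑ i ∈ (Finset.Icc τ n).filter (fun i => σ i = i), a i)
      (2 * c * ∑ i ∈ (Finset.Icc τ n).filter (fun i => σ i = i), b i) := by
  induction n using Nat.strong_induction_on with
  | _ n ih =>
    have hs1 : τ ≤ σ n := hτ ▸ hσ.mono hτn hn.le
    have hs2 := hσ.le hn.le
    have hs3 := hσ.idem hn.le
    have pa := mul_pos hc (ha (σ n) (by omega))
    have pb := mul_pos hc (hb (σ n) (by omega))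
    have g1 : GoodP A B X Y (σ n) (n+1) (c * a (σ n) + c * a (σ n)) (c * b (σ n) + c * b (σ n)) :=
      (hG n hn.le).concat pa.le pb.le pa.le pb.le hs2 (by omega)
        (GoodP.single (hX0 n) (hY0 n) (hX n hn.le) (hY n hn.le) (hA n hn) (hB n hn))
    rcases hs1.eq_or_lt with h | h
    · have key : ∀ a : ℕ → ℝ, (∀ n, n ≤ K → 0 < a n) →
          c * a (σ n) + c * a (σ n) ≤ 2 * c * ∑ i ∈ (Finset.Icc τ n).filter (fun i => σ i = i), a i := by
        intro a ha
        have : a τ ≤ ∑ i ∈ (Finset.Icc τ n).filter (fun i => σ i = i), a i := by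
          apply Finset.single_le_sum (f := a)
          · intro i hi; simp at hi; exact (ha i (by omega)).le
          · simp [hτ, hτn]
        rw [← h]
        nlinarith
      have g2 := g1.mono (by positivity) (by positivity) (key a ha) (key b hb)
      rwa [← h] at g2
    · have g0 := ih (σ n - 1) (by omega) (by omega) (by omega)
      rw [show σ n - 1 + 1 = σ n by omega] at g0
      have nn : ∀ a : ℕ → ℝ, (∀ n, n ≤ K → 0 < a n) →
        0 ≤ 2 * c * ∑ i ∈ (Finset.Icc τ (σ n - 1)).filter (fun i => σ i = i), a i := by
        intro a ha
        have : 0 ≤ ∑ i ∈ (Finset.Icc τ (σ n - 1)).filter (fun i => σ i = i), a i := by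
          apply Finset.sum_nonneg
          intro i hi; simp at hi; exact (ha i (by omega)).le
        positivity
      have key : ∀ a : ℕ → ℝ, (∀ n, n ≤ K → 0 < a n) →
          2 * c * (∑ i ∈ (Finset.Icc τ (σ n - 1)).filter (fun i => σ i = i), a i) + (c * a (σ n) + c * a (σ n)) ≤
          2 * c * ∑ i ∈ (Finset.Icc τ n).filter (fun i => σ i = i), a i := by
        intro a ha
        have : (∑ i ∈ (Finset.Icc τ (σ n - 1)).filter (fun i => σ i = i), a i) + a (σ n) ≤
            ∑ i ∈ (Finset.Icc τ n).filter (fun i => σ i = i), a i := by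
          rw [add_comm, ← Finset.sum_insert]
          · apply Finset.sum_le_sum_of_subset_of_nonneg
            · intro i hi
              simp only [Finset.mem_insert, Finset.mem_filter, Finset.mem_Icc] at hi ⊢
              rcases hi with rfl | hi
              · exact ⟨⟨h.le, hs2⟩, hs3⟩
              · exact ⟨⟨by omega, by omega⟩, hi.2⟩
            · intro i hi _; simp at hi; exact (ha i (by omega)).le
          · simp; omega
        nlinarith
      exact (g0.concat (nn a ha) (nn b hb) (by positivity) (by positivity) h.le (by omega) g1).mono
        (add_nonneg (nn a ha) (by positivity)) (add_nonneg (nn b hb) (by positivity)) (key a ha) (key b hb)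

lemma cross_sum (hσ : PathSig K σ) (ha : ∀ n, n ≤ K → 0 < a n) (N : ℕ → ℕ) (hN : Monotone N) (hNK : ∀ k, N k ≤ K)
    (S : Finset ℕ) (hS : ∀ k ∈ S, N k < N (k+1)) (hS2 : ∀ k ∈ S, σ (N (k+1)) ≠ σ (N k)) :
    ∑ k ∈ S, (∑ i ∈ (Finset.Icc (σ (N k)) (N (k+1) - 1)).filter (fun i => σ i = i), a i) ≤
      2 * ∑ i ∈ (Finset.range (K+1)).filter (fun i => σ i = i), a i := by
  have e : ∀ k ∈ S, (∑ i ∈ (Finset.Icc (σ (N k)) (N (k+1) - 1)).filter (fun i => σ i = i), a i) =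
      ∑ i ∈ (Finset.range (K+1)).filter (fun i => σ i = i), if σ (N k) ≤ i ∧ i < N (k+1) then a i else 0 := by
    intro k hk
    rw [← Finset.sum_filter]
    apply Finset.sum_congr _ fun _ _ => rfl
    ext i
    have := hS k hk
    have := hNK (k+1)
    simp only [Finset.mem_filter, Finset.mem_Icc, Finset.mem_range]
    constructor
    · rintro ⟨⟨h1, h2⟩, h3⟩; exact ⟨⟨by omega, h3⟩, h1, by omega⟩
    · rintro ⟨⟨h1, h2⟩, h3⟩; exact ⟨⟨by omega, by omega⟩, h2⟩
  rw [Finset.sum_congr rfl e, Finset.sum_comm, Finset.mul_sum]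
  apply Finset.sum_le_sum
  intro i hi
  simp only [Finset.mem_filter, Finset.mem_range] at hi
  rw [← Finset.sum_filter, Finset.sum_const, nsmul_eq_mul]
  have pa := ha i (by omega)
  have hcard : (S.filter (fun k => σ (N k) ≤ i ∧ i < N (k+1))).card ≤ 2 := by
    have sub : S.filter (fun k => σ (N k) ≤ i ∧ i < N (k+1)) ⊆
        S.filter (fun k => N k < i ∧ i < N (k+1)) ∪ S.filter (fun k => σ (N k) = i) := by
      intro k hk
      simp only [Finset.mem_filter, Finset.mem_union] at hk ⊢
      rcases lt_or_ge (N k) i with h | h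
      · exact Or.inl ⟨hk.1, h, hk.2.2⟩
      · right
        have := hσ.mono h (hNK k)
        exact ⟨hk.1, by omega⟩
    refine (Finset.card_le_card sub).trans ((Finset.card_union_le _ _).trans ?_)
    have c1 : (S.filter (fun k => N k < i ∧ i < N (k+1))).card ≤ 1 := by
      rw [Finset.card_le_one]
      intro k hk k' hk'
      simp only [Finset.mem_filter] at hk hk'
      rcases lt_trichotomy k k' with h | h | h
      · have := hN (show k+1 ≤ k' by omega); omega
      · exact h
      · have := hN (show k'+1 ≤ k by omega); omega
    have c2 : (S.filter (fun k => σ (N k) = i)).card ≤ 1 := by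
      rw [Finset.card_le_one]
      have aux : ∀ k ∈ S, σ (N k) = i → ∀ k', σ (N k') = i → ¬ k < k' := by
        intro k hk e k' e' hlt
        have h1 := hσ.mono (hN (show k ≤ k+1 by omega)) (hNK _)
        have h2 := hσ.mono (hN (show k+1 ≤ k' by omega)) (hNK _)
        exact hS2 k hk (by omega)
      intro k hk k' hk'
      simp only [Finset.mem_filter] at hk hk'
      have := aux k hk.1 hk.2 k' hk'.2
      have := aux k' hk'.1 hk'.2 k hk.2
      omega
    omega
  have : ((S.filter (fun k => σ (N k) ≤ i ∧ i < N (k+1))).card : ℝ) ≤ 2 := by exact_mod_cast hcard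
  nlinarith

lemma path_count (hσ : PathSig K σ) (hc : 0 < c) (hX0 : ∀ j, 0 < X j) (hY0 : ∀ j, 0 < Y j)
    (hA : ∀ n, n < K → ‖A (n+1) - A n‖ ≤ X n) (hB : ∀ n, n < K → ‖B (n+1) - B n‖ ≤ Y n)
    (ha : ∀ n, n ≤ K → 0 < a n) (hb : ∀ n, n ≤ K → 0 < b n)
    (hG : ∀ n, n ≤ K → GoodP A B X Y (σ n) n (c * a (σ n)) (c * b (σ n)))
    (hX : ∀ n, n ≤ K → X n ≤ c * a (σ n)) (hY : ∀ n, n ≤ K → Y n ≤ c * b (σ n))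
    {lam t : ℝ} (hl : 0 < lam) (ht : 1/2 ≤ t) (cnt : ℕ → ℕ → ℕ)
    (hcnt : ∀ m n τ, m ≤ n → n ≤ K → σ m = τ → σ n = τ → cnt τ m ≤ cnt τ n)
    (hcnt2 : ∀ m n τ, m < n → n ≤ K → σ m = τ → σ n = τ → cnt τ m = cnt τ n → Tq A B X Y m n ≤ lam)
    (hcnt3 : ∀ n τ, n ≤ K → σ n = τ → (cnt τ n : ℝ) < max 1 ((12 * c^2 * a τ * b τ / lam)^t))
    (N : ℕ → ℕ) (hN : Monotone N) (hNK : ∀ k, N k ≤ K)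
    (S : Finset ℕ) (hS : ∀ k ∈ S, N k < N (k+1) ∧ lam < Tq A B X Y (N k) (N (k+1))) :
    (S.card : ℝ) ≤ 2 * (16 * (12 * c^2) * (∑ i ∈ (Finset.range (K+1)).filter (fun i => σ i = i), a i) *
      (∑ i ∈ (Finset.range (K+1)).filter (fun i => σ i = i), b i) / lam)^t := by
  set SA := ∑ i ∈ (Finset.range (K+1)).filter (fun i => σ i = i), a i with hSA
  set SB := ∑ i ∈ (Finset.range (K+1)).filter (fun i => σ i = i), b i with hSB
  have nn : ∀ a : ℕ → ℝ, (∀ n, n ≤ K → 0 < a n) → ∀ T : Finset ℕ, (∀ i ∈ T, i ≤ K) → 0 ≤ ∑ i ∈ T, a i :=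
    fun a ha T hT => Finset.sum_nonneg fun i hi => (ha i (hT i hi)).le
  have SA0 : 0 ≤ SA := nn a ha _ (by intro i hi; simp at hi; omega)
  have SB0 : 0 ≤ SB := nn b hb _ (by intro i hi; simp at hi; omega)
  -- crossing
  have h1 : ((S.filter (fun k => σ (N (k+1)) ≠ σ (N k))).card : ℝ) ≤ (16 * (12 * c^2) * SA * SB / lam)^t := by
    set S1 := S.filter (fun k => σ (N (k+1)) ≠ σ (N k)) with hS1
    have m1 : ∀ k ∈ S1, N k < N (k+1) := fun k hk => (hS k (Finset.mem_filter.mp hk).1).1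
    have m2 : ∀ k ∈ S1, σ (N (k+1)) ≠ σ (N k) := fun k hk => (Finset.mem_filter.mp hk).2
    have sa := cross_sum hσ ha N hN hNK S1 m1 m2
    have sb := cross_sum hσ hb N hN hNK S1 m1 m2
    set P : ℕ → ℝ := fun k => ∑ i ∈ (Finset.Icc (σ (N k)) (N (k+1) - 1)).filter (fun i => σ i = i), a i with hP
    set Q : ℕ → ℝ := fun k => ∑ i ∈ (Finset.Icc (σ (N k)) (N (k+1) - 1)).filter (fun i => σ i = i), b i with hQ
    have inK : ∀ k ∈ S1, ∀ i ∈ (Finset.Icc (σ (N k)) (N (k+1) - 1)).filter (fun i => σ i = i), i ≤ K := by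
      intro k hk i hi
      simp at hi
      have := hNK (k+1); omega
    have P0 : ∀ k ∈ S1, 0 ≤ P k := fun k hk => nn a ha _ (inK k hk)
    have Q0 : ∀ k ∈ S1, 0 ≤ Q k := fun k hk => nn b hb _ (inK k hk)
    have each : ∀ k ∈ S1, (1:ℝ) ≤ (4 * (12 * c^2) / lam * P k * Q k)^t := by
      intro k hk
      have hT := (hS k (Finset.mem_filter.mp hk).1).2
      have hlt := m1 k hk
      have hle := hσ.le (hNK k)
      have g := chain hσ hc hX0 hY0 hA hB ha hb hG hX hY (σ (N k)) (hσ.idem (hNK k)) (N (k+1) - 1)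
        (by omega) (by have := hNK (k+1); omega)
      rw [show N (k+1) - 1 + 1 = N (k+1) by omega] at g
      have hT2 := g.T_le hX0 hY0 hle hlt le_rfl
      apply Real.one_le_rpow _ (by linarith)
      rw [mul_assoc, div_mul_eq_mul_div, le_div_iff₀ hl]
      have : 12 * ((2 * c * P k) * (2 * c * Q k)) = 4 * (12 * c^2) * (P k * Q k) := by ring
      simp only [hP, hQ] at this hT2 ⊢
      linarith
    calc (S1.card : ℝ) = ∑ k ∈ S1, (1:ℝ) := by simp
      _ ≤ ∑ k ∈ S1, (4 * (12 * c^2) / lam * P k * Q k)^t := Finset.sum_le_sum each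
      _ ≤ ((4 * (12 * c^2) / lam * (2 * SA)) * (2 * SB))^t := by
          apply pq_sum_le S1 (fun k => 4 * (12 * c^2) / lam * P k) Q _ Q0 _ _ t _ sb ht
          · intro k hk; have := P0 k hk; positivity
          · rw [← Finset.mul_sum]; gcongr
      _ = _ := by congr 1; ring
  have h2 : ((S.filter (fun k => ¬ σ (N (k+1)) ≠ σ (N k))).card : ℝ) ≤ (16 * (12 * c^2) * SA * SB / lam)^t := by
    set S2 := S.filter (fun k => ¬ σ (N (k+1)) ≠ σ (N k)) with hS2
    have m2 : ∀ k ∈ S2, σ (N (k+1)) = σ (N k) := fun k hk => not_not.mp (Finset.mem_filter.mp hk).2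
    have m1 : ∀ k ∈ S2, N k < N (k+1) := fun k hk => (hS k (Finset.mem_filter.mp hk).1).1
    set T := (Finset.range (K+1)).filter (fun i => σ i = i) with hT
    have hmap : ∀ k ∈ S2, σ (N k) ∈ T := by
      intro k hk
      have := hσ.le (hNK k)
      have := hNK k
      simp only [hT, Finset.mem_filter, Finset.mem_range]
      exact ⟨by omega, hσ.idem (hNK k)⟩
    have each : ∀ τ ∈ T, ((S2.filter (fun k => σ (N k) = τ)).card : ℝ) ≤ (12 * c^2 / lam * a τ * b τ)^t := by
      intro τ hτ
      simp only [hT, Finset.mem_filter, Finset.mem_range] at hτ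
      have pa := ha τ (by omega)
      have pb := hb τ (by omega)
      set G := S2.filter (fun k => σ (N k) = τ) with hG
      rcases G.eq_empty_or_nonempty with h | h
      · rw [h]; simp; positivity
      · have inc : ∀ k ∈ G, cnt τ (N k) < cnt τ (N (k+1)) := by
          intro k hk
          have hk2 := Finset.mem_filter.mp hk
          have e1 := hk2.2
          have e2 := (m2 k hk2.1).trans e1
          have := hcnt (N k) (N (k+1)) τ (m1 k hk2.1).le (hNK _) e1 e2
          refine lt_of_le_of_ne this fun he => ?_
          have := hcnt2 (N k) (N (k+1)) τ (m1 k hk2.1) (hNK _) e1 e2 he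
          have := (hS k (Finset.mem_filter.mp hk2.1).1).2
          linarith
        have mon : ∀ k ∈ G, ∀ k' ∈ G, k < k' → cnt τ (N (k+1)) ≤ cnt τ (N k') := by
          intro k hk k' hk' hlt
          have hk2 := Finset.mem_filter.mp hk
          exact hcnt _ _ τ (hN (show k+1 ≤ k' by omega)) (hNK _) ((m2 k hk2.1).trans hk2.2)
            (Finset.mem_filter.mp hk').2
        set kl := G.max' h with hkl
        have hklG : kl ∈ G := G.max'_mem h
        have hklG2 := Finset.mem_filter.mp hklG
        have card_le : G.card ≤ cnt τ (N (kl+1)) := by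
          have : G.card ≤ (Finset.range (cnt τ (N (kl+1)))).card := by
            apply Finset.card_le_card_of_injOn (fun k => cnt τ (N k))
            · intro k hk
              simp only [Finset.coe_range, Set.mem_Iio]
              rcases (G.le_max' k hk).eq_or_lt with h' | h'
              · rw [h']; exact inc kl hklG
              · exact (inc k hk).trans_le ((mon k hk kl hklG h').trans (inc kl hklG).le)
            · intro k hk k' hk' he
              simp only at he
              rcases lt_trichotomy k k' with h' | h' | h'
              · have := inc k hk; have := mon k hk k' hk' h'; omega
              · exact h'
              · have := inc k' hk'; have := mon k' hk' k hk h'; omega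
          simpa using this
        have l3 := hcnt3 (N (kl+1)) τ (hNK _) ((m2 kl hklG2.1).trans hklG2.2)
        have l4 : (1:ℝ) ≤ cnt τ (N (kl+1)) := by
          have := inc kl hklG
          exact_mod_cast (by omega : 1 ≤ cnt τ (N (kl+1)))
        have l5 : (cnt τ (N (kl+1)) : ℝ) < (12 * c^2 * a τ * b τ / lam)^t := by
          rcases lt_max_iff.mp l3 with h' | h'
          · linarith
          · exact h'
        have l6 : (G.card : ℝ) ≤ cnt τ (N (kl+1)) := by exact_mod_cast card_le
        have l7 : 12 * c^2 / lam * a τ * b τ = 12 * c^2 * a τ * b τ / lam := by ring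
        rw [l7]; linarith
    calc (S2.card : ℝ) = ∑ τ ∈ T, ((S2.filter (fun k => σ (N k) = τ)).card : ℝ) := by
          rw [Finset.card_eq_sum_card_fiberwise hmap]; push_cast; rfl
      _ ≤ ∑ τ ∈ T, (12 * c^2 / lam * a τ * b τ)^t := Finset.sum_le_sum each
      _ ≤ ((12 * c^2 / lam * SA) * SB)^t := by
          apply pq_sum_le T (fun k => 12 * c^2 / lam * a k) b _ _ _ _ t _ le_rfl ht
          · intro k hk; simp [hT] at hk; have := ha k (by omega); positivity
          · intro k hk; simp [hT] at hk; exact (hb k (by omega)).le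
          · rw [← Finset.mul_sum]
      _ ≤ _ := by
          apply Real.rpow_le_rpow (by positivity) _ (by linarith)
          have : 0 ≤ 12 * c^2 / lam * SA * SB := by positivity
          have e : 16 * (12 * c^2) * SA * SB / lam = 16 * (12 * c^2 / lam * SA * SB) := by ring
          rw [e]; linarith
  have h3 := Finset.card_filter_add_card_filter_not (s := S) (fun k => σ (N (k+1)) ≠ σ (N k))
  have h4 : ((S.filter (fun k => σ (N (k+1)) ≠ σ (N k))).card : ℝ) +
      ((S.filter (fun k => ¬ σ (N (k+1)) ≠ σ (N k))).card : ℝ) = S.card := by exact_mod_cast h3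
  linarith

end count


namespace TD
variable (D : TD)

open Classical in
def sig (K : ℕ) (lam : ℝ) : ℕ → ℤ → ℕ
  | 0, _ => 0
  | n+1, z => if D.bad K lam (sig K lam n (z/2)) (n+1) z then n+1 else sig K lam n (z/2)

lemma sig_le (K : ℕ) (lam : ℝ) (n : ℕ) (z : ℤ) : D.sig K lam n z ≤ n := by
  induction n generalizing z with
  | zero => simp [sig]
  | succ n ih =>
    rw [sig]
    split_ifs
    · rfl
    · exact (ih _).trans (by omega)

lemma half_path {K n : ℕ} (hn : n < K) (z : ℤ) : z / 2^(K-(n+1)) / 2 = z / 2^(K-n) := by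
  rw [← div_pow_succ, show K - (n+1) + 1 = K - n by omega]

lemma pathSig (K : ℕ) (lam : ℝ) (z : ℤ) : PathSig K (fun n => D.sig K lam n (z / 2^(K-n))) where
  zero := rfl
  step := by
    intro n hn
    simp only [sig, half_path hn]
    split_ifs
    · exact Or.inl rfl
    · exact Or.inr rfl

open Classical in
lemma sparse {K m : ℕ} {lam : ℝ} (hm : m ≤ K) (ζ : ℤ) (hs : D.sig K lam m ζ = m) :
    E1^[K-m] (fun w => if ∃ n, m < n ∧ n ≤ K ∧ D.sig K lam n (w / 2^(K-n)) = n then (1:ℝ) else 0) ζ ≤ 1/2 := by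
  refine le_trans (E_mono_desc _ _ _ ζ ?_) (D.frac (lam := lam) hm ζ)
  intro w hw
  have key : (∃ n, m < n ∧ n ≤ K ∧ D.sig K lam n (w / 2^(K-n)) = n) →
      ∃ n, m < n ∧ n ≤ K ∧ D.bad K lam m n (w / 2^(K-n)) := by
    rintro ⟨n, hn1, hn2, hn3⟩
    by_contra hno
    push Not at hno
    have : ∀ n, m ≤ n → n ≤ K → D.sig K lam n (w / 2^(K-n)) = m := by
      intro n hmn
      induction n, hmn using Nat.le_induction with
      | base => intro _; rw [hw, hs]
      | succ n hmn ih =>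
        intro hn
        have h := ih (by omega)
        rw [sig, half_path (by omega), h, if_neg (hno (n+1) (by omega) hn)]
    have := this n hn1.le hn2
    omega
  split_ifs with h1 h2 h2
  · exact le_rfl
  · exact absurd (key h1) h2
  · exact zero_le_one
  · exact le_rfl

lemma sig_notbad (K : ℕ) (lam : ℝ) (n : ℕ) (z : ℤ) :
    D.sig K lam n z = n ∨ ¬ D.bad K lam (D.sig K lam n z) n z := by
  cases n with
  | zero => left; rfl
  | succ n =>
    rw [sig]
    split_ifs with h
    · left; rfl
    · right; exact h

/-- path states satisfy the recursion -/
lemma St_path {K : ℕ} (k1 k2 : ℝ) (m : ℕ) (z : ℤ) (d : ℕ) (hd : d < K - m) :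
    D.St k1 k2 m (d+1) (z / 2^(K-(m+(d+1)))) = stp D.r D.s (D.St k1 k2 m d (z / 2^(K-(m+d))))
      ((D.A (m+d+1) (z / 2^(K-(m+d+1))) - D.A (m+d) (z / 2^(K-(m+d)))) / k1)
      ((D.B (m+d+1) (z / 2^(K-(m+d+1))) - D.B (m+d) (z / 2^(K-(m+d)))) / k2)
      (D.X (m+d) (z / 2^(K-(m+d))) / k1) (D.Y (m+d) (z / 2^(K-(m+d))) / k2) := by
  rw [St, ← add_assoc, half_path (by omega)]

lemma tree_main {K : ℕ} {lam : ℝ} (hl : 0 < lam) (z : ℤ) (N : ℕ → ℕ) (hN : Monotone N) (hNK : ∀ k, N k ≤ K)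
    (S : Finset ℕ) (hS : ∀ k ∈ S, N k < N (k+1) ∧ lam < Tq (fun i => D.A i (z / 2^(K-i))) (fun i => D.B i (z / 2^(K-i)))
      (fun i => D.X i (z / 2^(K-i))) (fun i => D.Y i (z / 2^(K-i))) (N k) (N (k+1))) :
    (S.card : ℝ) ≤ 2 * (16 * C0 *
      (∑ i ∈ (Finset.range (K+1)).filter (fun i => D.sig K lam i (z / 2^(K-i)) = i), D.aa K i (z / 2^(K-i))) *
      (∑ i ∈ (Finset.range (K+1)).filter (fun i => D.sig K lam i (z / 2^(K-i)) = i), D.bb K i (z / 2^(K-i))) / lam)^D.t := by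
  have hσ := D.pathSig K lam z
  set σ : ℕ → ℕ := fun n => D.sig K lam n (z / 2^(K-n)) with hσdef
  have eroot : ∀ n, n ≤ K → z / 2^(K-n) / 2^(n - σ n) = z / 2^(K - σ n) := by
    intro n hn
    have := hσ.le hn
    rw [← div_pow_add, show K - n + (n - σ n) = K - σ n by omega]
  -- not bad facts
  have nb : ∀ n, n ≤ K → σ n ≠ n → ¬ D.bad K lam (σ n) n (z / 2^(K-n)) := by
    intro n hn h
    rcases D.sig_notbad K lam n (z / 2^(K-n)) with h' | h'
    · exact absurd h' h
    · exact h'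
  have hXb : ∀ n, n ≤ K → D.X n (z / 2^(K-n)) ≤ 112 * 8 * D.aa K (σ n) (z / 2^(K-σ n)) := by
    intro n hn
    have pa := D.aa_pos (hσ.le hn |>.trans hn) (z / 2^(K-σ n))
    by_cases h : σ n = n
    · have := D.X_le_aa hn (z / 2^(K-n))
      rw [h] at pa ⊢
      linarith
    · have := nb n hn h
      unfold bad at this
      push Not at this
      have h1 := this.1
      rw [eroot n hn] at h1
      have h2 := (D.X_le_sX (hσ.le hn) le_rfl (z / 2^(K-n))).trans h1
      simp only [Nat.sub_self, pow_zero, Int.ediv_one] at h2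
      have h3 := (Real.rpow_le_rpow_iff (D.hX _ _).le (by positivity) (by linarith [D.hr1])).mp h2
      linarith
  have hYb : ∀ n, n ≤ K → D.Y n (z / 2^(K-n)) ≤ 112 * 8 * D.bb K (σ n) (z / 2^(K-σ n)) := by
    intro n hn
    have pa := D.bb_pos (hσ.le hn |>.trans hn) (z / 2^(K-σ n))
    by_cases h : σ n = n
    · have := D.Y_le_bb hn (z / 2^(K-n))
      rw [h] at pa ⊢
      linarith
    · have := nb n hn h
      unfold bad at this
      push Not at this
      have h1 := this.2.1
      rw [eroot n hn] at h1
      have h2 := (D.flip.X_le_sX (hσ.le hn) le_rfl (z / 2^(K-n))).trans h1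
      simp only [Nat.sub_self, pow_zero, Int.ediv_one] at h2
      have h3 := (Real.rpow_le_rpow_iff (D.flip.hX _ _).le (by positivity) (by have := D.flip.hr1; linarith)).mp h2
      have h4 : D.Y n (z / 2^(K-n)) ≤ 8 * D.bb K (σ n) (z / 2^(K-σ n)) := h3
      linarith
  have cellc := fun (τ d : ℕ) (hτ : τ ≤ K) (hd : d ≤ K - τ) => cell (A := fun i => D.A i (z / 2^(K-i))) (B := fun i => D.B i (z / 2^(K-i)))
    (X := fun i => D.X i (z / 2^(K-i))) (Y := fun i => D.Y i (z / 2^(K-i)))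
    (D.cA_pos hτ (z / 2^(K-τ))) (D.cB_pos hτ (z / 2^(K-τ))) τ (K-τ)
    (fun d => D.St (D.cA K τ (z / 2^(K-τ))) (D.cB K τ (z / 2^(K-τ))) τ d (z / 2^(K-(τ+d)))) rfl
    (fun d hd => D.St_path _ _ τ z d hd) d hd
  have cellf := fun (τ d : ℕ) (hτ : τ ≤ K) (hd : d ≤ K - τ) => cell (A := fun i => D.A i (z / 2^(K-i))) (B := fun i => D.B i (z / 2^(K-i)))
    (X := fun i => D.X i (z / 2^(K-i))) (Y := fun i => D.Y i (z / 2^(K-i)))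
    (D.fA_pos lam hτ (z / 2^(K-τ))) (D.fB_pos lam hτ (z / 2^(K-τ))) τ (K-τ)
    (fun d => D.St (D.fA K lam τ (z / 2^(K-τ))) (D.fB K lam τ (z / 2^(K-τ))) τ d (z / 2^(K-(τ+d)))) rfl
    (fun d hd => D.St_path _ _ τ z d hd) d hd
  apply path_count (A := fun i => D.A i (z / 2^(K-i))) (B := fun i => D.B i (z / 2^(K-i)))
    (X := fun i => D.X i (z / 2^(K-i))) (Y := fun i => D.Y i (z / 2^(K-i))) (c := 112 * 8)
    (a := fun i => D.aa K i (z / 2^(K-i))) (b := fun i => D.bb K i (z / 2^(K-i))) hσ (by norm_num)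
    (fun j => D.hX _ _) (fun j => D.hY _ _)
    (fun n hn => by have := D.hA n (z / 2^(K-(n+1))); rwa [half_path hn] at this)
    (fun n hn => by have := D.hB n (z / 2^(K-(n+1))); rwa [half_path hn] at this)
    (fun n hn => D.aa_pos hn _) (fun n hn => D.bb_pos hn _) _ hXb hYb hl D.t_ge
    (fun τ n => (D.St (D.fA K lam τ (z / 2^(K-τ))) (D.fB K lam τ (z / 2^(K-τ))) τ (n-τ) (z / 2^(K-n))).c)
    _ _ _ N hN hNK S hS
  · intro n hn
    have hle := hσ.le hn
    obtain ⟨e, he1, he2, hG, -, -, -, -, -, hc2⟩ := cellc (σ n) (n - σ n) (by omega) (by omega)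
    have hc0 : (D.St (D.cA K (σ n) (z / 2^(K-σ n))) (D.cB K (σ n) (z / 2^(K-σ n))) (σ n) (n - σ n) (z / 2^(K-(σ n+(n-σ n))))).c = 0 := by
      rw [show σ n + (n - σ n) = n by omega]
      by_cases h : σ n = n
      · rw [show n - σ n = 0 by omega]; rfl
      · have := nb n hn h
        unfold bad at this
        push Not at this
        have h1 := this.2.2.1
        rw [eroot n hn] at h1
        omega
    have := hc2 0 (by omega) (by simp only [hc0]; rfl)
    rw [show σ n + (n - σ n) = n by omega] at hG
    obtain rfl : e = σ n := by omega
    exact hG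
  · intro m n τ hmn hn hm' hn'
    have h1 := hσ.le hn
    have h2 := hσ.le (hmn.trans hn)
    obtain ⟨e, he1, he2, hG, -, -, -, -, hc1, hc2⟩ := cellf τ (n - τ) (by omega) (by omega)
    have := hc1 (m - τ) (by omega)
    simp only [show τ + (n - τ) = n by omega, show τ + (m - τ) = m by omega] at this
    exact this
  · intro m n τ hmn hn hm' hn' hcc
    have h1 := hσ.le hn
    have h2 := hσ.le (hmn.le.trans hn)
    obtain ⟨e, he1, he2, hG, -, -, -, -, hc1, hc2⟩ := cellf τ (n - τ) (by omega) (by omega)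
    have := hc2 (m - τ) (by omega) (by
      simp only [show τ + (n - τ) = n by omega, show τ + (m - τ) = m by omega]
      exact hcc)
    simp only [show τ + (n - τ) = n by omega, show τ + (m - τ) = m by omega] at this hG
    exact (hG.T_le (fun j => D.hX _ _) (fun j => D.hY _ _) this hmn le_rfl).trans (D.f_prod hl (by omega) _)
  · intro n τ hn hτ
    subst hτ
    have hle := hσ.le hn
    by_cases h : σ n = n
    · refine lt_max_of_lt_left ?_
      rw [show n - σ n = 0 by omega]
      simp [St, State.start]
    · have := nb n hn h
      unfold bad at this
      push Not at this
      have h1 := this.2.2.2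
      rw [eroot n hn] at h1
      exact h1

end TD


/-! ## Dyadic intervals on the line and the sparse bound -/

/-- index of the dyadic interval of length `2^(-m)` containing `x` -/
def pn (m : ℤ) (x : ℝ) : ℤ := ⌊x * (2:ℝ)^m⌋

lemma measurable_pn (m : ℤ) : Measurable (pn m) := by
  unfold pn; exact Int.measurable_floor.comp (by fun_prop)

lemma pn_half (m : ℤ) (x : ℝ) : pn (m+1) x / 2 = pn m x := by
  unfold pn
  have h := Int.floor_div_natCast (x * (2:ℝ)^(m+1)) 2
  rw [zpow_add_one₀ (by norm_num)] at h
  rw [zpow_add_one₀ (by norm_num)]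
  push_cast at h
  rw [← h]
  congr 1
  ring

lemma pn_div (m : ℤ) (k : ℕ) (x : ℝ) : pn (m+k) x / 2^k = pn m x := by
  induction k with
  | zero => simp
  | succ k ih =>
    rw [div_pow_succ', show m + ((k+1 : ℕ):ℤ) = m + k + 1 by push_cast; ring, pn_half, ih]

def In (m ζ : ℤ) : Set ℝ := pn m ⁻¹' {ζ}

lemma mem_In {m ζ : ℤ} {x : ℝ} : x ∈ In m ζ ↔ pn m x = ζ := Iff.rfl

lemma measurableSet_In (m ζ : ℤ) : MeasurableSet (In m ζ) := measurable_pn m (measurableSet_singleton ζ)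

lemma In_eq (m ζ : ℤ) : In m ζ = Set.Ico (ζ * (2:ℝ)^(-m)) ((ζ+1) * (2:ℝ)^(-m)) := by
  ext x
  have h : (0:ℝ) < (2:ℝ)^m := by positivity
  rw [mem_In, pn, Int.floor_eq_iff, Set.mem_Ico, zpow_neg, ← div_eq_mul_inv, ← div_eq_mul_inv,
    div_le_iff₀ h, lt_div_iff₀ h]

lemma volume_In (m ζ : ℤ) : volume (In m ζ) = ENNReal.ofReal ((2:ℝ)^(-m)) := by
  rw [In_eq, Real.volume_Ico]
  congr 1; ring

lemma In_split (m ζ : ℤ) : In m ζ = In (m+1) (2*ζ) ∪ In (m+1) (2*ζ+1) := by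
  ext x
  simp only [Set.mem_union, mem_In, ← pn_half m x]
  omega

lemma lintegral_In_split (m ζ : ℤ) (h : ℝ → ℝ≥0∞) :
    ∫⁻ x in In m ζ, h x = (∫⁻ x in In (m+1) (2*ζ), h x) + ∫⁻ x in In (m+1) (2*ζ+1), h x := by
  rw [In_split]
  refine lintegral_union (measurableSet_In _ _) ?_
  rw [Set.disjoint_left]
  intro x hx hx'
  rw [mem_In] at hx hx'
  omega

lemma lintegral_In (m : ℤ) (h : ℝ → ℝ≥0∞) : ∫⁻ x, h x = ∑' ζ, ∫⁻ x in In m ζ, h x := by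
  rw [← lintegral_iUnion (measurableSet_In m)]
  · have : ⋃ i, In m i = Set.univ := by
      ext x; simp [mem_In]
    rw [this, Measure.restrict_univ]
  · intro a b hab
    simp only [Function.onFun, Set.disjoint_left]
    intro x hx hx'
    rw [mem_In] at hx hx'
    exact hab (hx.symm.trans hx')

lemma E_nonneg (k : ℕ) {h : ℤ → ℝ} (hh : ∀ z, 0 ≤ h z) (ζ : ℤ) : 0 ≤ E1^[k] h ζ := by
  have := E_mono_desc k (fun _ => 0) h ζ (fun w _ => hh w)
  rwa [E_const] at this

lemma lintegral_In_E (m : ℤ) (k : ℕ) {h : ℤ → ℝ} (hh : ∀ z, 0 ≤ h z) (ζ : ℤ) :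
    ∫⁻ x in In m ζ, ENNReal.ofReal (h (pn (m+k) x)) = ENNReal.ofReal ((2:ℝ)^(-m) * E1^[k] h ζ) := by
  induction k generalizing m ζ with
  | zero =>
    have : ∫⁻ x in In m ζ, ENNReal.ofReal (h (pn (m+(0:ℕ)) x)) = ∫⁻ x in In m ζ, ENNReal.ofReal (h ζ) := by
      apply setLIntegral_congr_fun (measurableSet_In _ _)
      intro x hx
      rw [mem_In] at hx
      simp [hx]
    rw [this, setLIntegral_const, volume_In, mul_comm, ← ENNReal.ofReal_mul (by positivity)]
    rfl
  | succ k ih =>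
    have e : m + ((k+1:ℕ):ℤ) = m + 1 + k := by push_cast; ring
    rw [lintegral_In_split, e, ih, ih, ← ENNReal.ofReal_add]
    · rw [Function.iterate_succ_apply', E1]
      congr 1
      rw [neg_add, zpow_add₀ (by norm_num)]
      norm_num
      ring
    · have := E_nonneg k hh (2*ζ); positivity
    · have := E_nonneg k hh (2*ζ+1); positivity

lemma In_le_Mx (m ζ : ℤ) (h : ℝ → ℝ≥0∞) {x : ℝ} (hx : x ∈ In m ζ) :
    ∫⁻ y in In m ζ, h y ≤ ENNReal.ofReal (4 * (2:ℝ)^(-m)) * Av m h x := by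
  unfold Av
  rw [← lintegral_const_mul' _ _ ENNReal.ofReal_ne_top]
  refine le_trans ?_ (setLIntegral_le_lintegral (In m ζ) _)
  apply setLIntegral_mono' (measurableSet_In _ _)
  intro y hy
  rw [← mul_assoc]
  refine le_mul_of_one_le_left' ?_
  unfold wk
  rw [← ENNReal.ofReal_mul (by positivity), ← ENNReal.ofReal_one]
  apply ENNReal.ofReal_le_ofReal
  rw [In_eq, Set.mem_Ico] at hx hy
  have hp : (0:ℝ) < (2:ℝ)^m := by positivity
  have hxy : |x - y| ≤ (2:ℝ)^(-m) := by
    rw [abs_le]; constructor <;> linarith [hx.1, hx.2, hy.1, hy.2]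
  have h1 : (2:ℝ)^m * |x-y| ≤ 1 := by
    calc (2:ℝ)^m * |x-y| ≤ (2:ℝ)^m * (2:ℝ)^(-m) := by gcongr
      _ = 1 := by rw [zpow_neg, mul_inv_cancel₀ hp.ne']
  have h2 : (0:ℝ) ≤ (2:ℝ)^m * |x-y| := by positivity
  have e : 4 * (2:ℝ)^(-m) * ((2:ℝ)^m / (1 + (2:ℝ)^m * |x-y|)^2) = 4 / (1 + (2:ℝ)^m * |x-y|)^2 := by
    rw [zpow_neg]; field_simp
  rw [e, le_div_iff₀ (by positivity)]
  nlinarith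

section sparse
open Classical

variable (K : ℕ) (n0 : ℤ) (st : ℕ → ℤ → Prop) (al : ℤ → ℝ)

def SS (z : ℤ) : ℝ := ∑ i ∈ (Finset.range (K+1)).filter (fun i => st i (z / 2^(K-i))), E1^[K-i] al (z / 2^(K-i))

def later (m : ℕ) (w : ℤ) : Prop := ∃ n, m < n ∧ n ≤ K ∧ st n (w / 2^(K-n))

variable {K st al}

lemma sparse_one (hal : ∀ z, 0 ≤ al z)
    (hsp : ∀ m ζ, m ≤ K → st m ζ → E1^[K-m] (fun w => if later K st m w then (1:ℝ) else 0) ζ ≤ 1/2)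
    (G : ℝ → ℝ≥0∞) (m : ℕ) (hm : m ≤ K) (ζ : ℤ) (hst : st m ζ) :
    ENNReal.ofReal (E1^[K-m] al ζ) * ∫⁻ x in In (n0+m) ζ, G x ≤
      32 * ∫⁻ x in In (n0+m) ζ, (if later K st m (pn (n0+K) x) then 0 else
        Mx (fun y => ENNReal.ofReal (al (pn (n0+K) y))) x * Mx G x) := by
  set L : ℝ := (2:ℝ)^(-(n0+m)) with hL
  have pL : 0 < L := by positivity
  set a := E1^[K-m] al ζ with ha
  have a0 : 0 ≤ a := E_nonneg _ hal ζ
  have eK : n0 + (K:ℤ) = n0 + m + ((K-m : ℕ):ℤ) := by push_cast [hm]; ring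
  set J := ∫⁻ x in In (n0+m) ζ, G x with hJ
  have h1 : ∀ x ∈ In (n0+m) ζ, ENNReal.ofReal a * J ≤ ENNReal.ofReal (16 * L) *
      (Mx (fun y => ENNReal.ofReal (al (pn (n0+K) y))) x * Mx G x) := by
    intro x hx
    have i1 : J ≤ ENNReal.ofReal (4 * L) * Mx G x :=
      (In_le_Mx _ _ G hx).trans (by gcongr; exact Av_le_Mx _ _ _)
    have i2 : ENNReal.ofReal (L * a) ≤ ENNReal.ofReal (4 * L) * Mx (fun y => ENNReal.ofReal (al (pn (n0+K) y))) x := by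
      have := In_le_Mx (n0+m) ζ (fun y => ENNReal.ofReal (al (pn (n0+K) y))) hx
      rw [eK, lintegral_In_E (n0+m) (K-m) hal ζ] at this
      rw [eK]
      exact this.trans (by gcongr; exact Av_le_Mx _ _ _)
    have i3 : ENNReal.ofReal a ≤ 4 * Mx (fun y => ENNReal.ofReal (al (pn (n0+K) y))) x := by
      rw [ENNReal.ofReal_mul pL.le, mul_comm 4 L, ENNReal.ofReal_mul pL.le, mul_assoc,
        ENNReal.mul_le_mul_iff_right (by simpa using pL) ENNReal.ofReal_ne_top] at i2
      simpa using i2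
    calc _ ≤ (4 * Mx (fun y => ENNReal.ofReal (al (pn (n0+K) y))) x) * (ENNReal.ofReal (4 * L) * Mx G x) := by
          gcongr
      _ = _ := by
          rw [show 16 * L = 4 * (4 * L) by ring, ENNReal.ofReal_mul (p := 4) (q := 4 * L) (by norm_num)]
          simp only [ENNReal.ofReal_ofNat]
          generalize ENNReal.ofReal (4 * L) = u
          ring
  set co : ℤ → ℝ := fun w => if later K st m w then (0:ℝ) else 1 with hco
  have hcoE : 1/2 ≤ E1^[K-m] co ζ := by
    have := E_add (K-m) (fun w => if later K st m w then (1:ℝ) else 0) co ζ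
    have e : (fun w => (if later K st m w then (1:ℝ) else 0) + co w) = fun _ => 1 := by
      funext w; simp only [hco]; split_ifs <;> norm_num
    rw [e, E_const] at this
    linarith [hsp m ζ hm hst]
  have hco0 : ∀ z, 0 ≤ co z := by intro z; simp only [hco]; split_ifs <;> norm_num
  have hIntg := lintegral_In_E (n0+m) (K-m) hco0 ζ
  rw [← eK] at hIntg
  have hge : ENNReal.ofReal (L / 2) ≤ ∫⁻ x in In (n0+m) ζ, ENNReal.ofReal (co (pn (n0+K) x)) := by
    rw [hIntg]
    apply ENNReal.ofReal_le_ofReal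
    nlinarith
  have hm1 : Measurable (fun x => ENNReal.ofReal (co (pn (n0+K) x))) :=
    ENNReal.measurable_ofReal.comp ((measurable_from_top (f := co)).comp (measurable_pn _))
  have h2 : ENNReal.ofReal (L/2) * (ENNReal.ofReal a * J) ≤ ENNReal.ofReal (16 * L) *
      ∫⁻ x in In (n0+m) ζ, (if later K st m (pn (n0+K) x) then 0 else
        Mx (fun y => ENNReal.ofReal (al (pn (n0+K) y))) x * Mx G x) := by
    calc _ ≤ (∫⁻ x in In (n0+m) ζ, ENNReal.ofReal (co (pn (n0+K) x))) * (ENNReal.ofReal a * J) := by gcongr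
      _ = ∫⁻ x in In (n0+m) ζ, ENNReal.ofReal (co (pn (n0+K) x)) * (ENNReal.ofReal a * J) := by
          rw [lintegral_mul_const _ hm1]
      _ ≤ ∫⁻ x in In (n0+m) ζ, ENNReal.ofReal (16 * L) * (if later K st m (pn (n0+K) x) then 0 else
            Mx (fun y => ENNReal.ofReal (al (pn (n0+K) y))) x * Mx G x) := by
          apply setLIntegral_mono' (measurableSet_In _ _)
          intro x hx
          simp only [hco]
          split_ifs
          · simp
          · simpa using h1 x hx
      _ = _ := lintegral_const_mul' _ _ ENNReal.ofReal_ne_top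
  rw [show 16 * L = (L/2) * 32 by ring, ENNReal.ofReal_mul (by positivity), mul_assoc,
    ENNReal.mul_le_mul_iff_right (by simpa using pL) ENNReal.ofReal_ne_top] at h2
  simpa using h2

lemma sparse_dual (hal : ∀ z, 0 ≤ al z)
    (hsp : ∀ m ζ, m ≤ K → st m ζ → E1^[K-m] (fun w => if later K st m w then (1:ℝ) else 0) ζ ≤ 1/2)
    (G : ℝ → ℝ≥0∞) (hG : Measurable G) :
    ∫⁻ x, ENNReal.ofReal (SS K st al (pn (n0+K) x)) * G x ≤
      32 * ∫⁻ x, Mx (fun y => ENNReal.ofReal (al (pn (n0+K) y))) x * Mx G x := by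
  set MM : ℝ → ℝ≥0∞ := fun x => Mx (fun y => ENNReal.ofReal (al (pn (n0+K) y))) x * Mx G x with hMM
  have mal : Measurable (fun y => ENNReal.ofReal (al (pn (n0+K) y))) :=
    ENNReal.measurable_ofReal.comp ((measurable_from_top (f := al)).comp (measurable_pn _))
  have mMM : Measurable MM := (measurable_Mx mal).mul (measurable_Mx hG)
  have ediv : ∀ i, i ≤ K → ∀ x, pn (n0+K) x / 2^(K-i) = pn (n0+i) x := by
    intro i hi x
    rw [show n0 + (K:ℤ) = n0 + i + ((K-i : ℕ):ℤ) by push_cast [hi]; ring, pn_div]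
  set T : ℕ → ℝ → ℝ≥0∞ := fun i x => (if st i (pn (n0+i) x) then ENNReal.ofReal (E1^[K-i] al (pn (n0+i) x)) else 0) * G x with hT
  set U : ℕ → ℝ → ℝ≥0∞ := fun i x => if st i (pn (n0+i) x) ∧ ¬ later K st i (pn (n0+K) x) then MM x else 0 with hU
  have mT : ∀ i, Measurable (T i) := by
    intro i
    refine Measurable.mul ?_ hG
    exact (measurable_from_top (f := fun z : ℤ => if st i z then ENNReal.ofReal (E1^[K-i] al z) else 0)).comp (measurable_pn _)
  have mU : ∀ i, Measurable (U i) := by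
    intro i
    refine Measurable.ite ?_ mMM measurable_const
    exact MeasurableSet.inter ((measurable_pn _) (MeasurableSet.of_discrete (s := {z | st i z})))
      ((measurable_pn (n0+K)) (MeasurableSet.of_discrete (s := {z | ¬ later K st i z})))
  have e1 : ∀ x, ENNReal.ofReal (SS K st al (pn (n0+K) x)) * G x = ∑ i ∈ Finset.range (K+1), T i x := by
    intro x
    unfold SS
    rw [Finset.sum_filter, ENNReal.ofReal_sum_of_nonneg, Finset.sum_mul]
    · apply Finset.sum_congr rfl
      intro i hi
      simp only [hT, ediv i (by simp at hi; omega)]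
      split_ifs <;> simp
    · intro i _
      split_ifs
      · exact E_nonneg _ hal _
      · rfl
  have each : ∀ i ∈ Finset.range (K+1), ∫⁻ x, T i x ≤ 32 * ∫⁻ x, U i x := by
    intro i hi
    have hi' : i ≤ K := by simp at hi; omega
    rw [lintegral_In (n0+i) (T i), lintegral_In (n0+i) (U i), ← ENNReal.tsum_mul_left]
    apply ENNReal.tsum_le_tsum
    intro ζ
    have t1 : ∫⁻ x in In (n0+i) ζ, T i x = ∫⁻ x in In (n0+i) ζ, (if st i ζ then ENNReal.ofReal (E1^[K-i] al ζ) else 0) * G x := by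
      apply setLIntegral_congr_fun (measurableSet_In _ _)
      intro x hx
      rw [mem_In] at hx
      simp only [hT, hx]
    have t2 : ∫⁻ x in In (n0+i) ζ, U i x = ∫⁻ x in In (n0+i) ζ, (if st i ζ ∧ ¬ later K st i (pn (n0+K) x) then MM x else 0) := by
      apply setLIntegral_congr_fun (measurableSet_In _ _)
      intro x hx
      rw [mem_In] at hx
      simp only [hU, hx]
    rw [t1, t2, lintegral_const_mul _ hG]
    by_cases hs : st i ζ
    · rw [if_pos hs]
      refine (sparse_one n0 hal hsp G i hi' ζ hs).trans_eq ?_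
      congr 2
      funext x
      simp [hs, hMM, ite_not]
    · simp [hs]
  calc _ = ∫⁻ x, ∑ i ∈ Finset.range (K+1), T i x := lintegral_congr e1
    _ = ∑ i ∈ Finset.range (K+1), ∫⁻ x, T i x := lintegral_finsetSum _ fun i _ => mT i
    _ ≤ ∑ i ∈ Finset.range (K+1), 32 * ∫⁻ x, U i x := Finset.sum_le_sum each
    _ = 32 * ∫⁻ x, ∑ i ∈ Finset.range (K+1), U i x := by
        rw [lintegral_finsetSum _ fun i _ => mU i, Finset.mul_sum]
    _ ≤ 32 * ∫⁻ x, MM x := by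
        gcongr with x
        simp only [hU]
        rw [← Finset.sum_filter, Finset.sum_const]
        have : ((Finset.range (K+1)).filter (fun i => st i (pn (n0+i) x) ∧ ¬ later K st i (pn (n0+K) x))).card ≤ 1 := by
          rw [Finset.card_le_one]
          have aux : ∀ i j, j ≤ K → i < j → ¬ later K st i (pn (n0+K) x) → st j (pn (n0+j) x) → False := by
            intro i j hj hij h1 h2
            exact h1 ⟨j, hij, hj, by rwa [ediv j hj]⟩
          intro i hi j hj
          simp only [Finset.mem_filter, Finset.mem_range] at hi hj
          rcases lt_trichotomy i j with h | h | h
          · exact (aux i j (by omega) h hi.2.2 hj.2.1).elim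
          · exact h
          · exact (aux j i (by omega) h hj.2.2 hi.2.1).elim
        calc _ ≤ 1 • MM x := by gcongr
          _ = MM x := one_smul _ _

end sparse

open Classical in
lemma sparse_Lp (P : ℝ) (hP : 1 < P) : ∃ C : ℝ≥0, ∀ (K : ℕ) (n0 : ℤ) (st : ℕ → ℤ → Prop) (al : ℤ → ℝ), (∀ z, 0 ≤ al z) →
    (∀ m ζ, m ≤ K → st m ζ → E1^[K-m] (fun w => if later K st m w then (1:ℝ) else 0) ζ ≤ 1/2) →
    (∫⁻ x, ENNReal.ofReal (SS K st al (pn (n0+K) x)) ^ P)^(1/P) ≤ C * (∫⁻ x, ENNReal.ofReal (al (pn (n0+K) x)) ^ P)^(1/P) := by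
  have hpq := Real.HolderConjugate.conjExponent hP
  set P' := P.conjExponent
  obtain ⟨C1, hC1⟩ := Mx_strong P hP
  obtain ⟨C2, hC2⟩ := Mx_strong P' hpq.symm.lt
  have p0 : 0 < P := by linarith
  have p0' : 0 < P' := hpq.symm.pos
  refine ⟨32 * C1^(1/P) * C2^(1/P'), ?_⟩
  intro K n0 st al hal hsp
  have mal : Measurable (fun y => ENNReal.ofReal (al (pn (n0+K) y))) :=
    ENNReal.measurable_ofReal.comp ((measurable_from_top (f := al)).comp (measurable_pn _))
  apply duality (ENNReal.measurable_ofReal.comp ((measurable_from_top (f := SS K st al)).comp (measurable_pn _))) hpq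
  intro G hG
  refine (sparse_dual n0 hal hsp G hG).trans ?_
  have h := ENNReal.lintegral_mul_le_Lp_mul_Lq volume hpq (measurable_Mx mal).aemeasurable (measurable_Mx hG).aemeasurable
  simp only [Pi.mul_apply] at h
  have h1 : (∫⁻ x, Mx (fun y => ENNReal.ofReal (al (pn (n0+K) y))) x ^ P)^(1/P) ≤
      (C1^(1/P) : ℝ≥0) * (∫⁻ x, ENNReal.ofReal (al (pn (n0+K) x)) ^ P)^(1/P) := by
    rw [ENNReal.coe_rpow_of_nonneg _ (by positivity), ← ENNReal.mul_rpow_of_nonneg _ _ (by positivity)]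
    exact ENNReal.rpow_le_rpow (hC1 _ mal) (by positivity)
  have h2 : (∫⁻ x, Mx G x ^ P')^(1/P') ≤
      (C2^(1/P') : ℝ≥0) * (∫⁻ x, G x ^ P')^(1/P') := by
    rw [ENNReal.coe_rpow_of_nonneg _ (by positivity), ← ENNReal.mul_rpow_of_nonneg _ _ (by positivity)]
    exact ENNReal.rpow_le_rpow (hC2 _ hG) (by positivity)
  calc _ ≤ 32 * (((C1^(1/P) : ℝ≥0) * (∫⁻ x, ENNReal.ofReal (al (pn (n0+K) x)) ^ P)^(1/P)) *
      ((C2^(1/P') : ℝ≥0) * (∫⁻ x, G x ^ P')^(1/P'))) := by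
        gcongr
        exact h.trans (mul_le_mul' h1 h2)
    _ = _ := by push_cast; ring


/-! ## Comparison of the paraproduct sums with the tree quantities -/

lemma Mq_compare (P Q A B : ℕ → ℂ) (m n : ℕ) (h : m ≤ n) :
    Mq P Q m n = Mq A B m n + (∑ j ∈ Finset.Ico m n, (P j - A j) * (B (j+1) - B j))
      - (P m - A m) * (B n - B m) + (P n - P m) * (Q n - B n)
      - ∑ j ∈ Finset.Ico m n, (P (j+1) - P j) * (Q (j+1) - B (j+1)) := by
  induction n, h using Nat.le_induction with
  | base => simp [Mq]
  | succ n h ih =>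
    unfold Mq at ih ⊢
    rw [Finset.sum_Ico_succ_top h, ih, Finset.sum_Ico_succ_top h, Finset.sum_Ico_succ_top h, Finset.sum_Ico_succ_top h]
    ring

lemma Mq_le_Tq (P Q A B : ℕ → ℂ) (X Y : ℕ → ℝ) {m n : ℕ} (h : m < n) (hu : ∀ j < n, ‖P j - A j‖ ≤ X j)
    (hu' : ∀ j < n, ‖P (j+1) - A (j+1)‖ ≤ X j) (hP : ∀ j < n, ‖P (j+1) - P j‖ ≤ X j)
    (hB : ∀ j < n, ‖B (j+1) - B j‖ ≤ Y j) (hv' : ∀ j < n, ‖Q (j+1) - B (j+1)‖ ≤ Y j) :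
    ‖Mq P Q m n‖ ≤ Tq A B X Y m n := by
  have X0 : ∀ j < n, 0 ≤ X j := fun j hj => (norm_nonneg _).trans (hu j hj)
  rw [Mq_compare P Q A B m n h.le]
  obtain ⟨n, rfl⟩ : ∃ k, n = k + 1 := ⟨n-1, by omega⟩
  unfold Tq
  simp only [Nat.add_sub_cancel]
  have s1 : ‖∑ j ∈ Finset.Ico m (n+1), (P j - A j) * (B (j+1) - B j)‖ ≤ ∑ j ∈ Finset.Ico m (n+1), X j * Y j := by
    refine (norm_sum_le _ _).trans (Finset.sum_le_sum fun j hj => ?_)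
    have hj := (Finset.mem_Ico.1 hj).2
    rw [norm_mul]
    exact mul_le_mul (hu j hj) (hB j hj) (norm_nonneg _) (X0 j hj)
  have s2 : ‖∑ j ∈ Finset.Ico m (n+1), (P (j+1) - P j) * (Q (j+1) - B (j+1))‖ ≤ ∑ j ∈ Finset.Ico m (n+1), X j * Y j := by
    refine (norm_sum_le _ _).trans (Finset.sum_le_sum fun j hj => ?_)
    have hj := (Finset.mem_Ico.1 hj).2
    rw [norm_mul]
    exact mul_le_mul (hP j hj) (hv' j hj) (norm_nonneg _) (X0 j hj)
  have s3 : ‖(P m - A m) * (B (n+1) - B m)‖ ≤ X m * ‖B (n+1) - B m‖ := by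
    rw [norm_mul]
    exact mul_le_mul_of_nonneg_right (hu m h) (norm_nonneg _)
  have s4 : ‖P (n+1) - P m‖ ≤ ‖A (n+1) - A m‖ + X n + X m := by
    have e : P (n+1) - P m = (A (n+1) - A m) + (P (n+1) - A (n+1)) - (P m - A m) := by ring
    rw [e]
    exact (norm_sub_le _ _).trans (add_le_add ((norm_add_le _ _).trans (by gcongr; exact hu' n (by omega))) (hu m h))
  have s5 : ‖(P (n+1) - P m) * (Q (n+1) - B (n+1))‖ ≤ (‖A (n+1) - A m‖ + X n + X m) * Y n := by
    rw [norm_mul]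
    exact mul_le_mul s4 (hv' n (by omega)) (norm_nonneg _) ((norm_nonneg _).trans s4)
  refine (norm_sub_le _ _).trans ?_
  refine (add_le_add_left (norm_add_le _ _) _).trans ?_
  refine (add_le_add_left (add_le_add_left (norm_sub_le _ _) _) _).trans ?_
  refine (add_le_add_left (add_le_add_left (add_le_add_left (norm_add_le _ _) _) _) _).trans ?_
  linarith


/-! ## Frequency localised functions -/

open SchwartzMap in
lemma conv_bound (m : SchwartzMap ℝ ℂ) : ∃ C : ℝ≥0, ∀ g H : SchwartzMap ℝ ℂ,
    (∀ ξ, 𝓕 H ξ = m ξ * 𝓕 g ξ) → ∀ x, ENNReal.ofReal ‖H x‖ ≤ C * Av 0 (fun y => ENNReal.ofReal ‖g y‖) x := by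
  set ψ : SchwartzMap ℝ ℂ := 𝓕⁻ m with hψ
  set C : ℝ := 2 ^ 2 * ((Finset.Iic ((2, 0) : ℕ × ℕ)).sup (fun m => SchwartzMap.seminorm ℝ m.1 m.2)) ψ with hC
  have C0 : 0 ≤ C := by positivity
  have hψb : ∀ y, ‖ψ y‖ ≤ C / (1 + |y|)^2 := by
    intro y
    have := one_add_le_sup_seminorm_apply (𝕜 := ℝ) (m := (2,0)) (k := 2) (n := 0) le_rfl le_rfl ψ y
    rw [norm_iteratedFDeriv_zero] at this
    rw [le_div_iff₀ (by positivity), mul_comm]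
    exact this
  refine ⟨C.toNNReal, ?_⟩
  intro g H hH x
  have e : H = convolution (ContinuousLinearMap.mul ℂ ℂ) ψ g := by
    have : 𝓕 H = 𝓕 (convolution (ContinuousLinearMap.mul ℂ ℂ) ψ g) := by
      ext ξ
      rw [fourier_convolution, hH, hψ, FourierTransform.fourier_fourierInv_eq]
      rfl
    calc H = 𝓕⁻ (𝓕 H) := by simp
      _ = _ := by rw [this]; simp
  rw [e, convolution_apply, MeasureTheory.convolution_def]
  have e2 : ∫ t, (ContinuousLinearMap.mul ℂ ℂ (ψ t)) (g (x - t)) = ∫ t, ψ (x - t) * g t := by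
    rw [← integral_sub_left_eq_self (fun t => (ContinuousLinearMap.mul ℂ ℂ (ψ t)) (g (x - t))) volume x]
    simp
  rw [e2]
  have h1 := enorm_integral_le_lintegral_enorm (μ := volume) (fun t => ψ (x - t) * g t)
  rw [← ofReal_norm] at h1
  refine h1.trans ?_
  unfold Av
  rw [← lintegral_const_mul' _ _ ENNReal.coe_ne_top]
  apply lintegral_mono
  intro y
  show ‖ψ (x - y) * g y‖ₑ ≤ (C.toNNReal : ℝ≥0∞) * (wk 0 x y * ENNReal.ofReal ‖g y‖)
  rw [← ofReal_norm, norm_mul, ENNReal.ofReal_mul (norm_nonneg _), ← mul_assoc]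
  gcongr
  unfold wk
  rw [show (C.toNNReal : ℝ≥0∞) = ENNReal.ofReal C from rfl, ← ENNReal.ofReal_mul C0]
  apply ENNReal.ofReal_le_ofReal
  simpa [div_eq_mul_inv] using hψb (x - y)

open SchwartzMap in
lemma exists_bump (a b : ℝ) (ha : 0 < a) (hb : 0 < b) : ∃ m0 m1 m2 : SchwartzMap ℝ ℂ,
    ∀ ξ : ℝ, a ≤ |ξ| → |ξ| ≤ b → m0 ξ = 1 ∧ (2 * Real.pi * Complex.I * ξ) * m1 ξ = 1 ∧ m2 ξ = 2 * Real.pi * Complex.I * ξ := by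
  set χ : ℝ → ℝ := fun ξ => Real.smoothTransition ((4 * ξ^2/a^2 - 1)/3) * Real.smoothTransition (2 - ξ^2/b^2) with hχ
  have cχ : ContDiff ℝ (⊤ : ℕ∞) χ := by
    apply ContDiff.mul
    · apply Real.smoothTransition.contDiff.comp; fun_prop
    · apply Real.smoothTransition.contDiff.comp; fun_prop
  have sχ : HasCompactSupport χ := by
    apply HasCompactSupport.intro (isCompact_Icc (a := -(2*b)) (b := 2*b))
    intro x hx
    have : (2*b)^2 ≤ x^2 := by
      rw [Set.mem_Icc, not_and_or] at hx
      rcases hx with h | h <;> nlinarith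
    simp only [hχ]
    rw [Real.smoothTransition.zero_of_nonpos (x := 2 - x^2/b^2), mul_zero]
    rw [sub_nonpos, le_div_iff₀ (by positivity)]; nlinarith [sq_nonneg b]
  have χ1 : ∀ ξ : ℝ, a ≤ |ξ| → |ξ| ≤ b → χ ξ = 1 := by
    intro ξ h1 h2
    have h3 : a^2 ≤ ξ^2 := by rw [← sq_abs ξ]; gcongr
    have h4 : ξ^2 ≤ b^2 := by rw [← sq_abs ξ]; gcongr
    simp only [hχ]
    rw [Real.smoothTransition.one_of_one_le, Real.smoothTransition.one_of_one_le, mul_one]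
    · have : ξ^2/b^2 ≤ 1 := by rw [div_le_one (by positivity)]; exact h4
      linarith
    · have : 4 ≤ 4 * ξ^2/a^2 := by rw [le_div_iff₀ (by positivity)]; linarith
      linarith
  have χ0 : χ 0 = 0 := by
    simp only [hχ]
    rw [Real.smoothTransition.zero_of_nonpos (x := (4 * 0^2/a^2 - 1)/3), zero_mul]
    norm_num
  have χle : ∀ ξ, χ ξ ≤ 1 := by
    intro ξ
    have := Real.smoothTransition.le_one ((4 * ξ^2/a^2 - 1)/3)
    have := Real.smoothTransition.le_one (2 - ξ^2/b^2)
    have := Real.smoothTransition.nonneg ((4 * ξ^2/a^2 - 1)/3)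
    have := Real.smoothTransition.nonneg (2 - ξ^2/b^2)
    simp only [hχ]; nlinarith
  set d : ℝ → ℝ := fun ξ => ξ^2 + (1 - χ ξ) with hd
  have dpos : ∀ ξ, 0 < d ξ := by
    intro ξ
    simp only [hd]
    rcases eq_or_ne ξ 0 with h | h
    · rw [h, χ0]; norm_num
    · have := χle ξ
      have : 0 < ξ^2 := by positivity
      linarith
  have cd : ContDiff ℝ (⊤ : ℕ∞) d := by
    apply ContDiff.add (by fun_prop); exact contDiff_const.sub cχ
  have c1 : ContDiff ℝ (⊤ : ℕ∞) (fun ξ => χ ξ * (ξ / d ξ)) := cχ.mul (contDiff_id.div cd (fun x => (dpos x).ne'))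
  have s1 : HasCompactSupport (fun ξ => χ ξ * (ξ / d ξ)) := sχ.mul_right
  have c2 : ContDiff ℝ (⊤ : ℕ∞) (fun ξ => χ ξ * ξ) := cχ.mul contDiff_id
  have s2 : HasCompactSupport (fun ξ => χ ξ * ξ) := sχ.mul_right
  have mk : ∀ (u : ℝ → ℝ) (c : ℂ), ContDiff ℝ (⊤ : ℕ∞) u → HasCompactSupport u → ∃ m : SchwartzMap ℝ ℂ, ∀ ξ, m ξ = c * (u ξ : ℂ) := by
    intro u c hu hs
    have h1 : ContDiff ℝ (⊤ : ℕ∞) (fun ξ => c * (u ξ : ℂ)) := contDiff_const.mul (Complex.ofRealCLM.contDiff.comp hu)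
    have h2 : HasCompactSupport (fun ξ => c * (u ξ : ℂ)) := by
      apply HasCompactSupport.mul_left
      exact hs.comp_left (g := fun t : ℝ => (t:ℂ)) (by simp)
    exact ⟨h2.toSchwartzMap h1, fun ξ => rfl⟩
  obtain ⟨m0, h0⟩ := mk χ 1 cχ sχ
  obtain ⟨m1, h1⟩ := mk _ ((2 * Real.pi * Complex.I)⁻¹) c1 s1
  obtain ⟨m2, h2⟩ := mk _ (2 * Real.pi * Complex.I) c2 s2
  refine ⟨m0, m1, m2, ?_⟩
  intro ξ ha1 hb1
  have e := χ1 ξ ha1 hb1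
  have hne : ξ ≠ 0 := by intro h; rw [h, abs_zero] at ha1; linarith
  have pi0 : (Real.pi : ℂ) ≠ 0 := by exact_mod_cast Real.pi_ne_zero
  refine ⟨by rw [h0, e]; simp, ?_, by rw [h2, e]; push_cast; ring⟩
  rw [h1, e]
  simp only [hd, e]
  have : (ξ:ℂ) ≠ 0 := by exact_mod_cast hne
  have hI := Complex.I_ne_zero
  push_cast
  field_simp
  ring

open SchwartzMap in
lemma LP0 (a b : ℝ) (ha : 0 < a) (hb : 0 < b) : ∃ C : ℝ≥0, ∀ g : SchwartzMap ℝ ℂ,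
    (∀ ξ, 𝓕 (⇑g) ξ ≠ 0 → a < |ξ| ∧ |ξ| < b) →
    ∃ H : SchwartzMap ℝ ℂ, (∀ x, deriv H x = g x) ∧
      ∀ x, ENNReal.ofReal ‖H x‖ ≤ C * Av 0 (fun y => ENNReal.ofReal ‖g y‖) x ∧
        ENNReal.ofReal ‖g x‖ ≤ C * Av 0 (fun y => ENNReal.ofReal ‖g y‖) x ∧
        ENNReal.ofReal ‖deriv g x‖ ≤ C * Av 0 (fun y => ENNReal.ofReal ‖g y‖) x := by
  obtain ⟨m0, m1, m2, hm⟩ := exists_bump a b ha hb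
  obtain ⟨C0, h0⟩ := conv_bound m0
  obtain ⟨C1, h1⟩ := conv_bound m1
  obtain ⟨C2, h2⟩ := conv_bound m2
  refine ⟨C0 + C1 + C2, ?_⟩
  intro g hg
  have hg' : ∀ ξ, 𝓕 g ξ = 0 ∨ (a ≤ |ξ| ∧ |ξ| ≤ b) := by
    intro ξ
    by_cases h : 𝓕 g ξ = 0
    · exact Or.inl h
    · have := hg ξ h
      exact Or.inr ⟨this.1.le, this.2.le⟩
  have hder : ∀ (u : SchwartzMap ℝ ℂ) (ξ : ℝ), 𝓕 (derivCLM ℂ ℂ u) ξ = (2 * Real.pi * Complex.I * ξ) * 𝓕 u ξ := by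
    intro u ξ
    have := Real.fourier_deriv (f := u) u.integrable u.differentiable (derivCLM ℂ ℂ u).integrable
    exact congrFun this ξ
  set H : SchwartzMap ℝ ℂ := 𝓕⁻ (pairing (ContinuousLinearMap.mul ℂ ℂ) m1 (𝓕 g)) with hH
  have FH : ∀ ξ, 𝓕 H ξ = m1 ξ * 𝓕 g ξ := by
    intro ξ
    rw [hH, FourierTransform.fourier_fourierInv_eq]; rfl
  have dH : derivCLM ℂ ℂ H = g := by
    have : 𝓕 (derivCLM ℂ ℂ H) = 𝓕 g := by
      ext ξ
      rw [hder, FH]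
      rcases hg' ξ with h | ⟨h, h'⟩
      · rw [h]; simp
      · rw [← mul_assoc, (hm ξ h h').2.1, one_mul]
    calc derivCLM ℂ ℂ H = 𝓕⁻ (𝓕 (derivCLM ℂ ℂ H)) := by simp
      _ = _ := by rw [this]; simp
  refine ⟨H, fun x => by rw [← derivCLM_apply ℂ, dH], ?_⟩
  intro x
  have F0 : ∀ ξ, 𝓕 g ξ = m0 ξ * 𝓕 g ξ := by
    intro ξ
    rcases hg' ξ with h | ⟨h, h'⟩
    · rw [h]; simp
    · rw [(hm ξ h h').1, one_mul]
  have F2 : ∀ ξ, 𝓕 (derivCLM ℂ ℂ g) ξ = m2 ξ * 𝓕 g ξ := by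
    intro ξ
    rw [hder]
    rcases hg' ξ with h | ⟨h, h'⟩
    · rw [h]; simp
    · rw [(hm ξ h h').2.2]
  refine ⟨(h1 g H FH x).trans ?_, (h0 g g F0 x).trans ?_, (h2 g _ F2 x).trans ?_⟩ <;>
  · push_cast
    gcongr
    first
      | exact le_add_self
      | (rw [add_assoc]; exact le_self_add)
      | exact le_add_right le_add_self


/-! ## Rescaling -/

lemma Av_scale (i : ℤ) (h : ℝ → ℝ≥0∞) (x : ℝ) :
    Av 0 (fun y => h ((2:ℝ)^(-i) * y)) ((2:ℝ)^i * x) = Av i h x := by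
  have hp : (0:ℝ) < (2:ℝ)^i := by positivity
  have hq : (0:ℝ) < (2:ℝ)^(-i) := by positivity
  unfold Av
  have hm := Real.smul_map_volume_mul_left (a := (2:ℝ)^i) hp.ne'
  conv_lhs => rw [← hm]
  have hme : MeasurableEmbedding (fun y : ℝ => (2:ℝ)^i * y) := (Homeomorph.mulLeft₀ _ hp.ne').measurableEmbedding
  rw [lintegral_smul_measure, hme.lintegral_map, smul_eq_mul, ← lintegral_const_mul' _ _ ENNReal.ofReal_ne_top]
  apply lintegral_congr
  intro y
  rw [← mul_assoc]
  have e : (2:ℝ)^(-i) * ((2:ℝ)^i * y) = y := by rw [zpow_neg]; field_simp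
  beta_reduce
  rw [e]
  congr 1
  unfold wk
  rw [← ENNReal.ofReal_mul (abs_nonneg _), abs_of_pos hp, ← mul_sub, abs_mul, abs_of_pos hp]
  congr 1
  simp [div_eq_mul_inv]

open SchwartzMap in
lemma LPi (Nb : ℝ) : ∃ C : ℝ≥0, ∀ f : ℤ → SchwartzMap ℝ ℂ, IsContLPFamily Nb f → ∀ i : ℤ,
    ∃ H : ℝ → ℂ, (∀ x, HasDerivAt H ((2:ℂ)^i * f i x) x) ∧
      ∀ x, ENNReal.ofReal ‖H x‖ ≤ C * Av i (fun y => ENNReal.ofReal ‖f i y‖) x ∧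
        ENNReal.ofReal ‖f i x‖ ≤ C * Av i (fun y => ENNReal.ofReal ‖f i y‖) x ∧
        ENNReal.ofReal ‖deriv (f i) x‖ ≤ C * ENNReal.ofReal ((2:ℝ)^i) * Av i (fun y => ENNReal.ofReal ‖f i y‖) x := by
  obtain ⟨C, hC⟩ := LP0 ((2:ℝ)^(-Nb)) ((2:ℝ)^Nb) (by positivity) (by positivity)
  refine ⟨C, fun f hf i => ?_⟩
  have hp : (0:ℝ) < (2:ℝ)^i := by positivity
  have hq : (0:ℝ) < (2:ℝ)^(-i) := by positivity
  have epq : (2:ℝ)^(-i) * (2:ℝ)^i = 1 := by rw [zpow_neg, inv_mul_cancel₀ hp.ne']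
  set L : ℝ ≃L[ℝ] ℝ := ContinuousLinearEquiv.smulLeft (Units.mk0 ((2:ℝ)^(-i)) hq.ne') with hL
  have hLa : ∀ y, L y = (2:ℝ)^(-i) * y := fun y => rfl
  set g : SchwartzMap ℝ ℂ := compCLMOfContinuousLinearEquiv ℂ L (f i) with hg
  have ga : ∀ y, g y = f i ((2:ℝ)^(-i) * y) := fun y => rfl
  have hF : ∀ ξ, 𝓕 (⇑g) ξ = (((2:ℝ)^i : ℝ) : ℂ) * 𝓕 (⇑(f i)) ((2:ℝ)^i * ξ) := by
    intro ξ
    rw [Real.fourier_eq', Real.fourier_eq']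
    have h1 := Measure.integral_comp_mul_left (fun v : ℝ => Complex.exp (↑(-2 * Real.pi * inner ℝ v ((2:ℝ)^i * ξ)) * Complex.I) • f i v) ((2:ℝ)^(-i))
    rw [zpow_neg, inv_inv, abs_of_pos hp] at h1
    rw [Complex.real_smul] at h1
    rw [← h1]
    apply integral_congr_ae
    filter_upwards with v
    rw [ga, zpow_neg]
    congr 4
    simp only [RCLike.inner_apply, conj_trivial]
    field_simp
  have hband : ∀ ξ, 𝓕 (⇑g) ξ ≠ 0 → (2:ℝ)^(-Nb) < |ξ| ∧ |ξ| < (2:ℝ)^Nb := by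
    intro ξ h
    rw [hF] at h
    have h := hf i _ (right_ne_zero_of_mul h)
    rw [abs_mul, abs_of_pos hp, sub_eq_add_neg, Real.rpow_add (by norm_num), Real.rpow_add (by norm_num), Real.rpow_intCast] at h
    exact ⟨lt_of_mul_lt_mul_left h.1 hp.le, lt_of_mul_lt_mul_left h.2 hp.le⟩
  obtain ⟨H, hd, hb⟩ := hC g hband
  have lin : ∀ x : ℝ, HasDerivAt (fun x : ℝ => (2:ℝ)^i * x) ((2:ℝ)^i) x := by
    intro x; simpa using (hasDerivAt_id x).const_mul ((2:ℝ)^i)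
  have gx : ∀ x, g ((2:ℝ)^i * x) = f i x := by
    intro x; rw [ga, ← mul_assoc, epq, one_mul]
  have hAv : ∀ x, Av 0 (fun y => ENNReal.ofReal ‖g y‖) ((2:ℝ)^i * x) = Av i (fun y => ENNReal.ofReal ‖f i y‖) x :=
    fun x => Av_scale i (fun y => ENNReal.ofReal ‖f i y‖) x
  have hder : ∀ x, deriv (f i) x = ((2:ℝ)^i : ℝ) • deriv g ((2:ℝ)^i * x) := by
    intro x
    have h1 : HasDerivAt g (deriv g ((2:ℝ)^i * x)) ((2:ℝ)^i * x) := g.differentiable.differentiableAt.hasDerivAt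
    have h2 := h1.scomp x (lin x)
    have e : (g ∘ fun x : ℝ => (2:ℝ)^i * x) = f i := funext gx
    rw [e] at h2
    exact h2.deriv
  refine ⟨fun x => H ((2:ℝ)^i * x), ?_, ?_⟩
  · intro x
    have h1 : HasDerivAt H (deriv H ((2:ℝ)^i * x)) ((2:ℝ)^i * x) := H.differentiable.differentiableAt.hasDerivAt
    have h2 := h1.scomp x (lin x)
    rw [hd, gx, Complex.real_smul] at h2
    push_cast at h2
    exact h2
  · intro x
    have := hb ((2:ℝ)^i * x)
    rw [hAv, gx] at this
    refine ⟨this.1, this.2.1, ?_⟩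
    rw [hder, norm_smul, Real.norm_of_nonneg hp.le, ENNReal.ofReal_mul hp.le, mul_comm (C:ℝ≥0∞), mul_assoc]
    gcongr
    exact this.2.2


/-! ## Single frequency estimates -/

def an (f : ℤ → SchwartzMap ℝ ℂ) (i : ℤ) (y : ℝ) : ℝ≥0∞ := ENNReal.ofReal ‖f i y‖

lemma measurable_an (f : ℤ → SchwartzMap ℝ ℂ) (i : ℤ) : Measurable (an f i) :=
  ENNReal.measurable_ofReal.comp (f i).continuous.norm.measurable

def LPB (C : ℝ≥0) (f : ℤ → SchwartzMap ℝ ℂ) : Prop := ∀ i : ℤ,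
    ∃ H : ℝ → ℂ, (∀ x, HasDerivAt H ((2:ℂ)^i * f i x) x) ∧
      ∀ x, ENNReal.ofReal ‖H x‖ ≤ C * Av i (an f i) x ∧
        ENNReal.ofReal ‖f i x‖ ≤ C * Av i (an f i) x ∧
        ENNReal.ofReal ‖deriv (f i) x‖ ≤ C * ENNReal.ofReal ((2:ℝ)^i) * Av i (an f i) x

lemma wk_comp (m : ℤ) {x x' : ℝ} (h : (2:ℝ)^m * |x - x'| ≤ 2) (y : ℝ) : wk m x' y ≤ 9 * wk m x y := by
  unfold wk
  have hp : (0:ℝ) < (2:ℝ)^m := by positivity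
  rw [show (9:ℝ≥0∞) = ENNReal.ofReal 9 by simp, ← ENNReal.ofReal_mul (by norm_num)]
  apply ENNReal.ofReal_le_ofReal
  rw [← mul_div_assoc, div_le_div_iff₀ (by positivity) (by positivity)]
  have h1 : |x - y| ≤ |x - x'| + |x' - y| := abs_sub_le _ _ _
  have h2 : (2:ℝ)^m * |x-y| ≤ 2 + (2:ℝ)^m * |x'-y| := by nlinarith
  have h3 : 0 ≤ (2:ℝ)^m * |x'-y| := by positivity
  have h4 : 0 ≤ (2:ℝ)^m * |x-y| := by positivity
  have h5 : (1 + (2:ℝ)^m * |x-y|)^2 ≤ (3 * (1 + (2:ℝ)^m * |x'-y|))^2 := by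
    gcongr; linarith
  nlinarith

lemma Av_comp (m : ℤ) {x x' : ℝ} (h : (2:ℝ)^m * |x - x'| ≤ 2) (u : ℝ → ℝ≥0∞) : Av m u x' ≤ 9 * Av m u x := by
  unfold Av
  rw [← lintegral_const_mul' _ _ (by simp)]
  apply lintegral_mono
  intro y
  show wk m x' y * u y ≤ 9 * (wk m x y * u y)
  rw [← mul_assoc]
  gcongr
  exact wk_comp m h y

lemma Av_scale_le {n i : ℤ} (h : n ≤ i) (u : ℝ → ℝ≥0∞) (x : ℝ) :
    Av i u x ≤ ENNReal.ofReal ((2:ℝ)^(i-n)) * Av n u x := by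
  unfold Av
  rw [← lintegral_const_mul' _ _ ENNReal.ofReal_ne_top]
  apply lintegral_mono
  intro y
  show wk i x y * u y ≤ _ * (wk n x y * u y)
  rw [← mul_assoc]
  gcongr
  unfold wk
  rw [← ENNReal.ofReal_mul (by positivity)]
  apply ENNReal.ofReal_le_ofReal
  rw [← mul_div_assoc, ← zpow_add₀ (by norm_num), sub_add_cancel]
  gcongr
  norm_num

def Tp (ρ : ℝ) (f : ℤ → SchwartzMap ℝ ℂ) (i n : ℤ) (x : ℝ) : ℝ≥0∞ :=
  (Av (min i n) (fun y => an f i y ^ ρ) x) ^ (1/ρ)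

lemma Av_le_Tp {ρ : ℝ} (hρ : 1 ≤ ρ) (f : ℤ → SchwartzMap ℝ ℂ) (i m : ℤ) (x : ℝ) :
    Av m (an f i) x ≤ 16 * (Av m (fun y => an f i y ^ ρ) x) ^ (1/ρ) := by
  have h := Av_jensen m (measurable_an f i) hρ x
  have r0 : 0 < ρ := by linarith
  calc Av m (an f i) x = ((Av m (an f i) x)^ρ)^(1/ρ) := by
        rw [← ENNReal.rpow_mul, mul_one_div_cancel r0.ne', ENNReal.rpow_one]
    _ ≤ (16^(ρ-1) * Av m (fun y => an f i y ^ ρ) x)^(1/ρ) := ENNReal.rpow_le_rpow h (by positivity)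
    _ = (16:ℝ≥0∞)^((ρ-1)*(1/ρ)) * _ := by
        rw [ENNReal.mul_rpow_of_nonneg _ _ (by positivity), ← ENNReal.rpow_mul]
    _ ≤ 16 * _ := by
        gcongr
        calc (16:ℝ≥0∞)^((ρ-1)*(1/ρ)) ≤ (16:ℝ≥0∞)^(1:ℝ) := by
              apply ENNReal.rpow_le_rpow_of_exponent_le (by norm_num)
              rw [mul_one_div, div_le_one r0]; linarith
          _ = 16 := ENNReal.rpow_one _

lemma Tp_comp {ρ : ℝ} (hρ : 1 ≤ ρ) (f : ℤ → SchwartzMap ℝ ℂ) (i n : ℤ) {x x' : ℝ} (h : (2:ℝ)^n * |x - x'| ≤ 2) :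
    Tp ρ f i n x' ≤ 9 * Tp ρ f i n x := by
  unfold Tp
  have h' : (2:ℝ)^(min i n) * |x - x'| ≤ 2 := by
    refine le_trans ?_ h
    gcongr
    · norm_num
    · exact min_le_right _ _
  calc _ ≤ (9 * Av (min i n) (fun y => an f i y ^ ρ) x)^(1/ρ) := ENNReal.rpow_le_rpow (Av_comp _ h' _) (by positivity)
    _ = (9:ℝ≥0∞)^(1/ρ) * _ := ENNReal.mul_rpow_of_nonneg _ _ (by positivity)
    _ ≤ 9 * _ := by
        gcongr
        calc (9:ℝ≥0∞)^(1/ρ) ≤ (9:ℝ≥0∞)^(1:ℝ) := by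
              apply ENNReal.rpow_le_rpow_of_exponent_le (by norm_num)
              rw [div_le_one (by linarith)]; exact hρ
          _ = 9 := ENNReal.rpow_one _

lemma Av_an_ne_top {ρ : ℝ} (hρ : 1 ≤ ρ) (f : ℤ → SchwartzMap ℝ ℂ) (i m : ℤ) (x : ℝ) :
    Av m (fun y => an f i y ^ ρ) x ≠ ⊤ := by
  set c : ℝ≥0 := ((SchwartzMap.seminorm ℝ 0 0) (f i)).toNNReal with hc
  have hb : ∀ y, an f i y ≤ c := by
    intro y
    exact ENNReal.ofReal_le_ofReal (SchwartzMap.norm_le_seminorm ℝ (f i) y)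
  have h1 : Av m (fun y => an f i y ^ ρ) x ≤ 16 * ((c:ℝ≥0∞)^ρ) := by
    refine le_trans (Av_mono m (fun y => ENNReal.rpow_le_rpow (hb y) (by linarith)) x) ?_
    exact (Av_le_Mx m _ x).trans (Mx_const_le _ _)
  refine ne_top_of_le_ne_top ?_ h1
  exact ENNReal.mul_ne_top (by simp) (ENNReal.rpow_ne_top_of_nonneg (by linarith) ENNReal.coe_ne_top)

lemma Tp_ne_top {ρ : ℝ} (hρ : 1 ≤ ρ) (f : ℤ → SchwartzMap ℝ ℂ) (i n : ℤ) (x : ℝ) : Tp ρ f i n x ≠ ⊤ :=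
  ENNReal.rpow_ne_top_of_nonneg (by positivity) (Av_an_ne_top hρ f i _ x)

lemma low_est {C : ℝ≥0} {f : ℤ → SchwartzMap ℝ ℂ} (hf : LPB C f) {ρ : ℝ} (hρ : 1 ≤ ρ) {i n : ℤ} (hin : i ≤ n)
    {x x' w : ℝ} (hx : (2:ℝ)^n * |w - x| ≤ 2) (hx' : (2:ℝ)^n * |w - x'| ≤ 2) :
    ENNReal.ofReal ‖f i x - f i x'‖ ≤ 576 * C * ENNReal.ofReal ((2:ℝ)^(i-n)) * Tp ρ f i n w := by
  obtain ⟨H, -, hH⟩ := hf i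
  have hp : (0:ℝ) < (2:ℝ)^n := by positivity
  have hpi : (0:ℝ) < (2:ℝ)^i := by positivity
  have hle : (2:ℝ)^i ≤ (2:ℝ)^n := zpow_le_zpow_right₀ (by norm_num) hin
  set T := Tp ρ f i n w with hT
  set B : ℝ≥0∞ := C * ENNReal.ofReal ((2:ℝ)^i) * (9 * (16 * T)) with hB
  have Tfin : T ≠ ⊤ := Tp_ne_top hρ f i n w
  have Bfin : B ≠ ⊤ := by
    refine ENNReal.mul_ne_top (ENNReal.mul_ne_top ENNReal.coe_ne_top ENNReal.ofReal_ne_top) ?_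
    exact ENNReal.mul_ne_top (by simp) (ENNReal.mul_ne_top (by simp) Tfin)
  have hxw : ∀ v, (2:ℝ)^n * |w - v| ≤ 2 ↔ v ∈ Metric.closedBall w (2 / (2:ℝ)^n) := by
    intro v
    rw [Metric.mem_closedBall, Real.dist_eq, abs_sub_comm, le_div_iff₀ hp, mul_comm]
  have hd : ∀ v ∈ Metric.closedBall w (2 / (2:ℝ)^n), ‖deriv (f i) v‖ ≤ B.toReal := by
    intro v hv
    rw [← hxw] at hv
    rw [← ENNReal.ofReal_le_iff_le_toReal Bfin]
    refine (hH v).2.2.trans ?_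
    rw [hB]
    gcongr
    have h2 : (2:ℝ)^i * |w - v| ≤ 2 := (mul_le_mul_of_nonneg_right hle (abs_nonneg _)).trans hv
    refine (Av_comp i h2 _).trans ?_
    gcongr
    rw [hT, Tp, min_eq_left hin]
    exact Av_le_Tp hρ f i i w
  have hmv := Convex.norm_image_sub_le_of_norm_deriv_le (𝕜 := ℝ) (f := f i)
    (fun v _ => (f i).differentiable.differentiableAt) hd (convex_closedBall w _) ((hxw x').1 hx') ((hxw x).1 hx)
  have hdist : ‖x - x'‖ ≤ 4 / (2:ℝ)^n := by
    rw [Real.norm_eq_abs]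
    have h1 := (hxw x).1 hx
    have h2 := (hxw x').1 hx'
    rw [Metric.mem_closedBall, Real.dist_eq] at h1 h2
    rw [show x - x' = (x - w) - (x' - w) by ring]
    refine (abs_sub _ _).trans ?_
    rw [show (4:ℝ) / 2^n = 2/2^n + 2/2^n by ring]
    linarith
  have h3 : ‖f i x - f i x'‖ ≤ B.toReal * (4 / (2:ℝ)^n) := hmv.trans (by gcongr)
  refine (ENNReal.ofReal_le_ofReal h3).trans ?_
  rw [ENNReal.ofReal_mul ENNReal.toReal_nonneg, ENNReal.ofReal_toReal Bfin, hB]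
  have e : ENNReal.ofReal ((2:ℝ)^i) * ENNReal.ofReal (4/(2:ℝ)^n) = 4 * ENNReal.ofReal ((2:ℝ)^(i-n)) := by
    rw [← ENNReal.ofReal_mul hpi.le, zpow_sub₀ (by norm_num), show (4:ℝ≥0∞) = ENNReal.ofReal 4 by simp,
      ← ENNReal.ofReal_mul (by norm_num)]
    congr 1; ring
  apply le_of_eq
  calc _ = 144 * C * (ENNReal.ofReal ((2:ℝ)^i) * ENNReal.ofReal (4/(2:ℝ)^n)) * T := by ring
    _ = _ := by rw [e]; ring

lemma self_est {C : ℝ≥0} {f : ℤ → SchwartzMap ℝ ℂ} (hf : LPB C f) {ρ : ℝ} (hρ : 1 ≤ ρ) {n : ℤ}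
    {x w : ℝ} (hx : (2:ℝ)^n * |w - x| ≤ 2) :
    ENNReal.ofReal ‖f n x‖ ≤ 576 * C * Tp ρ f n n w := by
  obtain ⟨H, -, hH⟩ := hf n
  refine (hH x).2.1.trans ?_
  calc (C:ℝ≥0∞) * Av n (an f n) x ≤ C * (16 * (9 * Tp ρ f n n w)) := by
        gcongr
        refine (Av_le_Tp hρ f n n x).trans ?_
        have := Tp_comp hρ f n n hx
        rw [Tp, min_self] at this
        gcongr
    _ = 144 * C * Tp ρ f n n w := by ring
    _ ≤ _ := by gcongr; norm_num

lemma high_est {C : ℝ≥0} {f : ℤ → SchwartzMap ℝ ℂ} (hf : LPB C f) {ρ : ℝ} (hρ : 1 ≤ ρ) {i n : ℤ} (hin : n ≤ i)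
    {l r w : ℝ} (hl : (2:ℝ)^n * |w - l| ≤ 2) (hr : (2:ℝ)^n * |w - r| ≤ 2) :
    ENNReal.ofReal ‖((2:ℝ)^n : ℝ) • ∫ y in l..r, f i y‖ ≤ 576 * C * ENNReal.ofReal ((2:ℝ)^(-(1-1/ρ) * (i-n:ℤ))) * Tp ρ f i n w := by
  obtain ⟨H, hHd, hH⟩ := hf i
  have r0 : 0 < ρ := by linarith
  have hp : (0:ℝ) < (2:ℝ)^n := by positivity
  have hpi : (0:ℝ) < (2:ℝ)^i := by positivity
  have hpc : ((2:ℂ)^i) ≠ 0 := zpow_ne_zero _ two_ne_zero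
  have hIntg : ∫ y in l..r, f i y = (2:ℂ)^(-i) * (H r - H l) := by
    have h1 : ∫ y in l..r, (2:ℂ)^i * f i y = H r - H l := by
      apply intervalIntegral.integral_eq_sub_of_hasDerivAt (fun x _ => hHd x)
      exact (continuous_const.mul (f i).continuous).intervalIntegrable _ _
    rw [← h1, intervalIntegral.integral_const_mul, ← mul_assoc, zpow_neg, inv_mul_cancel₀ hpc, one_mul]
  have hHb : ∀ v, (2:ℝ)^n * |w - v| ≤ 2 → ENNReal.ofReal ‖H v‖ ≤ C * (16 * (ENNReal.ofReal ((2:ℝ)^((i-n:ℤ)*(1/ρ))) * (9 * Tp ρ f i n w))) := by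
    intro v hv
    refine (hH v).1.trans ?_
    gcongr
    refine (Av_le_Tp hρ f i i v).trans ?_
    gcongr
    have h2 := Av_scale_le hin (fun y => an f i y ^ ρ) v
    refine (ENNReal.rpow_le_rpow h2 (by positivity)).trans ?_
    rw [ENNReal.mul_rpow_of_nonneg _ _ (by positivity), ENNReal.ofReal_rpow_of_pos (by positivity)]
    rw [← Real.rpow_intCast, ← Real.rpow_mul (by norm_num)]
    gcongr
    have := Tp_comp hρ f i n hv
    rw [Tp, min_eq_right hin] at this
    exact this
  have hn : ‖((2:ℝ)^n : ℝ) • ∫ y in l..r, f i y‖ ≤ (2:ℝ)^(n-i) * (‖H r‖ + ‖H l‖) := by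
    rw [hIntg, norm_smul, norm_mul, Real.norm_of_nonneg hp.le, ← mul_assoc]
    rw [norm_zpow, Complex.norm_ofNat, ← zpow_add₀ (by norm_num), ← sub_eq_add_neg]
    gcongr
    exact norm_sub_le _ _
  refine (ENNReal.ofReal_le_ofReal hn).trans ?_
  rw [ENNReal.ofReal_mul (by positivity), ENNReal.ofReal_add (norm_nonneg _) (norm_nonneg _)]
  have e : ENNReal.ofReal ((2:ℝ)^(-(1-1/ρ) * (i-n:ℤ))) = ENNReal.ofReal ((2:ℝ)^(n-i)) * ENNReal.ofReal ((2:ℝ)^((i-n:ℤ)*(1/ρ))) := by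
    rw [← ENNReal.ofReal_mul (by positivity), ← Real.rpow_intCast, ← Real.rpow_add (by norm_num)]
    congr 2
    push_cast; ring
  rw [e]
  calc _ ≤ ENNReal.ofReal ((2:ℝ)^(n-i)) * (C * (16 * (ENNReal.ofReal ((2:ℝ)^((i-n:ℤ)*(1/ρ))) * (9 * Tp ρ f i n w)))
        + C * (16 * (ENNReal.ofReal ((2:ℝ)^((i-n:ℤ)*(1/ρ))) * (9 * Tp ρ f i n w)))) := by
          gcongr
          · exact hHb r hr
          · exact hHb l hl
    _ = 288 * (C * (ENNReal.ofReal ((2:ℝ)^(n-i)) * ENNReal.ofReal ((2:ℝ)^((i-n:ℤ)*(1/ρ)))) * Tp ρ f i n w) := by ring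
    _ ≤ 576 * (C * (ENNReal.ofReal ((2:ℝ)^(n-i)) * ENNReal.ofReal ((2:ℝ)^((i-n:ℤ)*(1/ρ)))) * Tp ρ f i n w) := by
          gcongr; norm_num
    _ = _ := by ring


/-! ## Envelopes and approximating sequences -/

def cw (δ : ℝ) (d : ℤ) : ℝ≥0∞ := ENNReal.ofReal ((2:ℝ)^(-δ * |(d:ℝ)|))

def env (ρ δ : ℝ) (f : ℤ → SchwartzMap ℝ ℂ) (S : Finset ℤ) (n : ℤ) (x : ℝ) : ℝ≥0∞ :=
  ∑ i ∈ S, cw δ (i - n) * Tp ρ f i n x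

lemma cw_pos (δ : ℝ) (d : ℤ) : cw δ d ≠ 0 := by
  unfold cw
  have : (0:ℝ) < (2:ℝ)^(-δ * |(d:ℝ)|) := by positivity
  simpa using this

lemma cw_ne_top (δ : ℝ) (d : ℤ) : cw δ d ≠ ⊤ := ENNReal.ofReal_ne_top

lemma cw_zero (δ : ℝ) : cw δ 0 = 1 := by simp [cw]

lemma env_comp {ρ : ℝ} (hρ : 1 ≤ ρ) (δ : ℝ) (f : ℤ → SchwartzMap ℝ ℂ) (S : Finset ℤ) (n : ℤ) {x x' : ℝ}
    (h : (2:ℝ)^n * |x - x'| ≤ 2) : env ρ δ f S n x' ≤ 9 * env ρ δ f S n x := by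
  unfold env
  rw [Finset.mul_sum]
  apply Finset.sum_le_sum
  intro i _
  calc _ ≤ cw δ (i-n) * (9 * Tp ρ f i n x) := by gcongr; exact Tp_comp hρ f i n h
    _ = _ := by ring

lemma env_ne_top {ρ : ℝ} (hρ : 1 ≤ ρ) (δ : ℝ) (f : ℤ → SchwartzMap ℝ ℂ) (S : Finset ℤ) (n : ℤ) (x : ℝ) :
    env ρ δ f S n x ≠ ⊤ := by
  unfold env
  rw [ENNReal.sum_ne_top]
  intro i _
  exact ENNReal.mul_ne_top (cw_ne_top _ _) (Tp_ne_top hρ f i n x)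

lemma wk_ne_zero (m : ℤ) (x y : ℝ) : wk m x y ≠ 0 := by
  unfold wk
  have : (0:ℝ) < (2:ℝ)^m/(1+(2:ℝ)^m*|x-y|)^2 := by positivity
  simpa using this

lemma Tp_ne_zero {ρ : ℝ} (hρ : 1 ≤ ρ) (f : ℤ → SchwartzMap ℝ ℂ) (i n : ℤ) (hi : f i ≠ 0) (x : ℝ) :
    Tp ρ f i n x ≠ 0 := by
  have r0 : 0 < ρ := by linarith
  unfold Tp
  intro h
  rw [ENNReal.rpow_eq_zero_iff_of_pos (by positivity), Av] at h
  have hmm : Measurable (fun y => wk (min i n) x y * an f i y ^ ρ) :=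
    (measurable_wk _ x).mul ((measurable_an f i).pow_const ρ)
  rw [lintegral_eq_zero_iff hmm] at h
  apply hi
  have h1 : (f i : ℝ → ℂ) =ᵐ[volume] (fun _ => (0:ℂ)) := by
    filter_upwards [h] with y hy
    simp only [Pi.zero_apply, mul_eq_zero] at hy
    rcases hy with hy | hy
    · exact absurd hy (wk_ne_zero _ _ _)
    · rw [ENNReal.rpow_eq_zero_iff_of_pos r0] at hy
      simpa [an] using hy
  have h2 := (Continuous.ae_eq_iff_eq volume (f i).continuous continuous_const).1 h1
  ext y
  exact congrFun h2 y

lemma env_ne_zero {ρ : ℝ} (hρ : 1 ≤ ρ) (δ : ℝ) (f : ℤ → SchwartzMap ℝ ℂ) (S : Finset ℤ) (n : ℤ) (x : ℝ)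
    {i : ℤ} (hiS : i ∈ S) (hi : f i ≠ 0) : env ρ δ f S n x ≠ 0 := by
  unfold env
  intro h
  rw [Finset.sum_eq_zero_iff] at h
  exact mul_ne_zero (cw_pos _ _) (Tp_ne_zero hρ f i n hi x) (h i hiS)

def PP (f : ℤ → SchwartzMap ℝ ℂ) (S : Finset ℤ) (n : ℤ) (x : ℝ) : ℂ := ∑ i ∈ S, if i ≤ n then f i x else 0

/-- left end point of a dyadic interval -/
def lep (n z : ℤ) : ℝ := z * (2:ℝ)^(-n)

def AS (f : ℤ → SchwartzMap ℝ ℂ) (S : Finset ℤ) (n z : ℤ) : ℂ := PP f S n (lep n z)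

def AM (f : ℤ → SchwartzMap ℝ ℂ) (S : Finset ℤ) (n z : ℤ) : ℂ :=
  ∑ i ∈ S, ((2:ℝ)^n : ℝ) • ∫ y in lep n z..lep n (z+1), f i y

lemma lep_succ (n z : ℤ) : lep n (z+1) = lep n z + (2:ℝ)^(-n) := by
  unfold lep; push_cast; ring

lemma lep_two (n z : ℤ) : lep (n+1) (2*z) = lep n z := by
  unfold lep; rw [neg_add, zpow_add₀ (by norm_num)]; push_cast; norm_num; ring

lemma AM_mart (f : ℤ → SchwartzMap ℝ ℂ) (S : Finset ℤ) (n z : ℤ) :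
    AM f S (n+1) (2*z) + AM f S (n+1) (2*z+1) = 2 * AM f S n z := by
  unfold AM
  rw [← Finset.sum_add_distrib, Finset.mul_sum]
  apply Finset.sum_congr rfl
  intro i _
  rw [← smul_add, intervalIntegral.integral_add_adjacent_intervals ((f i).continuous.intervalIntegrable _ _)
    ((f i).continuous.intervalIntegrable _ _), lep_two, show 2*z+1+1 = 2*(z+1) by ring, lep_two,
    zpow_add_one₀ (by norm_num), mul_comm ((2:ℝ)^n), mul_smul, Complex.real_smul]
  simp

def Appr (E : ℝ≥0) (ρ δ : ℝ) (f : ℤ → SchwartzMap ℝ ℂ) (S : Finset ℤ) (A : ℤ → ℤ → ℂ) : Prop :=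
  ∀ n z w x, (∀ v ∈ Set.Icc (lep n z) (lep n (z+1)), (2:ℝ)^n * |w - v| ≤ 2) → x ∈ Set.Icc (lep n z) (lep n (z+1)) →
    ENNReal.ofReal ‖PP f S n x - A n z‖ ≤ E * env ρ δ f S n w

lemma low_cw {δ : ℝ} (hδ : δ ≤ 1) {i n : ℤ} (h : i ≤ n) : ENNReal.ofReal ((2:ℝ)^(i-n)) ≤ cw δ (i-n) := by
  unfold cw
  apply ENNReal.ofReal_le_ofReal
  rw [← Real.rpow_intCast]
  apply Real.rpow_le_rpow_of_exponent_le (by norm_num)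
  have : ((i - n : ℤ) : ℝ) ≤ 0 := by exact_mod_cast (by omega : i - n ≤ 0)
  rw [abs_of_nonpos this]
  nlinarith

lemma high_cw {δ ρ : ℝ} (hδ : δ ≤ 1 - 1/ρ) {i n : ℤ} (h : n ≤ i) :
    ENNReal.ofReal ((2:ℝ)^(-(1-1/ρ) * (i-n:ℤ))) ≤ cw δ (i-n) := by
  unfold cw
  apply ENNReal.ofReal_le_ofReal
  apply Real.rpow_le_rpow_of_exponent_le (by norm_num)
  have : 0 ≤ ((i - n : ℤ) : ℝ) := by exact_mod_cast (by omega : 0 ≤ i - n)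
  rw [abs_of_nonneg this]
  nlinarith

lemma ofReal_norm_sum_le {ι : Type*} (S : Finset ι) (u : ι → ℂ) :
    ENNReal.ofReal ‖∑ i ∈ S, u i‖ ≤ ∑ i ∈ S, ENNReal.ofReal ‖u i‖ := by
  rw [← ENNReal.ofReal_sum_of_nonneg (fun i _ => norm_nonneg _)]
  exact ENNReal.ofReal_le_ofReal (norm_sum_le _ _)

lemma lep_le (n z : ℤ) : lep n z ≤ lep n (z+1) := by
  rw [lep_succ]; have : (0:ℝ) < (2:ℝ)^(-n) := by positivity
  linarith

lemma AS_appr {C : ℝ≥0} {f : ℤ → SchwartzMap ℝ ℂ} (hf : LPB C f) {ρ δ : ℝ} (hρ : 1 ≤ ρ) (hδ : δ ≤ 1) (S : Finset ℤ) :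
    Appr (576 * C) ρ δ f S (AS f S) := by
  intro n z w x hw hx
  unfold AS PP env
  rw [← Finset.sum_sub_distrib, Finset.mul_sum]
  refine (ofReal_norm_sum_le _ _).trans (Finset.sum_le_sum fun i _ => ?_)
  split_ifs with h
  · refine (low_est hf hρ h (hw x hx) (hw _ ⟨le_rfl, lep_le n z⟩)).trans ?_
    rw [mul_assoc]
    push_cast
    gcongr
    exact low_cw hδ h
  · simp

lemma AM_appr {C : ℝ≥0} {f : ℤ → SchwartzMap ℝ ℂ} (hf : LPB C f) {ρ δ : ℝ} (hρ : 1 ≤ ρ) (hδ : δ ≤ 1 - 1/ρ) (S : Finset ℤ) :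
    Appr (576 * C) ρ δ f S (AM f S) := by
  intro n z w x hw hx
  have hδ1 : δ ≤ 1 := by
    have : 0 < 1/ρ := by positivity
    linarith
  unfold AM PP env
  rw [← Finset.sum_sub_distrib, Finset.mul_sum]
  refine (ofReal_norm_sum_le _ _).trans (Finset.sum_le_sum fun i _ => ?_)
  have hp : (0:ℝ) < (2:ℝ)^n := by positivity
  split_ifs with h
  · set B : ℝ≥0∞ := (576 * C : ℝ≥0) * (cw δ (i-n) * Tp ρ f i n w) with hB
    have Bfin : B ≠ ⊤ := ENNReal.mul_ne_top ENNReal.coe_ne_top (ENNReal.mul_ne_top (cw_ne_top _ _) (Tp_ne_top hρ f i n w))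
    have hb : ∀ y ∈ Set.Icc (lep n z) (lep n (z+1)), ‖f i x - f i y‖ ≤ B.toReal := by
      intro y hy
      rw [← ENNReal.ofReal_le_iff_le_toReal Bfin]
      refine (low_est hf hρ h (hw x hx) (hw y hy)).trans ?_
      rw [hB, mul_assoc]
      push_cast
      gcongr
      exact low_cw hδ1 h
    have hlen : lep n (z+1) - lep n z = (2:ℝ)^(-n) := by rw [lep_succ]; ring
    have e : f i x - ((2:ℝ)^n : ℝ) • ∫ y in lep n z..lep n (z+1), f i y = ((2:ℝ)^n : ℝ) • ∫ y in lep n z..lep n (z+1), (f i x - f i y) := by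
      rw [intervalIntegral.integral_sub (by simp) ((f i).continuous.intervalIntegrable _ _), smul_sub,
        intervalIntegral.integral_const, hlen, smul_smul, zpow_neg, mul_inv_cancel₀ hp.ne', one_smul]
    rw [e, ENNReal.ofReal_le_iff_le_toReal Bfin, norm_smul, Real.norm_of_nonneg hp.le]
    have h1 := intervalIntegral.norm_integral_le_of_norm_le_const (f := fun y => f i x - f i y) (a := lep n z) (b := lep n (z+1)) (C := B.toReal) (by
      intro y hy
      rw [Set.uIoc_of_le (lep_le n z)] at hy
      exact hb y ⟨hy.1.le, hy.2⟩)
    rw [hlen, abs_of_pos (by positivity)] at h1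
    calc _ ≤ (2:ℝ)^n * (B.toReal * (2:ℝ)^(-n)) := by gcongr
      _ = B.toReal := by rw [zpow_neg]; field_simp
  · rw [zero_sub, norm_neg]
    refine (high_est hf hρ (not_le.1 h).le (hw _ ⟨le_rfl, lep_le n z⟩) (hw _ ⟨lep_le n z, le_rfl⟩)).trans ?_
    rw [mul_assoc]
    push_cast
    gcongr
    have := high_cw hδ (not_le.1 h).le; push_cast at this; exact this


/-! ## Mixed norm bound for the envelopes -/

lemma cw_sum_ne_top {δ : ℝ} (hδ : 0 < δ) : ∑' d : ℤ, cw δ d ≠ ⊤ := by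
  have h : Summable (fun d : ℤ => (2:ℝ)^(-δ * |(d:ℝ)|)) := by
    have h0 : Summable (fun n : ℕ => (2:ℝ)^(-δ * (n:ℝ))) := by
      have : (fun n : ℕ => (2:ℝ)^(-δ * (n:ℝ))) = fun n : ℕ => ((2:ℝ)^(-δ))^n := by
        funext n
        rw [Real.rpow_mul (by norm_num), Real.rpow_natCast]
      rw [this]
      apply summable_geometric_of_lt_one (by positivity)
      exact Real.rpow_lt_one_of_one_lt_of_neg (by norm_num) (by linarith)
    apply Summable.of_nat_of_neg
    · simpa using h0
    · simpa using h0
  unfold cw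
  exact h.tsum_ofReal_ne_top

lemma cw_sum_le1 (δ : ℝ) (S : Finset ℤ) (n : ℤ) : ∑ i ∈ S, cw δ (i - n) ≤ ∑' d : ℤ, cw δ d := by
  calc _ ≤ ∑' i, cw δ (i - n) := ENNReal.sum_le_tsum S
    _ = _ := (Equiv.subRight n).tsum_eq (cw δ)

lemma cw_sum_le2 (δ : ℝ) (S : Finset ℤ) (i : ℤ) : ∑ n ∈ S, cw δ (i - n) ≤ ∑' d : ℤ, cw δ d := by
  calc _ ≤ ∑' n, cw δ (i - n) := ENNReal.sum_le_tsum S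
    _ = _ := (Equiv.subLeft i).tsum_eq (cw δ)

lemma Av_const_mul (m : ℤ) {c : ℝ≥0∞} (hc : c ≠ ⊤) (u : ℝ → ℝ≥0∞) (x : ℝ) :
    Av m (fun y => c * u y) x = c * Av m u x := by
  unfold Av
  rw [← lintegral_const_mul' _ _ hc]
  apply lintegral_congr
  intro y; ring

lemma env_Lp {p r ρ δ : ℝ} (hρ : 1 ≤ ρ) (hp : ρ < p) (hr : ρ ≤ r) (hδ : 0 < δ) : ∃ C : ℝ≥0,
    ∀ (f : ℤ → SchwartzMap ℝ ℂ) (S NS : Finset ℤ),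
      ∫⁻ x, (∑ n ∈ NS, env ρ δ f S n x ^ r)^(p/r) ≤ C * ∫⁻ x, (∑ i ∈ S, an f i x ^ r)^(p/r) := by
  have ρ0 : 0 < ρ := by linarith
  have r0 : 0 < r := by linarith
  have r1 : 1 ≤ r := by linarith
  have p0 : 0 < p := by linarith
  obtain ⟨C, hC⟩ := FS (p/ρ) (r/ρ) ((one_lt_div ρ0).2 hp) ((one_le_div ρ0).2 hr)
  have hW := cw_sum_ne_top hδ
  set W := ∑' d : ℤ, cw δ d with hWd
  have epr : p/ρ/(r/ρ) = p/r := by field_simp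
  set C' : ℝ≥0∞ := (W^(r-1))^(p/r) * C * W^(p/r) with hC'
  have C'fin : C' ≠ ⊤ := by
    refine ENNReal.mul_ne_top (ENNReal.mul_ne_top ?_ ENNReal.coe_ne_top) ?_
    · exact ENNReal.rpow_ne_top_of_nonneg (by positivity) (ENNReal.rpow_ne_top_of_nonneg (by linarith) hW)
    · exact ENNReal.rpow_ne_top_of_nonneg (by positivity) hW
  refine ⟨C'.toNNReal, ?_⟩
  intro f S NS
  rw [ENNReal.coe_toNNReal C'fin]
  set h : ℤ × ℤ → ℝ → ℝ≥0∞ := fun q y => cw δ (q.2 - q.1) ^ (ρ/r) * an f q.2 y ^ ρ with hh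
  have cfin : ∀ d, cw δ d ^ (ρ/r) ≠ ⊤ := fun d => ENNReal.rpow_ne_top_of_nonneg (by positivity) (cw_ne_top δ d)
  have hFS := hC (ℤ × ℤ) (NS ×ˢ S) (fun q => min q.2 q.1) h
    (fun q => ((measurable_an f q.2).pow_const ρ).const_mul _)
    (fun q x => ENNReal.mul_ne_top (cfin _) (ENNReal.rpow_ne_top_of_nonneg ρ0.le ENNReal.ofReal_ne_top))
  rw [epr] at hFS
  have cpow : ∀ d, (cw δ d ^ (ρ/r))^(r/ρ) = cw δ d := by
    intro d
    rw [← ENNReal.rpow_mul, show ρ/r*(r/ρ) = 1 by field_simp, ENNReal.rpow_one]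
  -- pointwise bound
  have pt : ∀ x, ∑ n ∈ NS, env ρ δ f S n x ^ r ≤ W^(r-1) * ∑ q ∈ NS ×ˢ S, Av (min q.2 q.1) (h q) x ^ (r/ρ) := by
    intro x
    rw [Finset.sum_product, Finset.mul_sum]
    apply Finset.sum_le_sum
    intro n _
    have h1 := ENNReal.inner_le_weight_mul_Lp_of_nonneg S r1 (fun i => cw δ (i-n)) (fun i => Tp ρ f i n x)
    have h2 := ENNReal.rpow_le_rpow h1 r0.le
    rw [ENNReal.mul_rpow_of_nonneg _ _ r0.le, ← ENNReal.rpow_mul, ← ENNReal.rpow_mul, inv_mul_cancel₀ r0.ne',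
      ENNReal.rpow_one, show (1 - r⁻¹)*r = r-1 by field_simp] at h2
    refine h2.trans ?_
    gcongr with i _
    · exact cw_sum_le1 δ S n
    · rw [hh]
      simp only
      rw [Av_const_mul _ (cfin _), ENNReal.mul_rpow_of_nonneg _ _ (by positivity), cpow, Tp, ← ENNReal.rpow_mul,
        show 1/ρ*r = r/ρ by ring]
  have pt2 : ∀ x, ∑ q ∈ NS ×ˢ S, h q x ^ (r/ρ) ≤ W * ∑ i ∈ S, an f i x ^ r := by
    intro x
    rw [Finset.sum_product_right, Finset.mul_sum]
    apply Finset.sum_le_sum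
    intro i _
    have : ∀ n ∈ NS, h (n,i) x ^ (r/ρ) = cw δ (i-n) * an f i x ^ r := by
      intro n _
      simp only [hh]
      rw [ENNReal.mul_rpow_of_nonneg _ _ (by positivity), cpow, ← ENNReal.rpow_mul, show ρ*(r/ρ) = r by field_simp]
    rw [Finset.sum_congr rfl this, ← Finset.sum_mul]
    gcongr
    exact cw_sum_le2 δ NS i
  have q0 : 0 ≤ p/r := by positivity
  calc ∫⁻ x, (∑ n ∈ NS, env ρ δ f S n x ^ r)^(p/r)
      ≤ ∫⁻ x, (W^(r-1))^(p/r) * (∑ q ∈ NS ×ˢ S, Av (min q.2 q.1) (h q) x ^ (r/ρ))^(p/r) := by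
        apply lintegral_mono
        intro x
        show _ ≤ _ * _
        rw [← ENNReal.mul_rpow_of_nonneg _ _ q0]
        exact ENNReal.rpow_le_rpow (pt x) q0
    _ = (W^(r-1))^(p/r) * ∫⁻ x, (∑ q ∈ NS ×ˢ S, Av (min q.2 q.1) (h q) x ^ (r/ρ))^(p/r) :=
        lintegral_const_mul' _ _ (ENNReal.rpow_ne_top_of_nonneg (by positivity) (ENNReal.rpow_ne_top_of_nonneg (by linarith) hW))
    _ ≤ (W^(r-1))^(p/r) * (C * ∫⁻ x, (∑ q ∈ NS ×ˢ S, h q x ^ (r/ρ))^(p/r)) := by gcongr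
    _ ≤ (W^(r-1))^(p/r) * (C * ∫⁻ x, W^(p/r) * (∑ i ∈ S, an f i x ^ r)^(p/r)) := by
        gcongr with x
        rw [← ENNReal.mul_rpow_of_nonneg _ _ q0]
        exact ENNReal.rpow_le_rpow (pt2 x) q0
    _ = _ := by
        rw [lintegral_const_mul' _ _ (ENNReal.rpow_ne_top_of_nonneg (by positivity) hW), hC']
        ring


/-! ## The one-sided package -/

def Xe (E : ℝ≥0) (ρ δ : ℝ) (f : ℤ → SchwartzMap ℝ ℂ) (S : Finset ℤ) (n z : ℤ) : ℝ≥0∞ :=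
  3 * E * (env ρ δ f S n (lep n z) + env ρ δ f S (n+1) (lep n z))

lemma Xe_ne_top (E : ℝ≥0) {ρ : ℝ} (hρ : 1 ≤ ρ) (δ : ℝ) (f : ℤ → SchwartzMap ℝ ℂ) (S : Finset ℤ) (n z : ℤ) :
    Xe E ρ δ f S n z ≠ ⊤ :=
  ENNReal.mul_ne_top (ENNReal.mul_ne_top (by simp) ENNReal.coe_ne_top)
    (ENNReal.add_ne_top.2 ⟨env_ne_top hρ _ _ _ _ _, env_ne_top hρ _ _ _ _ _⟩)

lemma lep_mem {n z : ℤ} {v : ℝ} (hv : v ∈ Set.Icc (lep n z) (lep n (z+1))) :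
    (2:ℝ)^n * |lep n z - v| ≤ 1 := by
  have hp : (0:ℝ) < (2:ℝ)^n := by positivity
  rw [lep_succ] at hv
  have : |lep n z - v| ≤ (2:ℝ)^(-n) := by
    rw [abs_le]; constructor <;> linarith [hv.1, hv.2, (by positivity : (0:ℝ) < (2:ℝ)^(-n))]
  calc (2:ℝ)^n * |lep n z - v| ≤ (2:ℝ)^n * (2:ℝ)^(-n) := by gcongr
    _ = 1 := by rw [zpow_neg, mul_inv_cancel₀ hp.ne']

lemma lep_sub {n z' : ℤ} {v : ℝ} (hv : v ∈ Set.Icc (lep (n+1) z') (lep (n+1) (z'+1))) :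
    v ∈ Set.Icc (lep n (z'/2)) (lep n (z'/2+1)) := by
  have hp : (0:ℝ) < (2:ℝ)^(-(n+1)) := by positivity
  rw [← lep_two n, ← lep_two n]
  unfold lep at hv ⊢
  constructor
  · refine le_trans ?_ hv.1
    gcongr
    omega
  · refine hv.2.trans ?_
    gcongr
    omega

lemma pn_mem (n : ℤ) (x : ℝ) : x ∈ Set.Icc (lep n (pn n x)) (lep n (pn n x + 1)) := by
  have : x ∈ In n (pn n x) := rfl
  rw [In_eq] at this
  unfold lep
  push_cast
  exact ⟨this.1, this.2.le⟩

lemma PP_succ (f : ℤ → SchwartzMap ℝ ℂ) (S : Finset ℤ) (n : ℤ) (x : ℝ) :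
    PP f S (n+1) x - PP f S n x = if n + 1 ∈ S then f (n+1) x else 0 := by
  unfold PP
  rw [← Finset.sum_sub_distrib]
  have : ∀ i ∈ S, ((if i ≤ n+1 then f i x else 0) - if i ≤ n then f i x else 0) = if i = n+1 then f i x else 0 := by
    intro i _
    split_ifs <;> first | omega | simp
  rw [Finset.sum_congr rfl this, Finset.sum_ite_eq']

lemma Xe_props {C E : ℝ≥0} (hE : 576 * C ≤ E) {ρ δ : ℝ} (hρ : 1 ≤ ρ) {f : ℤ → SchwartzMap ℝ ℂ} (hf : LPB C f) {S : Finset ℤ}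
    {A : ℤ → ℤ → ℂ} (hA : Appr (576 * C) ρ δ f S A) :
    (∀ n z', ‖A (n+1) z' - A n (z'/2)‖ ≤ (Xe E ρ δ f S n (z'/2)).toReal) ∧
    (∀ n x, ‖PP f S n x - A n (pn n x)‖ ≤ (Xe E ρ δ f S n (pn n x)).toReal) ∧
    (∀ n x, ‖PP f S (n+1) x - A (n+1) (pn (n+1) x)‖ ≤ (Xe E ρ δ f S n (pn n x)).toReal) ∧
    (∀ n x, ‖PP f S (n+1) x - PP f S n x‖ ≤ (Xe E ρ δ f S n (pn n x)).toReal) := by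
  have hE' : ((576 * C : ℝ≥0) : ℝ≥0∞) ≤ E := by exact_mod_cast hE
  have a1 : ∀ n z x, x ∈ Set.Icc (lep n z) (lep n (z+1)) →
      ENNReal.ofReal ‖PP f S n x - A n z‖ ≤ E * env ρ δ f S n (lep n z) := by
    intro n z x hx
    refine (hA n z (lep n z) x (fun v hv => (lep_mem hv).trans (by norm_num)) hx).trans ?_
    gcongr
  have two : ∀ n z v, v ∈ Set.Icc (lep n z) (lep n (z+1)) → (2:ℝ)^(n+1) * |lep n z - v| ≤ 2 := by
    intro n z v hv
    rw [zpow_add_one₀ (by norm_num)]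
    linarith [lep_mem hv]
  have a2 : ∀ n z' x, x ∈ Set.Icc (lep (n+1) z') (lep (n+1) (z'+1)) →
      ENNReal.ofReal ‖PP f S (n+1) x - A (n+1) z'‖ ≤ E * env ρ δ f S (n+1) (lep n (z'/2)) := by
    intro n z' x hx
    refine (hA (n+1) z' (lep n (z'/2)) x (fun v hv => two n _ v (lep_sub hv)) hx).trans ?_
    gcongr
  have a3 : ∀ n z x, x ∈ Set.Icc (lep n z) (lep n (z+1)) →
      ENNReal.ofReal ‖PP f S (n+1) x - PP f S n x‖ ≤ E * env ρ δ f S (n+1) (lep n z) := by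
    intro n z x hx
    rw [PP_succ]
    split_ifs with h
    · refine (self_est hf hρ (two n z x hx)).trans ?_
      push_cast at hE'
      gcongr
      unfold env
      refine le_trans ?_ (Finset.single_le_sum (fun i _ => zero_le) h)
      rw [sub_self, cw_zero, one_mul]
    · simp
  have fin := fun n z => Xe_ne_top E hρ δ f S n z
  have l1 : ∀ n z, (E : ℝ≥0∞) * env ρ δ f S n (lep n z) ≤ Xe E ρ δ f S n z := by
    intro n z
    unfold Xe
    calc _ ≤ (E : ℝ≥0∞) * (env ρ δ f S n (lep n z) + env ρ δ f S (n+1) (lep n z)) := by gcongr; exact le_self_add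
      _ = 1 * (E : ℝ≥0∞) * _ := by rw [one_mul]
      _ ≤ _ := by gcongr; norm_num
  have l2 : ∀ n z, (E : ℝ≥0∞) * env ρ δ f S (n+1) (lep n z) ≤ Xe E ρ δ f S n z := by
    intro n z
    unfold Xe
    calc _ ≤ (E : ℝ≥0∞) * (env ρ δ f S n (lep n z) + env ρ δ f S (n+1) (lep n z)) := by gcongr; exact le_add_self
      _ = 1 * (E : ℝ≥0∞) * _ := by rw [one_mul]
      _ ≤ _ := by gcongr; norm_num
  refine ⟨?_, ?_, ?_, ?_⟩
  · intro n z'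
    rw [← ENNReal.ofReal_le_iff_le_toReal (fin _ _)]
    set x := lep (n+1) z' with hx
    have hx1 : x ∈ Set.Icc (lep (n+1) z') (lep (n+1) (z'+1)) := ⟨le_rfl, lep_le _ _⟩
    have hx2 := lep_sub hx1
    have e : A (n+1) z' - A n (z'/2) = (PP f S n x - A n (z'/2)) + (PP f S (n+1) x - PP f S n x) - (PP f S (n+1) x - A (n+1) z') := by ring
    rw [e]
    calc _ ≤ ENNReal.ofReal (‖PP f S n x - A n (z'/2)‖ + ‖PP f S (n+1) x - PP f S n x‖ + ‖PP f S (n+1) x - A (n+1) z'‖) := by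
          apply ENNReal.ofReal_le_ofReal
          exact (norm_sub_le _ _).trans (by gcongr; exact norm_add_le _ _)
      _ = ENNReal.ofReal ‖PP f S n x - A n (z'/2)‖ + ENNReal.ofReal ‖PP f S (n+1) x - PP f S n x‖ + ENNReal.ofReal ‖PP f S (n+1) x - A (n+1) z'‖ := by
          rw [ENNReal.ofReal_add (by positivity) (by positivity), ENNReal.ofReal_add (by positivity) (by positivity)]
      _ ≤ E * env ρ δ f S n (lep n (z'/2)) + E * env ρ δ f S (n+1) (lep n (z'/2)) + E * env ρ δ f S (n+1) (lep n (z'/2)) := by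
          gcongr
          · exact a1 _ _ _ hx2
          · exact a3 _ _ _ hx2
          · exact a2 _ _ _ hx1
      _ = E * (1 * env ρ δ f S n (lep n (z'/2)) + 2 * env ρ δ f S (n+1) (lep n (z'/2))) := by ring
      _ ≤ E * (3 * env ρ δ f S n (lep n (z'/2)) + 3 * env ρ δ f S (n+1) (lep n (z'/2))) := by
          gcongr <;> norm_num
      _ = _ := by unfold Xe; ring
  · intro n x
    rw [← ENNReal.ofReal_le_iff_le_toReal (fin _ _)]
    exact (a1 n _ x (pn_mem n x)).trans (l1 _ _)
  · intro n x
    rw [← ENNReal.ofReal_le_iff_le_toReal (fin _ _)]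
    have := a2 n _ x (pn_mem (n+1) x)
    rw [pn_half] at this
    exact this.trans (l2 _ _)
  · intro n x
    rw [← ENNReal.ofReal_le_iff_le_toReal (fin _ _)]
    exact (a3 n _ x (pn_mem n x)).trans (l2 _ _)

lemma Xe_le (E : ℝ≥0) {ρ : ℝ} (hρ : 1 ≤ ρ) (δ : ℝ) (f : ℤ → SchwartzMap ℝ ℂ) (S : Finset ℤ) (n : ℤ) (x : ℝ) :
    Xe E ρ δ f S n (pn n x) ≤ 27 * E * (env ρ δ f S n x + env ρ δ f S (n+1) x) := by
  have h := lep_mem (pn_mem n x)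
  rw [abs_sub_comm] at h
  unfold Xe
  calc _ ≤ 3 * (E:ℝ≥0∞) * (9 * env ρ δ f S n x + 9 * env ρ δ f S (n+1) x) := by
        gcongr
        · exact env_comp hρ δ f S n (by linarith)
        · exact env_comp hρ δ f S (n+1) (by rw [zpow_add_one₀ (by norm_num)]; linarith)
    _ = _ := by ring

lemma Xe_Lp {p r ρ δ : ℝ} (hρ : 1 ≤ ρ) (hp : ρ < p) (hr : ρ ≤ r) (hδ : 0 < δ) (E : ℝ≥0) : ∃ C : ℝ≥0,
    ∀ (f : ℤ → SchwartzMap ℝ ℂ) (S NS : Finset ℤ),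
      ∫⁻ x, (∑ n ∈ NS, Xe E ρ δ f S n (pn n x) ^ r)^(p/r) ≤ C * ∫⁻ x, (∑ i ∈ S, an f i x ^ r)^(p/r) := by
  obtain ⟨C, hC⟩ := env_Lp hρ hp hr hδ
  have r1 : 1 ≤ r := by linarith
  have r0 : 0 < r := by linarith
  have p0 : 0 < p := by linarith
  have q0 : 0 ≤ p/r := by positivity
  set c : ℝ≥0∞ := (27 * (E:ℝ≥0∞))^r * 2^(r-1) * 2 with hc
  have cfin : c ≠ ⊤ := by
    refine ENNReal.mul_ne_top (ENNReal.mul_ne_top ?_ ?_) (by simp)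
    · exact ENNReal.rpow_ne_top_of_nonneg r0.le (ENNReal.mul_ne_top (by simp) ENNReal.coe_ne_top)
    · exact ENNReal.rpow_ne_top_of_nonneg (by linarith) (by simp)
  have cfin' : c^(p/r) ≠ ⊤ := ENNReal.rpow_ne_top_of_nonneg q0 cfin
  refine ⟨(c^(p/r)).toNNReal * C, ?_⟩
  intro f S NS
  classical
  set NS' := NS ∪ NS.image (· + 1) with hNS
  have pt : ∀ x, ∑ n ∈ NS, Xe E ρ δ f S n (pn n x) ^ r ≤ c * ∑ n ∈ NS', env ρ δ f S n x ^ r := by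
    intro x
    have s1 : ∑ n ∈ NS, env ρ δ f S n x ^ r ≤ ∑ n ∈ NS', env ρ δ f S n x ^ r :=
      Finset.sum_le_sum_of_subset Finset.subset_union_left
    have s2 : ∑ n ∈ NS, env ρ δ f S (n+1) x ^ r ≤ ∑ n ∈ NS', env ρ δ f S n x ^ r := by
      calc _ = ∑ n ∈ NS.image (· + 1), env ρ δ f S n x ^ r := by
            rw [Finset.sum_image (by intro a _ b _ h; simpa using h)]
        _ ≤ _ := Finset.sum_le_sum_of_subset Finset.subset_union_right
    calc _ ≤ ∑ n ∈ NS, (27 * (E:ℝ≥0∞))^r * (2^(r-1) * (env ρ δ f S n x ^ r + env ρ δ f S (n+1) x ^ r)) := by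
          apply Finset.sum_le_sum
          intro n _
          refine (ENNReal.rpow_le_rpow (Xe_le E hρ δ f S n x) r0.le).trans ?_
          rw [ENNReal.mul_rpow_of_nonneg _ _ r0.le]
          gcongr
          exact ENNReal.rpow_add_le_mul_rpow_add_rpow _ _ r1
      _ = (27 * (E:ℝ≥0∞))^r * (2^(r-1) * (∑ n ∈ NS, env ρ δ f S n x ^ r + ∑ n ∈ NS, env ρ δ f S (n+1) x ^ r)) := by
          rw [← Finset.mul_sum, ← Finset.mul_sum, Finset.sum_add_distrib]
      _ ≤ (27 * (E:ℝ≥0∞))^r * (2^(r-1) * (∑ n ∈ NS', env ρ δ f S n x ^ r + ∑ n ∈ NS', env ρ δ f S n x ^ r)) := by gcongr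
      _ = _ := by rw [hc]; ring
  calc _ ≤ ∫⁻ x, c^(p/r) * (∑ n ∈ NS', env ρ δ f S n x ^ r)^(p/r) := by
        apply lintegral_mono
        intro x
        show _ ≤ _ * _
        rw [← ENNReal.mul_rpow_of_nonneg _ _ q0]
        exact ENNReal.rpow_le_rpow (pt x) q0
    _ = c^(p/r) * ∫⁻ x, (∑ n ∈ NS', env ρ δ f S n x ^ r)^(p/r) := lintegral_const_mul' _ _ cfin'
    _ ≤ c^(p/r) * (C * ∫⁻ x, (∑ i ∈ S, an f i x ^ r)^(p/r)) := by gcongr; exact hC f S NS'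
    _ = _ := by
        push_cast
        rw [ENNReal.coe_toNNReal cfin', mul_assoc]

lemma side {p r Nb : ℝ} (hp : 1 < p) (hr : 1 ≤ r) : ∃ C : ℝ≥0, ∀ f : ℤ → SchwartzMap ℝ ℂ, IsContLPFamily Nb f →
    ∀ S : Finset ℤ, (∃ i ∈ S, f i ≠ 0) → ∃ (A : ℤ → ℤ → ℂ) (X : ℤ → ℤ → ℝ),
      (∀ n z, 0 < X n z) ∧ ((∀ n z, A (n+1) (2*z) + A (n+1) (2*z+1) = 2 * A n z) ∨ r = 1) ∧
      (∀ n z', ‖A (n+1) z' - A n (z'/2)‖ ≤ X n (z'/2)) ∧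
      (∀ n x, ‖PP f S n x - A n (pn n x)‖ ≤ X n (pn n x)) ∧
      (∀ n x, ‖PP f S (n+1) x - A (n+1) (pn (n+1) x)‖ ≤ X n (pn n x)) ∧
      (∀ n x, ‖PP f S (n+1) x - PP f S n x‖ ≤ X n (pn n x)) ∧
      ∀ NS : Finset ℤ, ∫⁻ x, (∑ n ∈ NS, ENNReal.ofReal (X n (pn n x)) ^ r)^(p/r) ≤
        C * ∫⁻ x, (∑ i ∈ S, an f i x ^ r)^(p/r) := by
  obtain ⟨C, hC⟩ := LPi Nb
  set E : ℝ≥0 := 576 * C + 1 with hE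
  have main : ∀ ρ δ : ℝ, 1 ≤ ρ → ρ < p → ρ ≤ r → 0 < δ → 
      ∃ C' : ℝ≥0, ∀ f : ℤ → SchwartzMap ℝ ℂ, IsContLPFamily Nb f →
        ∀ S : Finset ℤ, (∃ i ∈ S, f i ≠ 0) → ∀ A : ℤ → ℤ → ℂ, (LPB C f → Appr (576 * C) ρ δ f S A) → 
        ((∀ n z, A (n+1) (2*z) + A (n+1) (2*z+1) = 2 * A n z) ∨ r = 1) → ∃ (A : ℤ → ℤ → ℂ) (X : ℤ → ℤ → ℝ),
      (∀ n z, 0 < X n z) ∧ ((∀ n z, A (n+1) (2*z) + A (n+1) (2*z+1) = 2 * A n z) ∨ r = 1) ∧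
      (∀ n z', ‖A (n+1) z' - A n (z'/2)‖ ≤ X n (z'/2)) ∧
      (∀ n x, ‖PP f S n x - A n (pn n x)‖ ≤ X n (pn n x)) ∧
      (∀ n x, ‖PP f S (n+1) x - A (n+1) (pn (n+1) x)‖ ≤ X n (pn n x)) ∧
      (∀ n x, ‖PP f S (n+1) x - PP f S n x‖ ≤ X n (pn n x)) ∧
      ∀ NS : Finset ℤ, ∫⁻ x, (∑ n ∈ NS, ENNReal.ofReal (X n (pn n x)) ^ r)^(p/r) ≤
        C' * ∫⁻ x, (∑ i ∈ S, an f i x ^ r)^(p/r) := by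
    intro ρ δ hρ hρp hρr hδ
    obtain ⟨C', hC'⟩ := Xe_Lp hρ hρp hρr hδ E
    refine ⟨C', ?_⟩
    intro f hf S hS A hA hm
    have hfB : LPB C f := hC f hf
    obtain ⟨h1, h2, h3, h4⟩ := Xe_props (E := E) (by rw [hE]; exact le_self_add) hρ hfB (hA hfB)
    refine ⟨A, fun n z => (Xe E ρ δ f S n z).toReal, ?_, hm, h1, h2, h3, h4, ?_⟩
    · intro n z
      obtain ⟨i, hiS, hi⟩ := hS
      apply ENNReal.toReal_pos _ (Xe_ne_top E hρ δ f S n z)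
      unfold Xe
      have e1 : env ρ δ f S n (lep n z) ≠ 0 := env_ne_zero hρ δ f S n _ hiS hi
      have e2 : (E:ℝ≥0∞) ≠ 0 := by
        have : 0 < E := by rw [hE]; positivity
        exact_mod_cast this.ne'
      refine mul_ne_zero (mul_ne_zero (by simp) e2) ?_
      intro h
      exact e1 (add_eq_zero.1 h).1
    · intro NS
      refine le_trans (le_of_eq ?_) (hC' f S NS)
      simp only [ENNReal.ofReal_toReal (Xe_ne_top E hρ δ f S _ _)]
  rcases eq_or_lt_of_le hr with h1 | h1
  · obtain ⟨C', hC'⟩ := main 1 1 le_rfl hp hr one_pos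
    exact ⟨C', fun f hf S hS => hC' f hf S hS (AS f S) (fun hb => AS_appr hb le_rfl le_rfl S) (Or.inr h1.symm)⟩
  · obtain ⟨ρ, hρ1, hρ2⟩ := exists_between (lt_min hp h1)
    have hρ0 : 0 < ρ := by linarith
    have hd : 0 < 1 - 1/ρ := by
      have : 1/ρ < 1 := by rw [div_lt_one hρ0]; exact hρ1
      linarith
    obtain ⟨C', hC'⟩ := main ρ (1-1/ρ) hρ1.le (hρ2.trans_le (min_le_left _ _)) (hρ2.le.trans (min_le_right _ _)) hd
    exact ⟨C', fun f hf S hS => hC' f hf S hS (AM f S) (fun hb => AM_appr hb hρ1.le le_rfl S) (Or.inl (AM_mart f S))⟩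


/-! ## Assembly -/

lemma PP_diff (f : ℤ → SchwartzMap ℝ ℂ) (n0 : ℤ) (K : ℕ) (x : ℝ) {m n : ℕ} (hmn : m ≤ n) (hn : n ≤ K) :
    PP f (Finset.Icc (n0+1) (n0+K)) (n0+n) x - PP f (Finset.Icc (n0+1) (n0+K)) (n0+m) x
      = ∑ i ∈ Finset.Ioc (n0+m) (n0+n), f i x := by
  induction n, hmn using Nat.le_induction with
  | base => simp
  | succ n hmn ih =>
    have h1 := PP_succ f (Finset.Icc (n0+1) (n0+K)) (n0+n) x
    rw [if_pos (by rw [Finset.mem_Icc]; omega)] at h1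
    have h2 : Finset.Ioc (n0+m) (n0+((n+1:ℕ):ℤ)) = insert (n0+n+1) (Finset.Ioc (n0+m) (n0+n)) := by
      ext i; simp only [Finset.mem_Ioc, Finset.mem_insert]; push_cast; omega
    rw [h2, Finset.sum_insert (by simp), ← ih (by omega), ← h1]
    push_cast
    rw [← add_assoc]; ring

lemma jump_eq (f g : ℤ → SchwartzMap ℝ ℂ) (n0 : ℤ) (K : ℕ) (x : ℝ) {m n : ℕ} (hmn : m ≤ n) (hn : n ≤ K) :
    ∑ j ∈ Finset.Ioc (n0+m) (n0+n), ∑ i ∈ Finset.Ioo (n0+m) j, f i x * g j x =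
      Mq (fun i => PP f (Finset.Icc (n0+1) (n0+K)) (n0+i) x) (fun i => PP g (Finset.Icc (n0+1) (n0+K)) (n0+i) x) m n := by
  induction n, hmn using Nat.le_induction with
  | base => simp [Mq]
  | succ n hmn ih =>
    have h2 : Finset.Ioc (n0+m) (n0+((n+1:ℕ):ℤ)) = insert (n0+n+1) (Finset.Ioc (n0+m) (n0+n)) := by
      ext i; simp only [Finset.mem_Ioc, Finset.mem_insert]; push_cast; omega
    have h3 : Finset.Ioo (n0+m) (n0+n+1) = Finset.Ioc (n0+m) (n0+n) := by
      ext i; simp only [Finset.mem_Ioc, Finset.mem_Ioo]; omega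
    rw [h2, Finset.sum_insert (by simp), ih (by omega)]
    have h4 := PP_diff f n0 K x hmn (by omega)
    have h5 := PP_diff g n0 K x (Nat.le_succ n) hn
    have h6 : Finset.Ioc (n0+n) (n0+((n+1:ℕ):ℤ)) = {n0+(n:ℤ)+1} := by
      ext i; simp only [Finset.mem_Ioc, Finset.mem_singleton]; push_cast; omega
    simp only [Nat.succ_eq_add_one] at h5
    rw [h6, Finset.sum_singleton] at h5
    unfold Mq
    rw [Finset.sum_Ico_succ_top hmn, h4, h5, h3, Finset.sum_mul, add_comm]

lemma trunc_le_mixed {p r : ℝ} (hp : 1 < p) (hr : 1 ≤ r) (f : ℤ → SchwartzMap ℝ ℂ) (S : Finset ℤ) :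
    (∫⁻ x, (∑ i ∈ S, an f i x ^ r)^(p/r))^(1/p) ≤ mixedNorm p r f := by
  unfold mixedNorm
  refine ENNReal.rpow_le_rpow (lintegral_mono fun x => ?_) (by positivity)
  rw [← ENNReal.rpow_mul, one_div_mul_eq_div]
  exact ENNReal.rpow_le_rpow (ENNReal.sum_le_tsum S) (by positivity)

lemma alf_norm (D : TD) {p : ℝ} (hp : 1 < p) (X' : ℤ → ℤ → ℝ) (n0 : ℤ) (hDX : ∀ n z, D.X n z = X' (n0+n) z) (K : ℕ)
    (f : ℤ → SchwartzMap ℝ ℂ) (S : Finset ℤ) (C : ℝ≥0)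
    (hb : ∀ NS : Finset ℤ, ∫⁻ x, (∑ n ∈ NS, ENNReal.ofReal (X' n (pn n x)) ^ D.r)^(p/D.r) ≤
        C * ∫⁻ x, (∑ i ∈ S, an f i x ^ D.r)^(p/D.r)) :
    (∫⁻ x, ENNReal.ofReal (D.alf K (pn (n0+K) x)) ^ p)^(1/p) ≤ (C:ℝ≥0∞)^(1/p) * mixedNorm p D.r f := by
  have hr := D.hr1
  have hp0 : 0 < p := by linarith
  refine le_trans ?_ (mul_le_mul_right (trunc_le_mixed hp hr f S) _)
  rw [← ENNReal.mul_rpow_of_nonneg _ _ (by positivity)]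
  refine ENNReal.rpow_le_rpow (le_trans (le_of_eq ?_) (hb ((Finset.range (K+1)).image fun n : ℕ => n0 + n))) (by positivity)
  refine lintegral_congr fun x => ?_
  rw [Finset.sum_image (by intro a _ b _ h; simpa using h)]
  unfold TD.alf TD.sX
  rw [← ENNReal.ofReal_rpow_of_nonneg (Finset.sum_nonneg fun i _ => (Real.rpow_pos_of_pos (D.hX _ _) _).le) (by positivity),
    ENNReal.ofReal_sum_of_nonneg (fun i _ => (Real.rpow_pos_of_pos (D.hX _ _) _).le), ← ENNReal.rpow_mul, one_div_mul_eq_div]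
  congr 1
  rw [show Finset.Icc 0 K = Finset.range (K+1) by ext i; simp]
  refine Finset.sum_congr rfl fun i hi => ?_
  have hi' : i ≤ K := by simpa [Nat.lt_succ_iff] using hi
  rw [← ENNReal.ofReal_rpow_of_nonneg (D.hX _ _).le (by positivity), hDX,
    show n0 + (K:ℤ) = n0 + i + ((K-i : ℕ):ℤ) by push_cast [hi']; ring, pn_div]

open Classical in
lemma SS_alf_norm {p : ℝ} (hp : 1 < p) : ∃ C0' : ℝ≥0, ∀ (D : TD) (X' : ℤ → ℤ → ℝ) (n0 : ℤ) (_ : ∀ n z, D.X n z = X' (n0+n) z) (K : ℕ)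
    (st : ℕ → ℤ → Prop) (_ : ∀ m ζ, m ≤ K → st m ζ → E1^[K-m] (fun w => if later K st m w then (1:ℝ) else 0) ζ ≤ 1/2)
    (f : ℤ → SchwartzMap ℝ ℂ) (S : Finset ℤ) (C : ℝ≥0)
    (_ : ∀ NS : Finset ℤ, ∫⁻ x, (∑ n ∈ NS, ENNReal.ofReal (X' n (pn n x)) ^ D.r)^(p/D.r) ≤
        C * ∫⁻ x, (∑ i ∈ S, an f i x ^ D.r)^(p/D.r)),
    (∫⁻ x, ENNReal.ofReal (SS K st (D.alf K) (pn (n0+K) x)) ^ p)^(1/p) ≤ C0' * ((C:ℝ≥0∞)^(1/p) * mixedNorm p D.r f) := by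
  obtain ⟨C, hC⟩ := sparse_Lp p hp
  refine ⟨C, fun D X' n0 hDX K st hst f S C' hb => ?_⟩
  exact (hC K n0 st (D.alf K) (fun z => (D.alf_pos K z).le) hst).trans
    (mul_le_mul_right (alf_norm D hp X' n0 hDX K f S C' hb) _)

lemma real_tree {lam t M : ℝ} {a : ℕ} (hl : 0 < lam) (ht : 1/2 ≤ t) (hc : 0 ≤ M) 
    (h : (a:ℝ) ≤ 2 * (M / lam)^t) : ENNReal.ofReal lam * (a:ℝ≥0∞)^(1/t) ≤ ENNReal.ofReal (4 * M) := by
  have ht0 : 0 < t := by linarith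
  rw [← ENNReal.ofReal_natCast a, ENNReal.ofReal_rpow_of_nonneg (by positivity) (by positivity), ← ENNReal.ofReal_mul hl.le]
  apply ENNReal.ofReal_le_ofReal
  have h1 : (a:ℝ)^(1/t) ≤ (2 * (M / lam)^t)^(1/t) := Real.rpow_le_rpow (by positivity) h (by positivity)
  have hM : 0 ≤ M / lam := by positivity
  rw [Real.mul_rpow (by norm_num) (by positivity), ← Real.rpow_mul hM, mul_one_div_cancel ht0.ne', Real.rpow_one] at h1
  have h2 : (2:ℝ)^(1/t) ≤ 4 := by
    calc (2:ℝ)^(1/t) ≤ (2:ℝ)^(2:ℝ) := by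
          apply Real.rpow_le_rpow_of_exponent_le (by norm_num)
          rw [div_le_iff₀ ht0]; linarith
      _ = 4 := by norm_num
  calc lam * (a:ℝ)^(1/t) ≤ lam * (4 * (M/lam)) := by
        gcongr
        exact h1.trans (by gcongr)
    _ = 4 * M := by field_simp


open Classical in
lemma tree_SS (D : TD) {K : ℕ} {lam : ℝ} (hl : 0 < lam) (z : ℤ) (N : ℕ → ℕ) (hN : Monotone N) (hNK : ∀ k, N k ≤ K)
    (S : Finset ℕ) (hS : ∀ k ∈ S, N k < N (k+1) ∧ lam < Tq (fun i => D.A i (z / 2^(K-i))) (fun i => D.B i (z / 2^(K-i)))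
      (fun i => D.X i (z / 2^(K-i))) (fun i => D.Y i (z / 2^(K-i))) (N k) (N (k+1))) :
    ENNReal.ofReal lam * (S.card:ℝ≥0∞)^(1/D.t) ≤ ENNReal.ofReal (64 * TD.C0) *
      (ENNReal.ofReal (SS K (fun i z => D.sig K lam i z = i) (D.alf K) z) *
       ENNReal.ofReal (SS K (fun i z => D.sig K lam i z = i) (D.bet K) z)) := by
  have h := D.tree_main hl z N hN hNK S hS
  set SA := SS K (fun i z => D.sig K lam i z = i) (D.alf K) z with hSA
  set SB := SS K (fun i z => D.sig K lam i z = i) (D.bet K) z with hSB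
  have eA : (∑ i ∈ (Finset.range (K+1)).filter (fun i => D.sig K lam i (z / 2^(K-i)) = i), D.aa K i (z / 2^(K-i))) = SA := by
    rw [hSA]; unfold SS TD.aa; congr!
  have eB : (∑ i ∈ (Finset.range (K+1)).filter (fun i => D.sig K lam i (z / 2^(K-i)) = i), D.bb K i (z / 2^(K-i))) = SB := by
    rw [hSB]; unfold SS TD.bb; congr!
  rw [eA, eB] at h
  have a0 : 0 ≤ SA := by rw [← eA]; exact Finset.sum_nonneg fun i hi => (D.aa_pos (by simp at hi; omega) _).le
  have b0 : 0 ≤ SB := by rw [← eB]; exact Finset.sum_nonneg fun i hi => (D.bb_pos (by simp at hi; omega) _).le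
  have c0 : 0 ≤ TD.C0 := by unfold TD.C0; norm_num
  refine (real_tree hl D.t_ge (by positivity) h).trans (le_of_eq ?_)
  rw [← ENNReal.ofReal_mul a0, ← ENNReal.ofReal_mul (by positivity)]
  congr 1; ring

open Classical in
lemma level (p q r s Nb : ℝ) (hp : 1 < p) (hq : 1 < q)
    (hr1 : 1 ≤ r) (hr2 : r ≤ 2) (hs1 : 1 ≤ s) (hs2 : s ≤ 2) :
    ∃ C : ℝ≥0, ∀ (f g : ℤ → SchwartzMap ℝ ℂ), IsContLPFamily Nb f → IsContLPFamily Nb g →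
      ∀ (n0 : ℤ) (K : ℕ) (lam : ℝ), 0 < lam → ∃ H : ℝ → ℝ≥0∞, Measurable H ∧
        (∫⁻ x, H x ^ (p*q/(p+q)))^((p+q)/(p*q)) ≤ C * mixedNorm p r f * mixedNorm q s g ∧
        ∀ (x : ℝ) (N : ℕ → ℤ), Monotone N → ∀ S : Finset ℕ,
          (∀ k ∈ S, n0 ≤ N k ∧ N (k+1) ≤ n0 + K ∧
            lam < ‖∑ j ∈ Finset.Ioc (N k) (N (k + 1)), ∑ i ∈ Finset.Ioo (N k) j, f i x * g j x‖) →
          ENNReal.ofReal lam * (S.card:ℝ≥0∞)^(1/(r*s/(r+s))) ≤ H x := by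
  obtain ⟨C1, hC1⟩ := side (Nb := Nb) hp hr1
  obtain ⟨C2, hC2⟩ := side (Nb := Nb) hq hs1
  obtain ⟨C3, hC3⟩ := SS_alf_norm hp
  obtain ⟨C4, hC4⟩ := SS_alf_norm hq
  have hp0 : 0 < p := by linarith
  have hq0 : 0 < q := by linarith
  have hu0 : 0 < p*q/(p+q) := by positivity
  have ht0 : 0 < r*s/(r+s) := by
    have : 0 < r := by linarith
    have : 0 < s := by linarith
    positivity
  refine ⟨Real.toNNReal (64 * TD.C0) * (C3 * C1^(1/p)) * (C4 * C2^(1/q)), fun f g hf hg n0 K lam hl => ?_⟩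
  set S := Finset.Icc (n0+1) (n0+K) with hSdef
  by_cases hz : (∃ i ∈ S, f i ≠ 0) ∧ (∃ i ∈ S, g i ≠ 0)
  swap
  · refine ⟨fun _ => 0, measurable_const, ?_, ?_⟩
    · simp only [ENNReal.zero_rpow_of_pos hu0, lintegral_zero]
      rw [ENNReal.zero_rpow_of_pos (by positivity)]; exact zero_le
    · intro x N hN T hT
      have : T = ∅ := by
        rw [Finset.eq_empty_iff_forall_notMem]
        intro k hk
        obtain ⟨h1, h2, h3⟩ := hT k hk
        have : ∑ j ∈ Finset.Ioc (N k) (N (k + 1)), ∑ i ∈ Finset.Ioo (N k) j, f i x * g j x = 0 := by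
          refine Finset.sum_eq_zero fun j hj => Finset.sum_eq_zero fun i hi => ?_
          simp only [Finset.mem_Ioc, Finset.mem_Ioo] at hi hj
          rw [not_and_or] at hz
          rcases hz with hz | hz
          · push Not at hz
            rw [hz i (by rw [hSdef, Finset.mem_Icc]; omega)]; simp
          · push Not at hz
            rw [hz j (by rw [hSdef, Finset.mem_Icc]; omega)]; simp
        rw [this, norm_zero] at h3
        linarith
      rw [this]
      simp only [Finset.card_empty, Nat.cast_zero]
      rw [ENNReal.zero_rpow_of_pos (by positivity), mul_zero]
  obtain ⟨A, X, hX, mA, hA, hu, hu', hPu, hbA⟩ := hC1 f hf S hz.1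
  obtain ⟨B, Y, hY, mB, hB, hv, hv', hPv, hbB⟩ := hC2 g hg S hz.2
  let D : TD :=
    { A := fun n z => A (n0+n) z
      B := fun n z => B (n0+n) z
      X := fun n z => X (n0+n) z
      Y := fun n z => Y (n0+n) z
      r := r
      s := s
      hr1 := hr1
      hr2 := hr2
      hs1 := hs1
      hs2 := hs2
      hX := fun n z => hX _ _
      hY := fun n z => hY _ _
      hA := fun n z => by
        have := hA (n0+n) z
        rw [add_assoc] at this
        exact_mod_cast this
      hB := fun n z => by
        have := hB (n0+n) z
        rw [add_assoc] at this
        exact_mod_cast this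
      mA := mA.imp_left fun h n z => by
        have := h (n0+n) z
        rw [add_assoc] at this
        exact_mod_cast this
      mB := mB.imp_left fun h n z => by
        have := h (n0+n) z
        rw [add_assoc] at this
        exact_mod_cast this }
  set st : ℕ → ℤ → Prop := fun i z => D.sig K lam i z = i with hst
  set F1 : ℝ → ℝ≥0∞ := fun x => ENNReal.ofReal (SS K st (D.alf K) (pn (n0+K) x)) with hF1
  set F2 : ℝ → ℝ≥0∞ := fun x => ENNReal.ofReal (SS K st (D.bet K) (pn (n0+K) x)) with hF2
  have mF1 : Measurable F1 := ENNReal.measurable_ofReal.comp ((measurable_from_top (f := SS K st (D.alf K))).comp (measurable_pn _))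
  have mF2 : Measurable F2 := ENNReal.measurable_ofReal.comp ((measurable_from_top (f := SS K st (D.bet K))).comp (measurable_pn _))
  have hsp : ∀ m ζ, m ≤ K → st m ζ → E1^[K-m] (fun w => if later K st m w then (1:ℝ) else 0) ζ ≤ 1/2 := by
    intro m ζ hm h
    have := D.sparse (lam := lam) hm ζ h
    unfold later
    convert this
  have n1 : (∫⁻ x, F1 x ^ p)^(1/p) ≤ C3 * ((C1:ℝ≥0∞)^(1/p) * mixedNorm p r f) :=
    hC3 D X n0 (fun _ _ => rfl) K st hsp f S C1 hbA
  have n2 : (∫⁻ x, F2 x ^ q)^(1/q) ≤ C4 * ((C2:ℝ≥0∞)^(1/q) * mixedNorm q s g) :=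
    hC4 D.flip Y n0 (fun _ _ => rfl) K st hsp g S C2 hbB
  have hol := ENNReal.lintegral_Lp_mul_le_Lq_mul_Lr hu0 (q := p) (r := q)
    (by rw [div_lt_iff₀ (by positivity)]; nlinarith) (by field_simp; ring) volume mF1.aemeasurable mF2.aemeasurable
  refine ⟨fun x => ENNReal.ofReal (64 * TD.C0) * (F1 x * F2 x), (mF1.mul mF2).const_mul _, ?_, ?_⟩
  · simp only [ENNReal.mul_rpow_of_nonneg _ _ hu0.le]
    rw [lintegral_const_mul _ (by fun_prop), ENNReal.mul_rpow_of_nonneg _ _ (by positivity), ← ENNReal.rpow_mul]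
    rw [show p*q/(p+q) * ((p+q)/(p*q)) = 1 by field_simp, ENNReal.rpow_one]
    simp only [Pi.mul_apply, ENNReal.mul_rpow_of_nonneg _ _ hu0.le, one_div_div] at hol
    refine (mul_le_mul_right (hol.trans (mul_le_mul' n1 n2)) _).trans (le_of_eq ?_)
    push_cast
    rw [ENNReal.coe_rpow_of_nonneg _ (by positivity), ENNReal.coe_rpow_of_nonneg _ (by positivity)]
    rw [show ((Real.toNNReal (64 * TD.C0) : ℝ≥0) : ℝ≥0∞) = ENNReal.ofReal (64 * TD.C0) from rfl]
    ring
  · intro x N hN T hT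
    have path : ∀ i : ℕ, i ≤ K → pn (n0+K) x / 2^(K-i) = pn (n0+i) x := by
      intro i hi
      rw [show n0 + (K:ℤ) = n0 + i + ((K-i : ℕ):ℤ) by push_cast [hi]; ring, pn_div]
    refine tree_SS D hl (pn (n0+K) x) (fun k => (min (N k) (n0+K) - n0).toNat) ?_ ?_ T ?_
    · intro a b hab
      have := hN hab
      simp only; omega
    · intro k; omega
    · intro k hk
      obtain ⟨h1, h2, h3⟩ := hT k hk
      have h4 := hN (Nat.le_succ k)
      simp only [Nat.succ_eq_add_one] at h4
      obtain ⟨m, hm⟩ : ∃ m : ℕ, N k = n0 + m := ⟨(N k - n0).toNat, by omega⟩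
      obtain ⟨n, hn⟩ : ∃ m : ℕ, N (k+1) = n0 + m := ⟨(N (k+1) - n0).toNat, by omega⟩
      rw [show (min (N k) (n0+K) - n0).toNat = m by omega, show (min (N (k+1)) (n0+K) - n0).toNat = n by omega]
      rw [hm, hn] at h3 h4
      rw [hn] at h2
      rw [jump_eq f g n0 K x (by omega) (by omega)] at h3
      have hmn : m < n := by
        by_contra hcon
        have : m = n := by omega
        subst this
        simp [Mq] at h3
        linarith
      refine ⟨hmn, h3.trans_le ?_⟩
      have hK : n ≤ K := by omega
      have c1 : ∀ j : ℕ, n0 + ((j+1 : ℕ) : ℤ) = n0 + j + 1 := by intro j; push_cast; ring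
      apply Mq_le_Tq _ _ _ _ _ _ hmn
      · intro j hj
        rw [path j (by omega)]
        exact hu _ x
      · intro j hj
        rw [path j (by omega), path (j+1) (by omega)]
        change ‖PP f S (n0 + ((j+1:ℕ):ℤ)) x - A (n0 + ((j+1:ℕ):ℤ)) (pn (n0 + ((j+1:ℕ):ℤ)) x)‖ ≤ _
        rw [c1]
        exact hu' _ x
      · intro j hj
        rw [path j (by omega)]
        change ‖PP f S (n0 + ((j+1:ℕ):ℤ)) x - PP f S (n0 + (j:ℤ)) x‖ ≤ _
        rw [c1]
        exact hPu _ x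
      · intro j hj
        rw [path j (by omega), path (j+1) (by omega)]
        have := D.hB j (pn (n0 + ((j+1:ℕ):ℤ)) x)
        rw [c1, pn_half, ← c1] at this
        exact this
      · intro j hj
        rw [path j (by omega), path (j+1) (by omega)]
        change ‖PP g S (n0 + ((j+1:ℕ):ℤ)) x - B (n0 + ((j+1:ℕ):ℤ)) (pn (n0 + ((j+1:ℕ):ℤ)) x)‖ ≤ _
        rw [c1]
        exact hv' _ x


/-- Weak-type (jump counting) bilinear variational paraproduct estimate at the endpoint
`max(r,s) = 2`, `t = rs/(r+s)`, continuous case. -/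
theorem bilinear_weak_jump_paraproduct_continuous
    (p q r s t Nb : ℝ) (hp : 1 < p) (hq : 1 < q)
    (hr1 : 1 ≤ r) (hr2 : r ≤ 2) (hs1 : 1 ≤ s) (hs2 : s ≤ 2)
    (hmax : max r s = 2) (ht : t = r * s / (r + s)) (hNb : 0 < Nb) :
    ∃ C : ℝ≥0, 0 < C ∧
      ∀ (f g : ℤ → SchwartzMap ℝ ℂ), IsContLPFamily Nb f → IsContLPFamily Nb g →
      ∀ (Nk : ℕ → ℝ → ℤ), IsJumpCollection Nk →
      ∀ lam : ℝ, 0 < lam →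
      (∫⁻ x : ℝ,
          (ENNReal.ofReal lam *
            (({k : ℕ | lam < ‖
                (∑ j ∈ Finset.Ioc (Nk k x) (Nk (k + 1) x),
                  ∑ i ∈ Finset.Ioo (Nk k x) j, f i x * g j x)‖}.encard : ℝ≥0∞))
              ^ (1 / t)) ^ (p * q / (p + q))) ^ ((p + q) / (p * q))
        ≤ (C : ℝ≥0∞) * mixedNorm p r f * mixedNorm q s g := by
  obtain ⟨C, hC⟩ := level p q r s Nb hp hq hr1 hr2 hs1 hs2
  refine ⟨C + 1, by positivity, fun f g hf hg Nk hNk lam hl => ?_⟩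
  have hp0 : 0 < p := by linarith
  have hq0 : 0 < q := by linarith
  have hu0 : 0 < p*q/(p+q) := by positivity
  have hv0 : 0 < (p+q)/(p*q) := by positivity
  have huv : (p+q)/(p*q) * (p*q/(p+q)) = 1 := by field_simp
  rw [← ht] at hC
  have ht0 : 0 < t := by
    have : 0 < r := by linarith
    have : 0 < s := by linarith
    rw [ht]; positivity
  choose H mH nH bH using fun J : ℕ => hC f g hf hg (-(J:ℤ)) (2*J) lam hl
  have point : ∀ x, (ENNReal.ofReal lam *
            (({k : ℕ | lam < ‖
                (∑ j ∈ Finset.Ioc (Nk k x) (Nk (k + 1) x),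
                  ∑ i ∈ Finset.Ioo (Nk k x) j, f i x * g j x)‖}.encard : ℝ≥0∞))
              ^ (1 / t)) ^ (p * q / (p + q)) ≤ Filter.liminf (fun J => H J x ^ (p*q/(p+q))) Filter.atTop := by
    intro x
    set W := {k : ℕ | lam < ‖(∑ j ∈ Finset.Ioc (Nk k x) (Nk (k + 1) x),
                  ∑ i ∈ Finset.Ioo (Nk k x) j, f i x * g j x)‖} with hW
    have fin : ∀ T : Finset ℕ, (T : Set ℕ) ⊆ W → (ENNReal.ofReal lam * (T.card : ℝ≥0∞)^(1/t)) ^ (p*q/(p+q)) ≤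
        Filter.liminf (fun J => H J x ^ (p*q/(p+q))) Filter.atTop := by
      intro T hT
      refine Filter.le_liminf_of_le (by isBoundedDefault) ?_
      have ev : ∀ k ∈ T, ∀ᶠ J : ℕ in Filter.atTop, -(J:ℤ) ≤ Nk k x ∧ Nk (k+1) x ≤ J := by
        intro k _
        filter_upwards [Filter.eventually_ge_atTop (max (Nk k x).natAbs (Nk (k+1) x).natAbs)] with J hJ
        have h1 := (le_max_left _ _).trans hJ
        have h2 := (le_max_right _ _).trans hJ
        omega
      rw [← Filter.eventually_all_finset] at ev
      filter_upwards [ev] with J hJ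
      refine ENNReal.rpow_le_rpow ?_ hu0.le
      refine bH J x (fun k => Nk k x) (monotone_nat_of_le_succ fun k => hNk.2 k x) T ?_
      intro k hk
      refine ⟨(hJ k hk).1, ?_, hT hk⟩
      have := (hJ k hk).2
      push_cast
      omega
    rcases W.finite_or_infinite with hfin | hinf
    · have := fin hfin.toFinset (by simp)
      rw [hfin.encard_eq_coe_toFinset_card]
      simpa using this
    · rw [hinf.encard_eq]
      have cont : Continuous fun y : ℝ≥0∞ => (ENNReal.ofReal lam * y^(1/t)) ^ (p*q/(p+q)) :=
        ENNReal.continuous_rpow_const.comp ((ENNReal.continuous_const_mul ENNReal.ofReal_ne_top).comp ENNReal.continuous_rpow_const)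
      have lim := (cont.tendsto ⊤).comp ENNReal.tendsto_nat_nhds_top
      simp only [ENat.toENNReal_top]
      refine le_of_tendsto' lim fun n => ?_
      obtain ⟨T, hT, hTc⟩ := hinf.exists_subset_card_eq n
      have := fin T hT
      rw [hTc] at this
      exact this
  calc _ ≤ (∫⁻ x, Filter.liminf (fun J => H J x ^ (p*q/(p+q))) Filter.atTop) ^ ((p+q)/(p*q)) :=
        ENNReal.rpow_le_rpow (lintegral_mono point) hv0.le
    _ ≤ ((((C:ℝ≥0∞) * mixedNorm p r f * mixedNorm q s g)) ^ (p*q/(p+q))) ^ ((p+q)/(p*q)) := by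
        refine ENNReal.rpow_le_rpow ?_ hv0.le
        refine (lintegral_liminf_le fun J => (mH J).pow_const _).trans ?_
        refine Filter.liminf_le_of_le (by isBoundedDefault) ?_
        intro b hb
        obtain ⟨J, hJ⟩ := hb.exists
        refine hJ.trans ?_
        have := ENNReal.rpow_le_rpow (nH J) hu0.le
        rwa [← ENNReal.rpow_mul, huv, ENNReal.rpow_one] at this
    _ = (C:ℝ≥0∞) * mixedNorm p r f * mixedNorm q s g := by
        rw [← ENNReal.rpow_mul, mul_comm (p*q/(p+q)), huv, ENNReal.rpow_one]
    _ ≤ _ := by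
        gcongr
        simp

end
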